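/- Let Ω ⊂ (0,1) be a lacunary sequence converging to 0 and let {R_n}_{n∈ℕ} be a process such that for every n ∈ ℕ the slope of R_n belongs to Ω. Let 1 < p < ∞. Then there exist N ∈ ℕ and a constant C > 0 such that the N-truncated discrete maximal operator A*_N φ := sup_{n ≥ N} A_n|φ| satisfies ‖A*_N φ‖_{ℓ^p(ℤ²)} ≤ C ‖φ‖_{ℓ^p(ℤ²)} for every φ ∈ ℓ^p(ℤ²); consequently A* = sup_{n∈ℕ} A_n|·| is of weak-type (p,p) on ℓ^p(ℤ²). -/

import Mathlib

open MeasureTheory Filter Topology Set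
open scoped ENNReal Pointwise BigOperators

noncomputable section

/-- A (possibly tilted) closed rectangle in the plane, described by a corner,
an angle, and two positive side lengths. -/
structure Rect where
  corner : ℝ × ℝ
  angle : ℝ
  len1 : ℝ
  len2 : ℝ
  len1_pos : 0 < len1
  len2_pos : 0 < len2

namespace Rect

/-- The set of points of a rectangle. -/
def carrier (R : Rect) : Set (ℝ × ℝ) :=
  {p | ∃ s t : ℝ, s ∈ Icc (0 : ℝ) R.len1 ∧ t ∈ Icc (0 : ℝ) R.len2 ∧
    p = R.corner + s • (Real.cos R.angle, Real.sin R.angle) +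
      t • (-Real.sin R.angle, Real.cos R.angle)}

/-- `l(R)`: the length of the shortest side. -/
def shortSide (R : Rect) : ℝ := min R.len1 R.len2

/-- `L(R)`: the length of the longest side. -/
def longSide (R : Rect) : ℝ := max R.len1 R.len2

/-- The slope of a rectangle: the tangent of the angle formed between its longest
side and the horizontal axis (canonical choice for squares). -/
def slope (R : Rect) : ℝ :=
  if R.len2 ≤ R.len1 then Real.tan R.angle else Real.tan (R.angle + Real.pi / 2)

end Rect

/-- The integer lattice points lying in a planar set. -/
def latticePts (F : Set (ℝ × ℝ)) : Set (ℤ × ℤ) := {p | ((p.1 : ℝ), (p.2 : ℝ)) ∈ F}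

/-- `#(F ∩ ℤ²)`: the number of integer lattice points in `F`. -/
def latticeCount (F : Set (ℝ × ℝ)) : ℕ := (latticePts F).ncard

/-- A process: a sequence of rectangles containing `(0,0)` whose shortest sides
tend to infinity. -/
def IsProcess (R : ℕ → Rect) : Prop :=
  (∀ n, ((0 : ℝ), (0 : ℝ)) ∈ (R n).carrier) ∧
    Tendsto (fun n => (R n).shortSide) atTop atTop

variable {X : Type*} [MeasurableSpace X]

/-- The ergodic average `M_R f(x) = (1/#(R ∩ ℤ²)) ∑_{(i,j) ∈ R ∩ ℤ²} f(S^i T^j x)`. -/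
def ergAvg (S T : X ≃ᵐ X) (R : Rect) (f : X → ℝ) (x : X) : ℝ :=
  (latticeCount R.carrier : ℝ)⁻¹ *
    ∑ᶠ p ∈ latticePts R.carrier, f ((S.toEquiv ^ p.1) ((T.toEquiv ^ p.2) x))

/-- The maximal operator `M* f = sup_n M_n |f|`. -/
def maxOp (S T : X ≃ᵐ X) (R : ℕ → Rect) (f : X → ℝ) (x : X) : ℝ≥0∞ :=
  ⨆ n, ENNReal.ofReal (ergAvg S T (R n) (fun y => |f y|) x)

/-- The maximal operator `M'* f = sup_n |M_n f|`. -/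
def maxOpAbs (S T : X ≃ᵐ X) (R : ℕ → Rect) (f : X → ℝ) (x : X) : ℝ≥0∞ :=
  ⨆ n, ENNReal.ofReal |ergAvg S T (R n) f x|

/-- `S, T` form a pair of commuting, invertible, measure-preserving, ergodic
transformations of the probability space `(X, μ)`. -/
structure ErgodicSetup (μ : Measure X) (S T : X ≃ᵐ X) : Prop where
  prob : IsProbabilityMeasure μ
  measPres_S : MeasurePreserving (⇑S) μ μ
  measPres_T : MeasurePreserving (⇑T) μ μ
  comm : ∀ x, S (T x) = T (S x)
  erg_S : Ergodic (⇑S) μ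
  erg_T : Ergodic (⇑T) μ

/-- An operator `M` is of weak-type `(p,p)`. -/
def IsWeakType (μ : Measure X) (M : (X → ℝ) → X → ℝ≥0∞) (p : ℝ) : Prop :=
  ∃ C : ℝ, 0 < C ∧ ∀ f : X → ℝ, MemLp f (ENNReal.ofReal p) μ → ∀ lam : ℝ, 0 < lam →
    μ {x | ENNReal.ofReal lam < M f x} ≤
      ENNReal.ofReal (C * ((eLpNorm f (ENNReal.ofReal p) μ).toReal / lam) ^ p)

/-- The averages `M_n f` converge almost everywhere. -/
def AEConverges (μ : Measure X) (S T : X ≃ᵐ X) (R : ℕ → Rect) (f : X → ℝ) : Prop :=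
  ∀ᵐ x ∂μ, ∃ L : ℝ, Tendsto (fun n => ergAvg S T (R n) f x) atTop (𝓝 L)

/-- The maximal operator `M*` satisfies a Tauberian condition. -/
def ErgTauberian (μ : Measure X) (S T : X ≃ᵐ X) (R : ℕ → Rect) : Prop :=
  ∀ lam : ℝ, 0 < lam → lam < 1 → ∃ C : ℝ, 0 < C ∧ ∀ A : Set X, MeasurableSet A →
    0 < μ A → μ A < ⊤ →
    μ {x | ENNReal.ofReal lam < maxOp S T R (A.indicator fun _ => (1 : ℝ)) x} ≤
      ENNReal.ofReal C * μ A

/-- A `p`-good process: on every probability space with a commuting, invertible,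
measure-preserving, ergodic pair, the averages converge a.e. for every `f ∈ L^p`. -/
def IsGoodProcess (R : ℕ → Rect) (p : ℝ≥0∞) : Prop :=
  ∀ (Y : Type) [MeasurableSpace Y], ∀ (μ : Measure Y) (S T : Y ≃ᵐ Y),
    ErgodicSetup μ S T → ∀ f : Y → ℝ, MemLp f p μ → AEConverges μ S T R f

/-- The discrete average `A_R φ(k,l)`. -/
def discAvg (R : Rect) (φ : ℤ × ℤ → ℝ) (kl : ℤ × ℤ) : ℝ :=
  (latticeCount R.carrier : ℝ)⁻¹ *
    ∑ᶠ p ∈ latticePts R.carrier, φ (kl.1 + p.1, kl.2 + p.2)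

/-- The discrete maximal operator `A* φ = sup_n A_n |φ|`. -/
def discMaxOp (R : ℕ → Rect) (φ : ℤ × ℤ → ℝ) (kl : ℤ × ℤ) : ℝ≥0∞ :=
  ⨆ n, ENNReal.ofReal (discAvg (R n) (fun q => |φ q|) kl)

/-- The `N`-truncated discrete maximal operator `A*_N φ = sup_{n ≥ N} A_n |φ|`. -/
def discMaxOpFrom (R : ℕ → Rect) (N : ℕ) (φ : ℤ × ℤ → ℝ) (kl : ℤ × ℤ) : ℝ≥0∞ :=
  ⨆ n, ⨆ (_ : N ≤ n), ENNReal.ofReal (discAvg (R n) (fun q => |φ q|) kl)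

def lpSum (φ : ℤ × ℤ → ℝ) (p : ℝ) : ℝ≥0∞ := ∑' q : ℤ × ℤ, ENNReal.ofReal (|φ q| ^ p)

/-- `φ ∈ ℓ^p(ℤ²)`. -/
def Memlp (φ : ℤ × ℤ → ℝ) (p : ℝ) : Prop := lpSum φ p < ⊤

/-- The `ℓ^p(ℤ²)` norm. -/
def lpNorm (φ : ℤ × ℤ → ℝ) (p : ℝ) : ℝ≥0∞ := lpSum φ p ^ (1 / p)

/-- The `ℓ^p(ℤ²)` norm of an `ℝ≥0∞`-valued function. -/
def lpNormE (F : ℤ × ℤ → ℝ≥0∞) (p : ℝ) : ℝ≥0∞ := (∑' q : ℤ × ℤ, F q ^ p) ^ (1 / p)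

/-- A discrete operator `B` is of weak-type `(p,p)` on `ℓ^p(ℤ²)`. -/
def IsDiscWeakType (B : (ℤ × ℤ → ℝ) → ℤ × ℤ → ℝ≥0∞) (p : ℝ) : Prop :=
  ∃ C : ℝ, 0 < C ∧ ∀ φ : ℤ × ℤ → ℝ, Memlp φ p → ∀ lam : ℝ, 0 < lam →
    Measure.count {kl : ℤ × ℤ | ENNReal.ofReal lam ≤ B φ kl} ≤
      ENNReal.ofReal (C * ((lpNorm φ p).toReal / lam) ^ p)

/-- The discrete maximal operator associated with `R` satisfies a Tauberian condition. -/
def DiscTauberian (R : ℕ → Rect) : Prop :=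
  ∀ lam : ℝ, 0 < lam → ∃ C : ℝ, 0 < C ∧ ∀ E : Finset (ℤ × ℤ), E.Nonempty →
    Measure.count {kl : ℤ × ℤ |
        ENNReal.ofReal lam ≤ discMaxOp R (fun q => if q ∈ E then (1 : ℝ) else 0) kl} ≤
      ENNReal.ofReal C * (E.card : ℝ≥0∞)

/-- Vertices and sets of the geometric construction 1 (with `A = (1,0)`,
`B = (0,b)`, `C = (0,c)`). -/
def ptA : ℝ × ℝ := (1, 0)
def ptB (b : ℝ) : ℝ × ℝ := (0, b)
def ptC (c : ℝ) : ℝ × ℝ := (0, c)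
def ptB' (b : ℝ) : ℝ × ℝ := ptA + (3 / 2 : ℝ) • (ptB b - ptA)
def ptC' (c : ℝ) : ℝ × ℝ := ptA + (3 / 2 : ℝ) • (ptC c - ptA)

/-- The full triangle `ABC`. -/
def triABC (b c : ℝ) : Set (ℝ × ℝ) := convexHull ℝ {ptA, ptB b, ptC c}

/-- The full trapezium `BCC'B'`. -/
def trapV (b c : ℝ) : Set (ℝ × ℝ) := convexHull ℝ {ptB b, ptC c, ptC' c, ptB' b}

/-- The rectangle `P`: the smallest rectangle having `AC'` as one of its sides and
containing the triangle `AB'C'`, translated so that its center is the origin.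
Its sides have directions `(-1,c)/√(1+c²)` and `(c,1)/√(1+c²)`, with half-lengths
`(3/4)√(1+c²)` and `(3/4)(b-c)/√(1+c²)`. -/
def rectP (b c : ℝ) : Set (ℝ × ℝ) :=
  {p : ℝ × ℝ |
    |(-p.1 + c * p.2)| / Real.sqrt (1 + c ^ 2) ≤ (3 / 4) * Real.sqrt (1 + c ^ 2) ∧
    |(c * p.1 + p.2)| / Real.sqrt (1 + c ^ 2) ≤ (3 / 4) * (b - c) / Real.sqrt (1 + c ^ 2)}

/-- Horizontal translation of a planar set by `t`. -/
def hTranslate (t : ℝ) (F : Set (ℝ × ℝ)) : Set (ℝ × ℝ) :=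
  (fun p : ℝ × ℝ => (p.1 + t, p.2)) '' F

/-- The triangle `Δ_k` with vertices `A = (0,1)`, `B_{k-1} = (u_{k-1}, 0)`,
`B_k = (u_k, 0)`. -/
def triPerron (u : ℕ → ℝ) (k : ℕ) : Set (ℝ × ℝ) :=
  convexHull ℝ {((0 : ℝ), (1 : ℝ)), ((u (k - 1) : ℝ), (0 : ℝ)), ((u k : ℝ), (0 : ℝ))}

/-- The symmetric difference `Δ_n := R_n △ (R_n + (0,1))`. -/
def symmDiffTranslate (R : Rect) : Set (ℝ × ℝ) :=
  symmDiff R.carrier ((fun q : ℝ × ℝ => q + ((0 : ℝ), (1 : ℝ))) '' R.carrier)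


namespace LacMax
local notation "ENN" => ℝ≥0∞
open ENNReal (summable inner_le_weight_mul_Lp_of_nonneg rpow_inv_rpow rpow_add_of_nonneg rpow_one mul_rpow_of_nonneg tsum_le_tsum mul_iSup ofReal toReal_nonneg ofReal_rpow_of_nonneg ofReal_toReal ofReal_lt_iff_lt_toReal mul_top le_rpow_inv_iff le_tsum ofReal_div_of_pos ofReal_add ofReal_rpow_of_pos ofReal_mul measurable_ofReal mul_ne_top ofReal_one rpow_le_rpow ne_top_of_tsum_ne_top tsum_add rpow_ne_top_of_nonneg rpow_eq_zero_iff rpow_natCast rpow_mul rpow_add rpow_eq_top_iff div_le_of_le_mul one_le_rpow rpow_le_rpow_of_exponent_le zero_rpow_of_pos toReal_pos toReal_mono ofReal_le_ofReal natCast_ne_top tsum_prod' tsum_eq_iSup_sum rpow_two ofReal_sum_of_nonneg ofReal_natCast ofReal_ofNat)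
open Finset (sum_mul_sum mul_sum sum_add_distrib sum_mul sum_congr sum_coe_sort sum_le_sum_of_subset sum_image sum_range_add sum_range_succ sum_insert sum_comm sum_le_sum sum_const card_range sum_sub_distrib sum_div sum_le_sum_of_subset_of_nonneg range_mono sum_Ico_succ_top range_eq_Ico sum_nonneg card_univ le_sup sum_insertNone sum_product sum_le_card_nsmul single_le_sum)
abbrev Z2 := ℤ × ℤ
abbrev EF := Z2 → ENN
theorem tsum_holder {ι : Type*} {p q : ℝ} (hpq : p.HolderConjugate q) (f g : ι → ENN) :
    ∑' x, f x * g x ≤ (∑' x, f x ^ p) ^ (1/p) * (∑' x, g x ^ q) ^ (1/q) := by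
  let _ : MeasurableSpace ι := ⊤
  have h := ENNReal.lintegral_mul_le_Lp_mul_Lq (Measure.count : Measure ι) hpq
    (f := f) (g := g) measurable_from_top.aemeasurable measurable_from_top.aemeasurable
  simpa [lintegral_count] using h
def IsAvg (A : EF → EF) : Prop :=
  ∃ (ι : Type) (_ : Fintype ι) (w : ι → ENN) (v : ι → Z2), (∑ i, w i ≤ 1) ∧
    ∀ g x, A g x = ∑ i, w i * g (x + v i)
namespace IsAvg
variable {A B : EF → EF}
theorem comp (hA : IsAvg A) (hB : IsAvg B) : IsAvg (fun g => A (B g)) := by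
  obtain ⟨ι, _, w, v, hw, h⟩ := hA
  obtain ⟨κ, _, w', v', hw', h'⟩ := hB
  refine ⟨ι × κ, inferInstance, fun a => w a.1 * w' a.2, fun a => v a.1 + v' a.2, ?_, ?_⟩
  · rw [Fintype.sum_prod_type, ← sum_mul_sum]
    exact mul_le_one' hw hw'
  · intro g x
    beta_reduce
    rw [h, Fintype.sum_prod_type]
    simp only [h', mul_sum, add_assoc, mul_assoc]
theorem mono (hA : IsAvg A) {f g : EF} (h : f ≤ g) : A f ≤ A g := by
  obtain ⟨ι, _, w, v, hw, hh⟩ := hA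
  intro x; rw [hh, hh]; gcongr; exact h _
theorem add (hA : IsAvg A) (f g : EF) : A (f + g) = A f + A g := by
  obtain ⟨ι, _, w, v, hw, hh⟩ := hA
  funext x; simp only [hh, Pi.add_apply, mul_add, sum_add_distrib]
theorem smul (hA : IsAvg A) (c : ENN) (g : EF) (x : Z2) : A (fun y => c * g y) x = c * A g x := by
  obtain ⟨ι, _, w, v, hw, hh⟩ := hA
  simp only [hh, mul_sum, mul_left_comm]
theorem tsum (hA : IsAvg A) {κ : Type*} (f : κ → EF) (x : Z2) :
    A (fun y => ∑' k, f k y) x = ∑' k, A (f k) x := by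
  obtain ⟨ι, _, w, v, hw, hh⟩ := hA
  simp only [hh, ← ENNReal.tsum_mul_left]
  rw [Summable.tsum_finsetSum (fun _ _ => summable)]
theorem le_const (hA : IsAvg A) {f : EF} {c : ENN} (h : ∀ x, f x ≤ c) (x : Z2) : A f x ≤ c := by
  obtain ⟨ι, _, w, v, hw, hh⟩ := hA
  rw [hh]
  calc _ ≤ ∑ i, w i * c := by gcongr; exact h _
    _ = (∑ i, w i) * c := by rw [sum_mul]
    _ ≤ 1 * c := by gcongr
    _ = c := one_mul _
theorem jensen (hA : IsAvg A) {p : ℝ} (hp : 1 ≤ p) (f : EF) (x : Z2) :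
    (A f x) ^ p ≤ A (fun y => f y ^ p) x := by
  obtain ⟨ι, _, w, v, hw, hh⟩ := hA
  rw [hh, hh]
  have h := inner_le_weight_mul_Lp_of_nonneg Finset.univ hp w (fun i => f (x + v i))
  have hp0 : 0 < p := by linarith
  have h1 : (∑ i, w i) ^ (1 - p⁻¹) ≤ 1 := by
    apply ENNReal.rpow_le_one hw
    have : p⁻¹ ≤ 1 := inv_le_one_of_one_le₀ hp
    linarith
  calc _ ≤ ((∑ i, w i * f (x + v i) ^ p) ^ p⁻¹) ^ p := by
        gcongr
        refine h.trans ?_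
        calc _ ≤ 1 * (∑ i, w i * f (x + v i) ^ p) ^ p⁻¹ := by gcongr
          _ = _ := one_mul _
    _ = _ := rpow_inv_rpow hp0.ne' _
theorem holder (hA : IsAvg A) {p q : ℝ} (hpq : p.HolderConjugate q) (f g : EF) (x : Z2) :
    A (fun y => f y * g y) x ≤ (A (fun y => f y ^ p) x) ^ (1/p) * (A (fun y => g y ^ q) x) ^ (1/q) := by
  obtain ⟨ι, _, w, v, hw, hh⟩ := hA
  rw [hh, hh, hh]
  have h := ENNReal.inner_le_Lp_mul_Lq Finset.univ (fun i => w i ^ (1/p) * f (x + v i))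
    (fun i => w i ^ (1/q) * g (x + v i)) hpq
  have e1 : ∀ i, w i ^ (1/p) * f (x + v i) * (w i ^ (1/q) * g (x + v i))
      = w i * (f (x + v i) * g (x + v i)) := by
    intro i
    have : w i ^ (1/p) * w i ^ (1/q) = w i := by
      rw [← rpow_add_of_nonneg _ _ (by have := hpq.pos; positivity)
        (by have := hpq.symm.pos; positivity)]
      rw [one_div, one_div, hpq.inv_add_inv_eq_one, rpow_one]
    calc _ = (w i ^ (1/p) * w i ^ (1/q)) * (f (x + v i) * g (x + v i)) := by ring
      _ = _ := by rw [this]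
  have e2 : ∀ i, (w i ^ (1/p) * f (x + v i)) ^ p = w i * f (x + v i) ^ p := by
    intro i
    rw [mul_rpow_of_nonneg _ _ hpq.pos.le, one_div, rpow_inv_rpow hpq.pos.ne']
  have e3 : ∀ i, (w i ^ (1/q) * g (x + v i)) ^ q = w i * g (x + v i) ^ q := by
    intro i
    rw [mul_rpow_of_nonneg _ _ hpq.symm.pos.le, one_div, rpow_inv_rpow hpq.symm.pos.ne']
  simpa only [e1, e2, e3] using h
theorem tsum_rpow_le (hA : IsAvg A) {p : ℝ} (hp : 1 ≤ p) (f : EF) :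
    ∑' x, (A f x) ^ p ≤ ∑' x, f x ^ p := by
  refine (tsum_le_tsum (fun x => hA.jensen hp f x)).trans ?_
  obtain ⟨ι, _, w, v, hw, hh⟩ := hA
  simp only [hh]
  rw [Summable.tsum_finsetSum (fun _ _ => summable)]
  calc _ = ∑ i, w i * ∑' x, f x ^ p := by
        refine sum_congr rfl (fun i _ => ?_)
        rw [ENNReal.tsum_mul_left]
        congr 1
        exact (Equiv.addRight (v i)).tsum_eq (fun x => f x ^ p)
    _ ≤ 1 * ∑' x, f x ^ p := by rw [← sum_mul]; gcongr
    _ = _ := one_mul _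
end IsAvg
def IsMax (S : EF → EF) : Prop :=
  ∃ (ι : Type) (A : ι → EF → EF), (∀ i, IsAvg (A i)) ∧ ∀ g x, S g x = ⨆ i, A i g x
namespace IsMax
variable {S S' : EF → EF}
theorem of_family {ι : Type} (A : ι → EF → EF) (h : ∀ i, IsAvg (A i)) :
    IsMax (fun g x => ⨆ i, A i g x) := ⟨ι, A, h, fun _ _ => rfl⟩
theorem sup (h : IsMax S) (h' : IsMax S') : IsMax (fun g x => S g x ⊔ S' g x) := by
  obtain ⟨ι, A, hA, hS⟩ := h
  obtain ⟨κ, B, hB, hS'⟩ := h'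
  refine ⟨ι ⊕ κ, Sum.elim A B, ?_, ?_⟩
  · rintro (i|i) <;> simp [hA, hB]
  · intro g x; beta_reduce; rw [iSup_sum, hS, hS']; rfl
theorem iSup {κ : Type} {T : κ → EF → EF} (h : ∀ k, IsMax (T k)) :
    IsMax (fun g x => ⨆ k, T k g x) := by
  choose ι A hA hS using h
  refine ⟨Σ k, ι k, fun a => A a.1 a.2, fun a => hA _ _, ?_⟩
  intro g x
  rw [iSup_sigma]; simp only [hS]
theorem mono (h : IsMax S) {f g : EF} (hfg : f ≤ g) : S f ≤ S g := by
  obtain ⟨ι, A, hA, hS⟩ := h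
  intro x; rw [hS, hS]; exact iSup_mono fun i => (hA i).mono hfg x
theorem add_le (h : IsMax S) (f g : EF) : S (f + g) ≤ S f + S g := by
  obtain ⟨ι, A, hA, hS⟩ := h
  intro x; simp only [Pi.add_apply]; rw [hS]; refine iSup_le fun i => ?_
  rw [(hA i).add, hS, hS]
  exact add_le_add (le_iSup (fun i => A i f x) i) (le_iSup (fun i => A i g x) i)
theorem smul (h : IsMax S) (c : ENN) (g : EF) (x : Z2) : S (fun y => c * g y) x = c * S g x := by
  obtain ⟨ι, A, hA, hS⟩ := h
  rw [hS, hS, mul_iSup]; simp only [(hA _).smul]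
theorem tsum_le (h : IsMax S) {κ : Type*} (f : κ → EF) (x : Z2) :
    S (fun y => ∑' k, f k y) x ≤ ∑' k, S (f k) x := by
  obtain ⟨ι, A, hA, hS⟩ := h
  rw [hS]; refine iSup_le fun i => ?_
  rw [(hA i).tsum]
  refine tsum_le_tsum fun k => ?_
  rw [hS]; exact le_iSup (fun i => A i (f k) x) i
theorem sum_le (h : IsMax S) {κ : Type*} (s : Finset κ) (f : κ → EF) (x : Z2) :
    S (fun y => ∑ k ∈ s, f k y) x ≤ ∑ k ∈ s, S (f k) x := by
  have := h.tsum_le (fun k : s => f k) x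
  rw [Finset.tsum_subtype s (fun k => S (f k) x)] at this
  convert this using 2
  funext y
  exact (Finset.tsum_subtype s (fun k => f k y)).symm
theorem le_const (h : IsMax S) {f : EF} {c : ENN} (hf : ∀ x, f x ≤ c) (x : Z2) : S f x ≤ c := by
  obtain ⟨ι, A, hA, hS⟩ := h
  rw [hS]; exact iSup_le fun i => (hA i).le_const hf x
theorem holder (h : IsMax S) {p q : ℝ} (hpq : p.HolderConjugate q) (f g : EF) (x : Z2) :
    S (fun y => f y * g y) x ≤ (S (fun y => f y ^ p) x) ^ (1/p) * (S (fun y => g y ^ q) x) ^ (1/q) := by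
  have := hpq.pos
  have := hpq.symm.pos
  obtain ⟨ι, A, hA, hS⟩ := h
  rw [hS]; refine iSup_le fun i => ((hA i).holder hpq f g x).trans ?_
  rw [hS, hS]
  gcongr
  · exact le_iSup (fun i => A i (fun y => f y ^ p) x) i
  · exact le_iSup (fun i => A i (fun y => g y ^ q) x) i
theorem iterate_mono (h : IsMax S) (a : ℕ) {f g : EF} (hfg : f ≤ g) : S^[a] f ≤ S^[a] g := by
  induction a generalizing f g with
  | zero => simpa
  | succ a ih => rw [Function.iterate_succ_apply, Function.iterate_succ_apply]; exact ih (h.mono hfg)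
theorem iterate_smul (h : IsMax S) (a : ℕ) (c : ENN) (g : EF) :
    S^[a] (fun y => c * g y) = fun y => c * S^[a] g y := by
  induction a generalizing g with
  | zero => simp
  | succ a ih =>
    rw [Function.iterate_succ_apply, Function.iterate_succ_apply, ← ih]
    congr 1; funext x; exact h.smul c g x
theorem iterate_sum_le (h : IsMax S) (a : ℕ) {κ : Type*} (s : Finset κ) (f : κ → EF) (x : Z2) :
    S^[a] (fun y => ∑ k ∈ s, f k y) x ≤ ∑ k ∈ s, S^[a] (f k) x := by
  induction a generalizing f x with
  | zero => simp
  | succ a ih =>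
    rw [Function.iterate_succ_apply]
    refine (h.iterate_mono a (fun y => h.sum_le s f y) x).trans ?_
    refine (ih _ x).trans (le_of_eq ?_)
    simp only [Function.iterate_succ_apply]
end IsMax
def Bdd (p : ℝ) (S : EF → EF) (C : ENN) : Prop := ∀ g : EF, ∑' x, (S g x) ^ p ≤ C * ∑' x, g x ^ p
theorem Bdd.iterate {p : ℝ} {S : EF → EF} {C : ENN} (h : Bdd p S C) (a : ℕ) : Bdd p (S^[a]) (C ^ a) := by
  induction a with
  | zero => intro g; simp
  | succ a ih =>
    intro g
    rw [Function.iterate_succ_apply, pow_succ, mul_assoc]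
    exact (ih _).trans (by gcongr; exact h g)
theorem layer {q : ℝ} (hq : 0 < q) {a : ENN} (ha : a ≠ ⊤) :
    ofReal q * ∫⁻ t in Ioi (0:ℝ), (if ofReal t < a then ofReal (t^(q-1)) else 0) = a ^ q := by
  have h := MeasureTheory.lintegral_rpow_eq_lintegral_meas_lt_mul (Measure.dirac (0:ℕ))
    (f := fun _ => a.toReal) (ae_of_all _ fun _ => toReal_nonneg) aemeasurable_const hq
  rw [lintegral_dirac] at h
  rw [← ofReal_rpow_of_nonneg toReal_nonneg hq.le, ofReal_toReal ha] at h
  rw [h]; congr 1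
  refine setLIntegral_congr_fun measurableSet_Ioi (fun t ht => ?_)
  have e : ofReal t < a ↔ t < a.toReal := by
    rw [ofReal_lt_iff_lt_toReal (le_of_lt ht) ha]
  by_cases hta : t < a.toReal
  · simp [e, hta]
  · simp [e, hta]
theorem marcin {S : EF → EF} (hS : IsMax S) {p0 p : ℝ} (hp0 : 0 < p0) (hp : p0 < p) {C : ENN}
    (hw : ∀ (g : EF) (t : ℝ), 0 < t →
      ofReal t ^ p0 * Measure.count {x | ofReal t < S g x} ≤ C * ∑' x, g x ^ p0) :
    Bdd p S (ofReal (p * 2^p / (p - p0)) * (C + 1)) := by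
  intro f
  have hppos : 0 < p := hp0.trans hp
  have hd : 0 < p - p0 := by linarith
  by_cases hfin : ∑' x, f x ^ p = ⊤
  · rw [hfin, mul_top]; · exact le_top
    refine mul_ne_zero ?_ (by simp)
    rw [Ne, ENNReal.ofReal_eq_zero, not_le]; positivity
  set b := (∑' x, f x ^ p) ^ p⁻¹ with hb
  have hbt : b ≠ ⊤ := by simp [hb, hfin, hppos.le]
  have hfb : ∀ x, f x ≤ b := fun x => by
    rw [hb, le_rpow_inv_iff hppos]; exact le_tsum x
  have hSb : ∀ x, S f x ≠ ⊤ := fun x => ne_top_of_le_ne_top hbt (hS.le_const hfb x)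
  have hft : ∀ x, f x ≠ ⊤ := fun x => ne_top_of_le_ne_top hbt (hfb x)
  have key : ∀ t : ℝ, 0 < t → Measure.count {x | t < (S f x).toReal} * ofReal (t^(p-1)) ≤
      ∑' x, C * ofReal (2^p0) * f x ^ p0 *
        (if ofReal t < 2 * f x then ofReal (t^(p-p0-1)) else 0) := by
    intro t ht
    set g : EF := fun x => if ofReal t < 2 * f x then f x else 0 with hg
    have h1 : {x | t < (S f x).toReal} ⊆ {x | ofReal (t/2) < S g x} := by
      intro x hx
      simp only [mem_ofPred_eq] at hx ⊢
      rw [← ofReal_lt_iff_lt_toReal ht.le (hSb x)] at hx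
      by_contra! hc
      have h2 : f ≤ g + fun _ => ofReal (t/2) := by
        intro y
        simp only [hg, Pi.add_apply]
        split_ifs with h
        · exact le_self_add
        · rw [zero_add]
          rw [not_lt] at h
          rw [ofReal_div_of_pos (by norm_num), ENNReal.le_div_iff_mul_le (by simp) (by simp)]
          simpa [mul_comm] using h
      have h3 := (hS.mono h2 x).trans (hS.add_le _ _ x)
      simp only [Pi.add_apply] at h3
      have h4 : S (fun _ => ofReal (t/2)) x ≤ ofReal (t/2) := hS.le_const (fun _ => le_rfl) x
      have h5 : S f x ≤ ofReal (t/2) + ofReal (t/2) := h3.trans (add_le_add hc h4)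
      rw [← ofReal_add (by positivity) (by positivity), add_halves] at h5
      exact absurd hx (not_lt.2 h5)
    have h2 := hw g (t/2) (by positivity)
    rw [ofReal_rpow_of_pos (by positivity)] at h2
    have e1 : ofReal (t^(p-1)) = ofReal (2^p0) * ofReal (t^(p-p0-1)) * ofReal ((t/2)^p0) := by
      rw [← ofReal_mul (by positivity), ← ofReal_mul (by positivity)]
      congr 1
      rw [Real.div_rpow ht.le (by norm_num)]
      have : t^(p-1) = t^(p-p0-1) * t^p0 := by rw [← Real.rpow_add ht]; congr 1; ring
      rw [this]
      field_simp
    calc _ ≤ Measure.count {x | ofReal (t/2) < S g x} * ofReal (t^(p-1)) := by gcongr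
      _ = ofReal (2^p0) * ofReal (t^(p-p0-1)) * (ofReal ((t/2)^p0) * Measure.count {x | ofReal (t/2) < S g x}) := by
        rw [e1]; ring
      _ ≤ ofReal (2^p0) * ofReal (t^(p-p0-1)) * (C * ∑' x, g x ^ p0) := by gcongr
      _ = _ := by
        rw [← mul_assoc, ← ENNReal.tsum_mul_left]
        refine tsum_congr fun x => ?_
        simp only [hg]
        split_ifs
        · ring
        · simp [hp0]
  have h0 := MeasureTheory.lintegral_rpow_eq_lintegral_meas_lt_mul (Measure.count : Measure Z2)
    (f := fun x => (S f x).toReal) (ae_of_all _ fun _ => toReal_nonneg)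
    (measurable_of_countable _).aemeasurable hppos
  rw [lintegral_count] at h0
  have e0 : ∀ x, ofReal ((S f x).toReal ^ p) = S f x ^ p := fun x => by
    rw [← ofReal_rpow_of_nonneg toReal_nonneg hppos.le, ofReal_toReal (hSb x)]
  simp only [e0] at h0
  rw [h0]
  have mm : ∀ x : Z2, Measurable fun t : ℝ => (if ofReal t < 2 * f x then ofReal (t^(p-p0-1)) else 0) := by
    intro x
    refine Measurable.ite ?_ (by fun_prop) measurable_const
    exact measurableSet_lt measurable_ofReal measurable_const
  calc _ ≤ ofReal p * ∫⁻ t in Ioi (0:ℝ), ∑' x, C * ofReal (2^p0) * f x ^ p0 *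
        (if ofReal t < 2 * f x then ofReal (t^(p-p0-1)) else 0) := by
        gcongr ofReal p * ?_
        exact setLIntegral_mono' measurableSet_Ioi key
    _ = ofReal p * ∑' x, C * ofReal (2^p0) * f x ^ p0 * ∫⁻ t in Ioi (0:ℝ),
        (if ofReal t < 2 * f x then ofReal (t^(p-p0-1)) else 0) := by
        rw [lintegral_tsum (fun x => ((mm x).const_mul _).aemeasurable)]
        simp_rw [lintegral_const_mul _ (mm _)]
    _ = ofReal (p * 2^p / (p - p0)) * C * ∑' x, f x ^ p := by
        rw [← ENNReal.tsum_mul_left, ← ENNReal.tsum_mul_left]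
        refine tsum_congr fun x => ?_
        have hl := layer hd (a := 2 * f x) (mul_ne_top (by simp) (hft x))
        have hl' : (∫⁻ t in Ioi (0:ℝ), (if ofReal t < 2 * f x then ofReal (t^(p-p0-1)) else 0))
            = ofReal (1/(p-p0)) * (2 * f x) ^ (p-p0) := by
          rw [← hl, ← mul_assoc, ← ofReal_mul (by positivity)]
          rw [one_div_mul_cancel hd.ne', ofReal_one, one_mul]
        rw [hl', mul_rpow_of_nonneg _ _ hd.le]
        have e2 : (2:ENN) ^ (p-p0) = ofReal (2^(p-p0)) := by
          rw [← ofReal_rpow_of_pos (by norm_num)]; simp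
        have e3 : f x ^ p = f x ^ p0 * f x ^ (p-p0) := by
          rw [← rpow_add_of_nonneg _ _ hp0.le hd.le]; congr 1; ring
        have e4 : ofReal (p * 2^p / (p - p0)) = ofReal p * ofReal (2^p0) * ofReal (1/(p-p0)) * ofReal (2^(p-p0)) := by
          rw [← ofReal_mul (by positivity), ← ofReal_mul (by positivity), ← ofReal_mul (by positivity)]
          congr 1
          have : (2:ℝ)^p = 2^p0 * 2^(p-p0) := by rw [← Real.rpow_add (by norm_num)]; congr 1; ring
          rw [this]; field_simp
        rw [e2, e3, e4]; ring
    _ ≤ _ := by gcongr; exact le_self_add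
theorem Bdd.weak {S : EF → EF} {p : ℝ} (hp : 0 < p) {C : ENN} (h : Bdd p S C) (g : EF) (t : ℝ) (ht : 0 < t) :
      ofReal t ^ p * Measure.count {x | ofReal t < S g x} ≤ C * ∑' x, g x ^ p := by
  refine le_trans ?_ (h g)
  rw [← lintegral_count]
  refine le_trans ?_ (mul_meas_ge_le_lintegral (measurable_of_countable _) (ofReal t ^ p))
  refine mul_le_mul_right (measure_mono fun x hx => ?_) _
  exact rpow_le_rpow (le_of_lt hx) hp.le
theorem Bdd.interp {S : EF → EF} (hS : IsMax S) {p0 p : ℝ} (hp0 : 0 < p0) (hp : p0 < p) {C : ENN}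
    (h : Bdd p0 S C) : Bdd p S (ofReal (p * 2^p / (p - p0)) * (C + 1)) :=
  marcin hS hp0 hp (h.weak hp0)
def bx (v : Z2) (N : ℕ) (g : EF) (x : Z2) : ENN := (N:ENN)⁻¹ * ∑ a ∈ Finset.range N, g (x + (a:ℤ) • v)
def bl (v : Z2) (N : ℕ) (g : EF) (x : Z2) : ENN :=
  ((2*N+1 : ℕ):ENN)⁻¹ * ∑ t ∈ Finset.Icc (-(N:ℤ)) N, g (x + t • v)
theorem isAvg_finset {κ : Type} (s : Finset κ) (v : κ → Z2) (c : ENN) (hc : c * s.card ≤ 1) :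
    IsAvg (fun g x => c * ∑ i ∈ s, g (x + v i)) := by
  refine ⟨s, inferInstance, fun _ => c, fun i => v i, ?_, ?_⟩
  · simpa [mul_comm] using hc
  · intro g x
    beta_reduce
    rw [mul_sum, ← sum_coe_sort]
theorem isAvg_bx (v : Z2) (N : ℕ) : IsAvg (bx v N) := by
  refine isAvg_finset (Finset.range N) (fun a => (a:ℤ) • v) _ ?_
  simp [ENNReal.inv_mul_le_one]
theorem isAvg_bl (v : Z2) (N : ℕ) : IsAvg (bl v N) := by
  refine isAvg_finset (Finset.Icc (-(N:ℤ)) N) (fun a => a • v) _ ?_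
  have : (Finset.Icc (-(N:ℤ)) N).card = 2*N+1 := by simp; omega
  rw [this]; exact ENNReal.inv_mul_le_one _
theorem garsia (v : Z2) (g : EF) (lam : ENN) (h0 : lam ≠ 0) (ht : lam ≠ ⊤) (N : ℕ) :
    lam * Measure.count {x | ∃ n, n < N ∧ ((n+1 : ℕ):ENN) * lam < ∑ a ∈ Finset.range (n+1), g (x + (a:ℤ) • v)}
      ≤ ∑' x, g x := by
  by_cases hg : ∑' x, g x = ⊤
  · rw [hg]; exact le_top
  set E := {x | ∃ n, n < N ∧ ((n+1 : ℕ):ENN) * lam < ∑ a ∈ Finset.range (n+1), g (x + (a:ℤ) • v)} with hE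
  set F : EF := fun x => ⨆ n ∈ Finset.range (N+1), (∑ a ∈ Finset.range n, g (x + (a:ℤ) • v) - n * lam) with hF
  have hgx : ∀ x, g x ≠ ⊤ := fun x => ne_top_of_tsum_ne_top hg x
  have hFsum : ∑' x, F x ≠ ⊤ := by
    have h1 : ∀ x, F x ≤ ∑ a ∈ Finset.range N, g (x + (a:ℤ) • v) := by
      intro x
      refine iSup₂_le fun n hn => tsub_le_self.trans ?_
      refine sum_le_sum_of_subset ?_
      intro a ha; simp at ha hn ⊢; omega
    have h2 : ∑' x, ∑ a ∈ Finset.range N, g (x + (a:ℤ) • v) = N * ∑' x, g x := by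
      rw [Summable.tsum_finsetSum (fun _ _ => summable)]
      have : ∀ a ∈ Finset.range N, ∑' x, g (x + (a:ℤ) • v) = ∑' x, g x := fun a _ =>
        (Equiv.addRight ((a:ℤ) • v)).tsum_eq g
      rw [sum_congr rfl this]; simp
    refine ne_top_of_le_ne_top ?_ (tsum_le_tsum h1)
    rw [h2]; exact mul_ne_top (by simp) hg
  have step : ∀ x n, ∑ a ∈ Finset.range (n+1), g (x + (a:ℤ) • v) = g x + ∑ a ∈ Finset.range n, g ((x + v) + (a:ℤ) • v) := by
    intro x n
    rw [Finset.sum_range_succ', add_comm]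
    congr 1
    · simp
    · refine sum_congr rfl fun a _ => ?_
      congr 1; push_cast; rw [add_smul, one_smul]; abel
  have hle : ∀ x n, n < N → ((n+1 : ℕ):ENN) * lam ≤ ∑ a ∈ Finset.range (n+1), g (x + (a:ℤ) • v) →
      (∑ a ∈ Finset.range (n+1), g (x + (a:ℤ) • v) - ((n+1 : ℕ):ENN) * lam) + lam ≤ g x + F (x+v) := by
    intro x n hn h
    have h1 : ∑ a ∈ Finset.range n, g ((x + v) + (a:ℤ) • v) ≤ F (x+v) + n * lam := by
      rw [← tsub_le_iff_right]
      exact le_iSup₂ (f := fun n (_ : n ∈ Finset.range (N+1)) => (∑ a ∈ Finset.range n, g ((x+v) + (a:ℤ) • v) - n * lam)) n (by simp; omega)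
    have hfin : (n:ENN) * lam ≠ ⊤ := mul_ne_top (by simp) ht
    rw [← ENNReal.add_le_add_iff_right hfin, add_assoc]
    have : lam + n * lam = ((n+1:ℕ):ENN) * lam := by push_cast; ring
    rw [this, tsub_add_cancel_of_le h, step, add_assoc]
    gcongr
  have hpt : ∀ x ∈ E, F x + lam ≤ g x + F (x + v) := by
    rintro x ⟨m, hm, hlt⟩
    have h1 := hle x m hm hlt.le
    have h2 : F x + lam = ⨆ n ∈ Finset.range (N+1), ((∑ a ∈ Finset.range n, g (x + (a:ℤ) • v) - n * lam) + lam) :=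
      ENNReal.biSup_add' (p := fun n => n ∈ Finset.range (N+1)) ⟨0, by simp⟩ _
    rw [h2]
    refine iSup₂_le fun n hn => ?_
    rcases n with _ | n
    · simp only [Finset.range_zero, Finset.sum_empty, zero_tsub, zero_add]
      exact le_add_self.trans h1
    · simp only [Finset.mem_range] at hn
      by_cases hh : ((n+1 : ℕ):ENN) * lam ≤ ∑ a ∈ Finset.range (n+1), g (x + (a:ℤ) • v)
      · exact hle x n (by omega) hh
      · rw [tsub_eq_zero_of_le (not_le.1 hh).le, zero_add]
        exact le_add_self.trans h1
  have hz : ∀ x, x ∉ E → F x = 0 := by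
    intro x hx
    rw [hF]; beta_reduce
    simp only [ENNReal.iSup_eq_zero]
    intro n hn
    rcases n with _ | n
    · simp
    · simp only [Finset.mem_range] at hn
      refine tsub_eq_zero_of_le ?_
      by_contra hc
      exact hx ⟨n, by omega, not_le.1 hc⟩
  have hs : ∑' x, F x + lam * Measure.count E ≤ ∑' x, g x + ∑' x, F x := by
    calc _ = ∑' x, (F x + E.indicator (fun _ => lam) x) := by
          rw [tsum_add]
          congr 1
          rw [← lintegral_count, lintegral_indicator_const (Set.to_countable E).measurableSet]
      _ ≤ ∑' x, (g x + F (x+v)) := by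
          refine tsum_le_tsum fun x => ?_
          by_cases hx : x ∈ E
          · rw [indicator_of_mem hx]; exact hpt x hx
          · rw [indicator_of_notMem hx, hz x hx]; simp
      _ = _ := by
          rw [tsum_add]
          congr 1
          exact (Equiv.addRight v).tsum_eq F
  rw [add_comm] at hs
  exact (ENNReal.add_le_add_iff_right hFsum).1 hs
def Mplus (v : Z2) (g : EF) (x : Z2) : ENN := ⨆ N : ℕ, bx v N g x
def Mv (v : Z2) (g : EF) (x : Z2) : ENN := ⨆ N : ℕ, bl v N g x
theorem isMax_Mplus (v : Z2) : IsMax (Mplus v) := ⟨ℕ, bx v, isAvg_bx v, fun _ _ => rfl⟩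
theorem isMax_Mv (v : Z2) : IsMax (Mv v) := ⟨ℕ, bl v, isAvg_bl v, fun _ _ => rfl⟩
theorem Mplus_weak (v : Z2) (g : EF) (t : ℝ) (ht : 0 < t) :
    ofReal t ^ (1:ℝ) * Measure.count {x | ofReal t < Mplus v g x} ≤ 1 * ∑' x, g x ^ (1:ℝ) := by
  simp only [rpow_one, one_mul]
  set U : ℕ → Set Z2 := fun N => {x | ∃ n, n < N ∧ ((n+1 : ℕ):ENN) * ofReal t < ∑ a ∈ Finset.range (n+1), g (x + (a:ℤ) • v)} with hU
  have hmono : Monotone U := by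
    rintro a b hab x ⟨n, hn, h⟩
    exact ⟨n, by omega, h⟩
  have hsub : {x | ofReal t < Mplus v g x} ⊆ ⋃ N, U N := by
    intro x hx
    simp only [Mplus, mem_ofPred_eq, lt_iSup_iff] at hx
    obtain ⟨N, hN⟩ := hx
    rcases N with _ | N
    · simp [bx] at hN
    · refine mem_iUnion.2 ⟨N+1, N, by omega, ?_⟩
      rw [bx, mul_comm, ← div_eq_mul_inv, ENNReal.lt_div_iff_mul_lt] at hN
      · rwa [mul_comm] at hN
      all_goals simp
  calc _ ≤ ofReal t * Measure.count (⋃ N, U N) := by gcongr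
    _ = ⨆ N, ofReal t * Measure.count (U N) := by
      rw [hmono.measure_iUnion, mul_iSup]
    _ ≤ _ := iSup_le fun N => garsia v g _ (by simpa using ht) (by simp) N
theorem Mv_le (v : Z2) (g : EF) (x : Z2) : Mv v g x ≤ Mplus v g x + Mplus (-v) g x := by
  refine iSup_le fun N => ?_
  refine le_trans ?_ (add_le_add (le_iSup (fun N => bx v N g x) (N+1)) (le_iSup (fun N => bx (-v) N g x) (N+1)))
  rw [bl, bx, bx, ← mul_add]
  gcongr
  · omega
  · have h1 : Finset.Icc (-(N:ℤ)) N ⊆ (Finset.range (N+1)).image (fun a : ℕ => (a:ℤ)) ∪ (Finset.range (N+1)).image (fun a : ℕ => -(a:ℤ)) := by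
      intro t ht
      simp only [Finset.mem_Icc, Finset.mem_union, Finset.mem_image, Finset.mem_range] at *
      rcases le_total 0 t with h | h
      · left; exact ⟨t.toNat, by omega, by omega⟩
      · right; exact ⟨(-t).toNat, by omega, by omega⟩
    refine (sum_le_sum_of_subset h1).trans ?_
    refine (le_self_add.trans (Finset.sum_union_inter).le).trans ?_
    · gcongr
      · rw [sum_image (by simp)]
      · rw [sum_image (by simp)]; simp
def hlC (p : ℝ) : ENN := 2^p * (4 * ofReal (p * 2^p / (p - 1)))
theorem hlC_ne_top {p : ℝ} (hp : 0 ≤ p) : hlC p ≠ ⊤ := by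
  unfold hlC
  refine mul_ne_top ?_ (mul_ne_top (by simp) (by simp))
  exact rpow_ne_top_of_nonneg hp (by simp)
theorem add_rpow_le_two {p : ℝ} (hp : 0 ≤ p) (a b : ENN) : (a + b) ^ p ≤ 2^p * (a^p + b^p) := by
  rcases le_total a b with h | h
  · calc (a+b)^p ≤ (2*b)^p := by gcongr; rw [two_mul]; gcongr
      _ = 2^p * b^p := mul_rpow_of_nonneg _ _ hp
      _ ≤ _ := by gcongr; exact le_add_self
  · calc (a+b)^p ≤ (2*a)^p := by gcongr; rw [two_mul]; gcongr
      _ = 2^p * a^p := mul_rpow_of_nonneg _ _ hp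
      _ ≤ _ := by gcongr; exact le_self_add
theorem Mv_bdd (v : Z2) {p : ℝ} (hp : 1 < p) : Bdd p (Mv v) (hlC p) := by
  intro g
  have h1 := marcin (isMax_Mplus v) one_pos hp (Mplus_weak v) g
  have h2 := marcin (isMax_Mplus (-v)) one_pos hp (Mplus_weak (-v)) g
  have hp0 : 0 ≤ p := by linarith
  calc _ ≤ ∑' x, 2^p * (Mplus v g x ^ p + Mplus (-v) g x ^ p) := by
        refine tsum_le_tsum fun x => ?_
        refine le_trans ?_ (add_rpow_le_two hp0 _ _)
        gcongr; exact Mv_le v g x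
    _ ≤ 2^p * (ofReal (p * 2^p / (p - 1)) * (1+1) * ∑' x, g x ^ p + ofReal (p * 2^p / (p - 1)) * (1+1) * ∑' x, g x ^ p) := by
        rw [ENNReal.tsum_mul_left, tsum_add]
        gcongr
    _ = _ := by rw [hlC]; ring
theorem rdf {S : EF → EF} (hS : IsMax S) {p : ℝ} (hp : 1 < p) {N0 : ENN} (hN1 : 1 ≤ N0) (hNt : N0 ≠ ⊤)
    (hb : Bdd p S N0) (g : EF) :
    ∃ W : EF, g ≤ W ∧ (∀ x, S W x ≤ 2 * N0 ^ (1/p) * W x) ∧ ∑' x, W x ^ p ≤ 2^p * ∑' x, g x ^ p := by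
  have hp0 : 0 < p := by linarith
  set c := N0 ^ (1/p) with hc
  have hN0 : N0 ≠ 0 := (lt_of_lt_of_le one_pos hN1).ne'
  have hc0 : c ≠ 0 := by simp [hc, rpow_eq_zero_iff, hN0, hNt]
  have hct : c ≠ ⊤ := rpow_ne_top_of_nonneg (by positivity) hNt
  have hcp : c ^ p = N0 := by rw [hc, one_div, rpow_inv_rpow hp0.ne']
  have h2c0 : 2 * c ≠ 0 := mul_ne_zero (by simp) hc0
  have h2ct : 2 * c ≠ ⊤ := mul_ne_top (by simp) hct
  refine ⟨fun x => ∑' j : ℕ, ((2*c)⁻¹)^j * S^[j] g x, ?_, ?_, ?_⟩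
  · intro x
    refine le_trans ?_ (le_tsum 0)
    simp
  · intro x
    refine (hS.tsum_le (fun j y => ((2*c)⁻¹)^j * S^[j] g y) x).trans ?_
    rw [← ENNReal.tsum_mul_left]
    calc _ = ∑' j : ℕ, (2 * c) * (((2*c)⁻¹)^(j+1) * S^[j+1] g x) := by
          refine tsum_congr fun j => ?_
          rw [hS.smul, pow_succ', ← mul_assoc, ← mul_assoc, ENNReal.mul_inv_cancel h2c0 h2ct, one_mul,
            Function.iterate_succ_apply']
      _ ≤ _ := ENNReal.tsum_comp_le_tsum_of_injective (add_left_injective 1) (fun j => (2 * c) * (((2*c)⁻¹)^j * S^[j] g x))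
  · have hgeo : ∑' j : ℕ, (2:ENN)⁻¹ ^ j = 2 := by
      rw [ENNReal.tsum_geometric]; simp
    have hjen : ∀ x, (∑' j : ℕ, ((2*c)⁻¹)^j * S^[j] g x) ^ p ≤ 2^(p-1) * ∑' j : ℕ, (2:ENN)⁻¹^j * (N0⁻¹ ^ j * (S^[j] g x) ^ p) := by
      intro x
      have hq := Real.HolderConjugate.conjExponent hp
      set q := p.conjExponent
      have hqp := hq.symm.pos
      have h := tsum_holder hq.symm (fun j : ℕ => ((2:ENN)⁻¹^j)^(1/q)) (fun j : ℕ => ((2:ENN)⁻¹^j)^(1/p) * (c⁻¹ ^ j * S^[j] g x))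
      have e1 : ∀ j : ℕ, (((2:ENN)⁻¹^j)^(1/q)) ^ q = (2:ENN)⁻¹ ^ j := fun j => by
        rw [one_div, rpow_inv_rpow hqp.ne']
      have e2 : ∀ j : ℕ, (((2:ENN)⁻¹^j)^(1/p) * (c⁻¹ ^ j * S^[j] g x)) ^ p = (2:ENN)⁻¹^j * (N0⁻¹ ^ j * (S^[j] g x) ^ p) := fun j => by
        rw [mul_rpow_of_nonneg _ _ hp0.le, one_div, rpow_inv_rpow hp0.ne',
          mul_rpow_of_nonneg _ _ hp0.le]
        congr 2
        rw [← rpow_natCast, ← rpow_mul, mul_comm (j:ℝ) p, rpow_mul, ENNReal.inv_rpow, hcp, rpow_natCast]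
      have e3 : ∀ j : ℕ, ((2:ENN)⁻¹^j)^(1/q) * (((2:ENN)⁻¹^j)^(1/p) * (c⁻¹ ^ j * S^[j] g x)) = ((2*c)⁻¹)^j * S^[j] g x := fun j => by
        rw [← mul_assoc, ← rpow_add_of_nonneg _ _ (by positivity) (by positivity), one_div, one_div,
          hq.symm.inv_add_inv_eq_one, rpow_one, ← mul_assoc, ← mul_pow, ENNReal.mul_inv (by simp) (by simp)]
      simp only [e1, e2, e3, hgeo] at h
      calc _ ≤ (2 ^ (1/q) * (∑' j : ℕ, (2:ENN)⁻¹^j * (N0⁻¹ ^ j * (S^[j] g x) ^ p)) ^ (1/p)) ^ p := by gcongr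
        _ = _ := by
          rw [mul_rpow_of_nonneg _ _ hp0.le, one_div, one_div, rpow_inv_rpow hp0.ne', ← rpow_mul]
          congr 2
          have := hq.inv_add_inv_eq_one
          have : q⁻¹ = 1 - p⁻¹ := by linarith
          rw [this]; field_simp
    calc _ ≤ ∑' x, 2^(p-1) * ∑' j : ℕ, (2:ENN)⁻¹^j * (N0⁻¹ ^ j * (S^[j] g x) ^ p) := tsum_le_tsum hjen
      _ = 2^(p-1) * ∑' j : ℕ, (2:ENN)⁻¹^j * (N0⁻¹ ^ j * ∑' x, (S^[j] g x) ^ p) := by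
        rw [ENNReal.tsum_mul_left, ENNReal.tsum_comm]; simp_rw [ENNReal.tsum_mul_left]
      _ ≤ 2^(p-1) * ∑' j : ℕ, (2:ENN)⁻¹^j * ∑' x, g x ^ p := by
        gcongr with j
        calc _ ≤ N0⁻¹ ^ j * (N0 ^ j * ∑' x, g x ^ p) := by gcongr; exact hb.iterate j g
          _ = _ := by rw [← mul_assoc, ← mul_pow, ENNReal.inv_mul_cancel hN0 hNt, one_pow, one_mul]
      _ = _ := by
        rw [ENNReal.tsum_mul_right, hgeo, ← mul_assoc]
        congr 1
        nth_rewrite 2 [← rpow_one 2]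
        rw [← rpow_add _ _ (by simp) (by simp)]; congr 1; ring
theorem weighted {S : EF → EF} (hS : IsMax S) {s : ℝ} (hs : 1 < s) {N1 B : ENN}
    (hb : Bdd (2 - 1/s) S N1) (W : EF) (hW0 : ∀ x, W x ≠ 0) (hWt : ∀ x, W x ≠ ⊤)
    (hSW : ∀ x, S W x ≤ B * W x) (g : EF) :
    ∑' x, (S g x) ^ (2:ℝ) / (W x) ^ (1/s) ≤ B ^ (1/s) * N1 * ∑' x, (g x) ^ (2:ℝ) / (W x) ^ (1/s) := by
  set t := 2 * s / (2 * s - 1) with ht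
  have hs0 : 0 < s := by linarith
  have hd : 0 < 2 * s - 1 := by linarith
  have htpos : 0 < t := by positivity
  have hconj : t.HolderConjugate (2*s) := by
    rw [Real.holderConjugate_iff]
    constructor
    · rw [ht, lt_div_iff₀ hd]; linarith
    · rw [ht]; field_simp; ring
  have h2t : 2 / t = 2 - 1/s := by rw [ht]; field_simp
  set h : EF := fun x => (g x / (W x) ^ (1/(2*s))) ^ t with hh
  have w0 : ∀ x (a : ℝ), W x ^ a ≠ 0 := fun x a => by simp [rpow_eq_zero_iff, hW0, hWt]
  have wt : ∀ x (a : ℝ), W x ^ a ≠ ⊤ := fun x a => by simp [rpow_eq_top_iff, hW0, hWt]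
  have key : ∀ x, (S g x)^(2:ℝ) / (W x)^(1/s) ≤ B ^ (1/s) * (S h x) ^ (2 - 1/s) := by
    intro x
    have h1 := hS.holder hconj (fun y => g y / (W y) ^ (1/(2*s))) (fun y => (W y) ^ (1/(2*s))) x
    have e1 : (fun y => g y / (W y) ^ (1/(2*s)) * (W y) ^ (1/(2*s))) = g := by
      funext y; exact ENNReal.div_mul_cancel (w0 y _) (wt y _)
    have e2 : (fun y => ((W y) ^ (1/(2*s))) ^ (2*s)) = W := by
      funext y; rw [one_div, rpow_inv_rpow (by positivity)]
    rw [e1, e2] at h1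
    refine div_le_of_le_mul ?_
    calc (S g x)^(2:ℝ) ≤ ((S h x)^(1/t) * (B * W x) ^ (1/(2*s))) ^ (2:ℝ) := by
          gcongr; refine h1.trans ?_; gcongr; exact hSW x
      _ = (S h x)^(2/t) * (B * W x) ^ (1/s) := by
          rw [mul_rpow_of_nonneg _ _ (by norm_num), ← rpow_mul, ← rpow_mul]
          congr 2
          · ring
          · field_simp
      _ = _ := by rw [h2t, mul_rpow_of_nonneg _ _ (by positivity)]; ring
  calc _ ≤ ∑' x, B ^ (1/s) * (S h x) ^ (2 - 1/s) := tsum_le_tsum key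
    _ = B ^ (1/s) * ∑' x, (S h x) ^ (2 - 1/s) := ENNReal.tsum_mul_left
    _ ≤ B ^ (1/s) * (N1 * ∑' x, (h x) ^ (2 - 1/s)) := by gcongr; exact hb h
    _ = _ := by
      rw [mul_assoc]
      congr 3; funext x
      rw [hh, ← h2t, ← rpow_mul]
      have : t * (2/t) = 2 := by field_simp
      rw [this, ENNReal.div_rpow_of_nonneg _ _ (by norm_num), ← rpow_mul]
      congr 2; field_simp
theorem exists_pos_small (p : ℝ) (hp : 0 < p) : ∃ g : EF, (∀ x, g x ≠ 0) ∧ ∑' x, g x ^ p ≤ 1 := by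
  obtain ⟨e, he, hs⟩ := ENNReal.exists_pos_sum_of_countable' (ε := 1) (by simp) Z2
  refine ⟨fun x => e x ^ p⁻¹, fun x => ?_, ?_⟩
  · have := (he x).ne'
    have h2 : e x ≠ ⊤ := ne_top_of_tsum_ne_top (ne_top_of_lt hs) x
    simp [rpow_eq_zero_iff, this, h2]
  · simp only [rpow_inv_rpow hp.ne']; exact hs.le
structure GoodW (𝒮 : Set (EF → EF)) (B : ENN) (w : EF) : Prop where
  ne_zero : ∀ x, w x ≠ 0
  ne_top : ∀ x, w x ≠ ⊤
  a1 : ∀ S ∈ 𝒮, ∀ x, S w x ≤ B * w x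
  l2 : ∀ S ∈ 𝒮, ∀ g : EF, ∑' x, (S g x) ^ (2:ℝ) / w x ≤ B * ∑' x, (g x) ^ (2:ℝ) / w x
theorem IsMax.jensen {S : EF → EF} (h : IsMax S) {p : ℝ} (hp : 1 ≤ p) (f : EF) (x : Z2) :
    (S f x) ^ p ≤ S (fun y => f y ^ p) x := by
  obtain ⟨ι, A, hA, hS⟩ := h
  have hp0 : 0 < p := by linarith
  rw [← le_rpow_inv_iff hp0, hS]
  refine iSup_le fun i => ?_
  rw [le_rpow_inv_iff hp0, hS]
  exact ((hA i).jensen hp f x).trans (le_iSup (fun i => A i (fun y => f y ^ p) x) i)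
theorem extrap_lt {p p0 : ℝ} (hp : 1 < p) (hp2 : p < 2) (hp0 : 1 < p0) (hpp : p0 < p / (2 - p))
    {𝒮 : Set (EF → EF)} {S0 : EF → EF} (hS0 : IsMax S0) (hmax : ∀ S ∈ 𝒮, IsMax S)
    (hle : ∀ S ∈ 𝒮, ∀ g x, S g x ≤ S0 g x) {N0 N1 : ENN} (hN0 : 1 ≤ N0) (hN0t : N0 ≠ ⊤)
    (hN1 : 1 ≤ N1)
    (hb0 : Bdd p0 S0 N0) (hb1 : ∀ S ∈ 𝒮, Bdd (2 - (2-p)*p0/p) S N1) {C : ENN} (hC : 1 ≤ C)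
    (H G : EF) (hHG : ∀ w, GoodW 𝒮 (2 * N0 * N1) w → ∑' x, H x ^ (2:ℝ) / w x ≤ C * ∑' x, G x ^ (2:ℝ) / w x) :
    ∑' x, H x ^ p ≤ C ^ (p/2) * (2 * 4 ^ p0) * ∑' x, G x ^ p := by
  have hd : 0 < 2 - p := by linarith
  have hp00 : 0 < p0 := by linarith
  have hppos : 0 < p := by linarith
  have h4 : (1:ENN) ≤ 4 ^ p0 := one_le_rpow (by norm_num) hp00
  have h4t : (4:ENN) ^ p0 ≠ ⊤ := rpow_ne_top_of_nonneg hp00.le (by simp)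
  by_cases hfin : ∑' x, G x ^ p = ⊤
  · rw [hfin, mul_top]; · exact le_top
    refine mul_ne_zero ?_ (mul_ne_zero (by simp) (lt_of_lt_of_le one_pos h4).ne')
    exact (lt_of_lt_of_le one_pos (one_le_rpow hC (by positivity))).ne'
  set s := p / ((2 - p) * p0) with hs
  have hs1 : 1 < s := by
    rw [hs, one_lt_div (by positivity)]
    rw [lt_div_iff₀ hd] at hpp; linarith
  have hs0 : 0 < s := by linarith
  have hsi : 1 / s = (2-p)*p0/p := by rw [hs]; field_simp
  obtain ⟨g0, hg0, hg0s⟩ := exists_pos_small p0 hp00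
  set X := ∑' x, G x ^ p with hX
  set ε : ENN := if X = 0 then 1 else X ^ (1/p0) with hε
  have hε0 : ε ≠ 0 := by
    rw [hε]; split_ifs with h
    · simp
    · simp [rpow_eq_zero_iff, h, hfin]
  have hεp : ε ^ p0 = if X = 0 then 1 else X := by
    rw [hε]; split_ifs with h
    · simp
    · rw [one_div, rpow_inv_rpow hp00.ne']
  set g : EF := fun x => G x ^ ((2-p)*s) + ε * g0 x with hg
  obtain ⟨W, hgW, hSW, hWs⟩ := rdf hS0 hp0 hN0 hN0t hb0 g
  have hgs : ∑' x, W x ^ p0 ≤ 4 ^ p0 * (X + ε ^ p0) := by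
    calc _ ≤ 2 ^ p0 * ∑' x, g x ^ p0 := hWs
      _ ≤ 2 ^ p0 * ∑' x, 2 ^ p0 * (G x ^ p + ε ^ p0 * g0 x ^ p0) := by
        gcongr with x
        refine (add_rpow_le_two hp00.le _ _).trans (le_of_eq ?_)
        rw [mul_rpow_of_nonneg _ _ hp00.le, ← rpow_mul]
        congr 3
        rw [hs]; field_simp
      _ = 4 ^ p0 * (X + ε ^ p0 * ∑' x, g0 x ^ p0) := by
        rw [ENNReal.tsum_mul_left, tsum_add, ENNReal.tsum_mul_left, ← mul_assoc,
          ← mul_rpow_of_nonneg _ _ hp00.le]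
        norm_num [hX]
      _ ≤ 4 ^ p0 * (X + ε ^ p0 * 1) := by gcongr
      _ = _ := by rw [mul_one]
  have hεt : ε ^ p0 ≠ ⊤ := by rw [hεp]; split_ifs <;> simp [hfin]
  have hWst : ∑' x, W x ^ p0 ≠ ⊤ := ne_top_of_le_ne_top (mul_ne_top h4t (by simp [hfin, hεt])) hgs
  have hWt : ∀ x, W x ≠ ⊤ := fun x hx => by
    have := ne_top_of_tsum_ne_top hWst x
    rw [hx] at this; simp [hp00] at this
  have hW0 : ∀ x, W x ≠ 0 := fun x => by
    have : 0 < ε * g0 x := pos_iff_ne_zero.2 (mul_ne_zero hε0 (hg0 x))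
    exact (lt_of_lt_of_le (lt_of_lt_of_le this le_add_self) (hgW x)).ne'
  set B := 2 * N0 ^ (1/p0) with hB
  have hN01 : N0 ^ (1/p0) ≤ N0 := by
    nth_rewrite 2 [← rpow_one N0]
    exact rpow_le_rpow_of_exponent_le hN0 (by rw [div_le_one hp00]; exact hp0.le)
  have hB1 : 1 ≤ B := by
    rw [hB]
    calc (1:ENN) ≤ 2 * 1 := by norm_num
      _ ≤ _ := by gcongr; exact one_le_rpow hN0 (by positivity)
  have hBs : B ^ (1/s) ≤ B := by
    nth_rewrite 2 [← rpow_one B]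
    exact rpow_le_rpow_of_exponent_le hB1 (by rw [div_le_one hs0]; exact hs1.le)
  have hBN : B ≤ 2 * N0 := by rw [hB]; gcongr
  set w : EF := fun x => W x ^ (1/s) with hw
  have hgood : GoodW 𝒮 (2 * N0 * N1) w := by
    refine ⟨fun x => ?_, fun x => ?_, ?_, ?_⟩
    · simp [hw, rpow_eq_zero_iff, hW0, hWt]
    · simp [hw, rpow_eq_top_iff, hW0, hWt]
    · intro S hS x
      have h1 := (hmax S hS).jensen hs1.le w x
      have e : (fun y => w y ^ s) = W := by funext y; rw [hw, one_div, rpow_inv_rpow hs0.ne']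
      rw [e] at h1
      rw [← le_rpow_inv_iff hs0] at h1
      calc S w x ≤ (B * W x) ^ s⁻¹ := h1.trans (by gcongr; exact (hle S hS W x).trans (hSW x))
        _ = B ^ (1/s) * w x := by rw [mul_rpow_of_nonneg _ _ (by positivity), hw, one_div]
        _ ≤ (2 * N0 * N1) * w x := by
          gcongr
          calc _ ≤ 2 * N0 * 1 := by rw [mul_one]; exact hBs.trans hBN
            _ ≤ _ := by gcongr
    · intro S hS g'
      refine (weighted (hmax S hS) hs1 (N1 := N1) (B := B) ?_ W hW0 hWt ?_ g').trans ?_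
      · rw [hsi]; exact hb1 S hS
      · intro x; exact (hle S hS W x).trans (hSW x)
      · gcongr; exact hBs.trans hBN
  have h1 := hHG w hgood
  have hwG : ∀ x, G x ^ (2 - p) ≤ w x := by
    intro x
    rw [hw]
    beta_reduce
    rw [one_div, le_rpow_inv_iff hs0, ← rpow_mul]
    exact le_self_add.trans (hgW x)
  have h2 : ∑' x, G x ^ (2:ℝ) / w x ≤ X := by
    refine tsum_le_tsum fun x => div_le_of_le_mul ?_
    calc G x ^ (2:ℝ) = G x ^ p * G x ^ (2-p) := by
          rw [← rpow_add_of_nonneg _ _ hppos.le hd.le]; congr 1; ring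
      _ ≤ _ := by gcongr; exact hwG x
  have hconj : (2/p).HolderConjugate (2/(2-p)) := by
    rw [Real.holderConjugate_iff]
    constructor
    · rw [lt_div_iff₀ hppos]; linarith
    · field_simp; ring
  have h3 := tsum_holder hconj (fun x => (H x ^ (2:ℝ) / w x) ^ (p/2)) (fun x => w x ^ (p/2))
  have e1 : ∀ x, (H x ^ (2:ℝ) / w x) ^ (p/2) * w x ^ (p/2) = H x ^ p := fun x => by
    rw [← mul_rpow_of_nonneg _ _ (by positivity), ENNReal.div_mul_cancel (hgood.ne_zero x) (hgood.ne_top x),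
      ← rpow_mul]; congr 1; field_simp
  have e2 : ∀ x, ((H x ^ (2:ℝ) / w x) ^ (p/2)) ^ (2/p) = H x ^ (2:ℝ) / w x := fun x => by
    rw [← rpow_mul]
    have : p/2*(2/p) = 1 := by field_simp
    rw [this, rpow_one]
  have e3 : ∀ x, (w x ^ (p/2)) ^ (2/(2-p)) = W x ^ p0 := fun x => by
    rw [hw, ← rpow_mul, ← rpow_mul]; congr 1; rw [hs]; field_simp
  simp only [e1, e2, e3] at h3
  have e4 : 1 / (2/p) = p/2 := by field_simp
  have e5 : 1 / (2/(2-p)) = 1 - p/2 := by field_simp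
  rw [e4, e5] at h3
  have hhalf : 0 < 1 - p/2 := by linarith
  refine h3.trans ?_
  calc _ ≤ (C * X) ^ (p/2) * (4 ^ p0 * (X + ε ^ p0)) ^ (1 - p/2) := by
        gcongr; exact h1.trans (by gcongr)
    _ ≤ C ^ (p/2) * (2 * 4 ^ p0) * X := by
        by_cases hX0 : X = 0
        · rw [hX0, mul_zero, zero_rpow_of_pos (by positivity)]; simp
        · rw [hεp, if_neg hX0, ← two_mul, mul_rpow_of_nonneg _ _ (by positivity), ← mul_assoc,
            mul_rpow_of_nonneg _ _ hhalf.le]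
          have e6 : X ^ (p/2) * X ^ (1-p/2) = X := by
            rw [← rpow_add _ _ hX0 hfin]
            have : p/2 + (1-p/2) = 1 := by ring
            rw [this, rpow_one]
          have h7 : (4 ^ p0 * 2 : ENN) ^ (1 - p/2) ≤ 2 * 4 ^ p0 := by
            rw [mul_comm]
            nth_rewrite 2 [← rpow_one (2 * 4 ^ p0)]
            refine rpow_le_rpow_of_exponent_le ?_ (by linarith)
            calc (1:ENN) ≤ 2 * 1 := by norm_num
              _ ≤ _ := by gcongr
          calc _ = C ^ (p/2) * (4 ^ p0 * 2) ^ (1-p/2) * (X ^ (p/2) * X ^ (1-p/2)) := by ring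
            _ ≤ _ := by rw [e6]; gcongr
theorem goodW_one {𝒮 : Set (EF → EF)} (hmax : ∀ S ∈ 𝒮, IsMax S) {N : ENN} (hN : 1 ≤ N)
    (hb : ∀ S ∈ 𝒮, Bdd 2 S N) : GoodW 𝒮 N (fun _ => 1) := by
  refine ⟨by simp, by simp, fun S hS x => ?_, fun S hS g => ?_⟩
  · rw [mul_one]; exact ((hmax S hS).le_const (fun _ => le_rfl) x).trans hN
  · simpa using hb S hS g
theorem strong_convex {p : ℝ} (hp : 1 < p) (hp2 : p ≤ 2) {S : ℝ} (hS : 0 < S) :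
    ConvexOn ℝ (Icc 0 S) (fun t : ℝ => t ^ p - p*(p-1)/2 * S^(p-2) * t^2) := by
  have hd1 : ∀ t ∈ interior (Icc 0 S), HasDerivWithinAt (fun t : ℝ => t ^ p - p*(p-1)/2 * S^(p-2) * t^2)
      (p * t^(p-1) - p*(p-1)*S^(p-2)*t) (interior (Icc 0 S)) t := by
    intro t ht
    rw [interior_Icc] at ht
    have h1 := (Real.hasDerivAt_rpow_const (x := t) (p := p) (Or.inl ht.1.ne'))
    have h2 := ((hasDerivAt_pow 2 t).const_mul (p*(p-1)/2 * S^(p-2)))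
    exact ((h1.sub h2).congr_deriv (by push_cast; ring)).hasDerivWithinAt
  have hd2 : ∀ t ∈ interior (Icc 0 S), HasDerivWithinAt (fun t : ℝ => p * t^(p-1) - p*(p-1)*S^(p-2)*t)
      (p*((p-1) * t^(p-1-1)) - p*(p-1)*S^(p-2)) (interior (Icc 0 S)) t := by
    intro t ht
    rw [interior_Icc] at ht
    have h1 := (Real.hasDerivAt_rpow_const (x := t) (p := p-1) (Or.inl ht.1.ne')).const_mul p
    have h2 := ((hasDerivAt_id t).const_mul (p*(p-1) * S^(p-2)))
    exact ((h1.sub h2).congr_deriv (by simp)).hasDerivWithinAt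
  refine convexOn_of_hasDerivWithinAt2_nonneg (convex_Icc 0 S) ?_ hd1 hd2 ?_
  · have : Continuous fun t : ℝ => t ^ p := Real.continuous_rpow_const (by linarith)
    fun_prop
  · intro t ht
    rw [interior_Icc] at ht
    have : S^(p-2) ≤ t^(p-2) := Real.rpow_le_rpow_of_nonpos ht.1 ht.2.le (by linarith)
    have e : p - 1 - 1 = p - 2 := by ring
    rw [e]
    have h3 : 0 ≤ p * (p-1) := mul_nonneg (by linarith) (by linarith)
    have := mul_le_mul_of_nonneg_left this h3
    linarith
theorem two_point {E : Type*} [NormedAddCommGroup E] [InnerProductSpace ℝ E] {p : ℝ} (hp : 1 < p) (hp2 : p ≤ 2)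
    {S : ℝ} (hS : 0 < S) (a b : E) (ha : ‖a‖ ≤ S) (hb : ‖b‖ ≤ S) :
    p*(p-1)/2 * (‖(1/2:ℝ) • (a - b)‖^2 * S^(p-2)) + ‖(1/2:ℝ) • (a+b)‖^p ≤ 1/2 * (‖a‖^p + ‖b‖^p) := by
  have hpar := parallelogram_law_with_norm ℝ a b
  set A := ‖a‖ with hA
  set B := ‖b‖ with hB
  have hA0 : 0 ≤ A := norm_nonneg _
  have hB0 : 0 ≤ B := norm_nonneg _
  set m := ‖(1/2:ℝ) • (a+b)‖ with hm
  set D := ‖(1/2:ℝ) • (a-b)‖ with hD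
  have hm0 : 0 ≤ m := norm_nonneg _
  have em : m = 1/2 * ‖a+b‖ := by rw [hm, norm_smul]; norm_num
  have eD : D = 1/2 * ‖a-b‖ := by rw [hD, norm_smul]; norm_num
  have hmD : m^2 + D^2 = (A^2 + B^2)/2 := by rw [em, eD]; linarith
  set μ := (A+B)/2 with hμ
  have hμ0 : 0 ≤ μ := by positivity
  have hmμ : m ≤ μ := by rw [em, hμ]; linarith [norm_add_le a b]
  have hμS : μ ≤ S := by rw [hμ]; linarith
  set K := S^(p-2) with hK
  have hK0 : 0 < K := Real.rpow_pos_of_pos hS _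
  have h0 := (strong_convex hp hp2 hS).2
  have h1 := @h0 A ⟨hA0, ha⟩ B ⟨hB0, hb⟩ (1/2) (1/2)
    (by norm_num) (by norm_num) (by norm_num)
  simp only [smul_eq_mul] at h1
  have e1 : 1/2*A + 1/2*B = μ := by rw [hμ]; ring
  rw [e1] at h1
  have h2 : m^p ≤ μ^p - p/2 * K * (μ^2 - m^2) := by
    rcases hμ0.eq_or_lt with h | h
    · have : m = 0 := by linarith
      rw [this, ← h]; simp
    · have hU : 0 < μ^2 := by positivity
      have hb := rpow_one_add_le_one_add_mul_self (s := m^2/μ^2 - 1) (p := p/2)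
        (by have : 0 ≤ m^2/μ^2 := by positivity
            linarith) (by linarith) (by linarith)
      have e2 : 1 + (m^2/μ^2 - 1) = (m/μ)^(2:ℕ) := by field_simp; ring
      rw [e2, ← Real.rpow_natCast, ← Real.rpow_mul (by positivity)] at hb
      have e3 : ((2:ℕ):ℝ) * (p/2) = p := by push_cast; ring
      rw [e3, Real.div_rpow hm0 hμ0, div_le_iff₀ (by positivity)] at hb
      have e4 : μ^p = μ^(p-2) * μ^2 := by
        rw [← Real.rpow_natCast μ 2, ← Real.rpow_add h]; congr 1; push_cast; ring
      have h5 : K ≤ μ^(p-2) := Real.rpow_le_rpow_of_nonpos h hμS (by linarith)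
      have h6 : m^2 ≤ μ^2 := by gcongr
      calc m^p ≤ (1 + p/2*(m^2/μ^2-1)) * μ^p := hb
        _ = μ^p - p/2 * μ^(p-2) * (μ^2 - m^2) := by
          rw [e4]; field_simp; ring
        _ ≤ _ := by
          have : 0 ≤ p/2 * (μ^2-m^2) := by
            apply mul_nonneg <;> linarith
          have := mul_le_mul_of_nonneg_left h5 this
          linarith
  have h3 : 0 ≤ p * (2-p) / 2 * K * (μ^2 - m^2) := by
    have : m^2 ≤ μ^2 := by gcongr
    have : 0 ≤ μ^2 - m^2 := by linarith
    have : 0 ≤ 2 - p := by linarith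
    positivity
  have hD2 : D^2 = (A^2+B^2)/2 - m^2 := by linarith
  rw [hD2]
  linarith
theorem two_point_E {E : Type*} [NormedAddCommGroup E] [InnerProductSpace ℝ E] {p : ℝ} (hp : 1 < p) (hp2 : p ≤ 2)
    {S : ENN} (hS : S ≠ 0) (hSt : S ≠ ⊤) (a b : E) (ha : ‖a‖ₑ ≤ S) (hb : ‖b‖ₑ ≤ S) :
    ofReal (p*(p-1)/2) * (‖(1/2:ℝ) • (a - b)‖ₑ^(2:ℝ) * S^(p-2)) + ‖(1/2:ℝ) • (a+b)‖ₑ^p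
      ≤ 2⁻¹ * (‖a‖ₑ^p + ‖b‖ₑ^p) := by
  have hpos : 0 < S.toReal := toReal_pos hS hSt
  have h := two_point hp hp2 hpos a b (by rw [← toReal_enorm]; exact toReal_mono hSt ha)
    (by rw [← toReal_enorm]; exact toReal_mono hSt hb)
  have hp0 : 0 ≤ p := by linarith
  have hpp : 0 ≤ p*(p-1)/2 := by nlinarith
  have h' := ofReal_le_ofReal h
  have en : ∀ (x : E) (r : ℝ), 0 ≤ r → ofReal (‖x‖^r) = ‖x‖ₑ^r := fun x r hr => by
    rw [← ofReal_rpow_of_nonneg (norm_nonneg _) hr, ofReal_norm]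
  rw [ofReal_add (by positivity) (by positivity), ofReal_mul hpp, ofReal_mul (by positivity),
    ofReal_mul (by norm_num), ofReal_add (by positivity) (by positivity), en _ _ hp0, en _ _ hp0, en _ _ hp0,
    ← Real.rpow_natCast, en _ _ (by norm_num), ← ofReal_rpow_of_pos hpos, ofReal_toReal hSt] at h'
  simpa using h'
theorem sum_le_Mv (v : Z2) (g : EF) (x : Z2) (N : ℕ) (s : Finset ℤ) (hs : ∀ t ∈ s, -(N:ℤ) ≤ t ∧ t ≤ N) :
    ∑ t ∈ s, g (x + t • v) ≤ ((2*N+1 : ℕ):ENN) * Mv v g x := by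
  calc _ ≤ ∑ t ∈ Finset.Icc (-(N:ℤ)) N, g (x + t • v) :=
        sum_le_sum_of_subset (fun t ht => Finset.mem_Icc.2 (hs t ht))
    _ = ((2*N+1 : ℕ):ENN) * bl v N g x := by
        rw [bl, ← mul_assoc, ENNReal.mul_inv_cancel (by simp) (natCast_ne_top _), one_mul]
    _ ≤ _ := by gcongr; exact le_iSup (fun N => bl v N g x) N
theorem sum_range_le_Mv (v : Z2) (g : EF) (x : Z2) (c : ℤ) (n N : ℕ) (h1 : -(N:ℤ) ≤ c) (h2 : c + n ≤ N + 1) :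
    ∑ a ∈ Finset.range n, g (x + (c + (a:ℤ)) • v) ≤ ((2*N+1 : ℕ):ENN) * Mv v g x := by
  have := sum_le_Mv v g x N ((Finset.range n).image (fun a : ℕ => c + (a:ℤ))) (by
    intro t ht; simp only [Finset.mem_image, Finset.mem_range] at ht; obtain ⟨a, ha, rfl⟩ := ht; constructor <;> omega)
  rwa [sum_image (by intro a _ b _ h; simpa using h)] at this
theorem le_Mv (v : Z2) (g : EF) (x : Z2) : g x ≤ Mv v g x := by
  refine le_trans ?_ (le_iSup (fun N => bl v N g x) 0)
  simp [bl]
section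
variable {E : Type*} [NormedAddCommGroup E] [InnerProductSpace ℝ E]
def vm (v : Z2) (i : ℕ) (F : Z2 → E) (x : Z2) : E := ((2:ℝ)^i)⁻¹ • ∑ a ∈ Finset.range (2^i), F (x + (a:ℤ) • v)
def ve (v : Z2) (i : ℕ) (F : Z2 → E) (x : Z2) : E := (1/2:ℝ) • (vm v i F x - vm v i F (x + ((2:ℤ)^i) • v))
theorem vm_succ (v : Z2) (i : ℕ) (F : Z2 → E) (x : Z2) :
    vm v (i+1) F x = (1/2:ℝ) • (vm v i F x + vm v i F (x + ((2:ℤ)^i) • v)) := by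
  have e : (2:ℕ)^(i+1) = 2^i + 2^i := by rw [pow_succ, mul_two]
  rw [vm, vm, vm, e, sum_range_add, ← smul_add, smul_smul]
  congr 1
  · rw [pow_succ]; field_simp
  · congr 1
    refine sum_congr rfl fun a _ => ?_
    congr 1; push_cast; rw [add_smul]; abel
theorem enorm_vm_le (v : Z2) (i : ℕ) (F : Z2 → E) (x : Z2) (c : ℤ) (hc : c = 0 ∨ c = 2^i) :
    ‖vm v i F (x + c • v)‖ₑ ≤ 5 * Mv v (fun y => ‖F y‖ₑ) x := by
  have h2 : (0:ℤ) < 2^i := by positivity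
  have h := sum_range_le_Mv v (fun y => ‖F y‖ₑ) x c (2^i) (2*2^i) (by push_cast; rcases hc with h | h <;> omega)
    (by push_cast; rcases hc with h | h <;> omega)
  rw [vm, enorm_smul]
  have e1 : ‖((2:ℝ)^i)⁻¹‖ₑ = ((2^i : ℕ) : ENN)⁻¹ := by
    rw [enorm_inv (by positivity), enorm_pow]; simp [Real.enorm_eq_ofReal]
  rw [e1]
  calc _ ≤ ((2^i : ℕ) : ENN)⁻¹ * ∑ a ∈ Finset.range (2^i), ‖F (x + (c + (a:ℤ)) • v)‖ₑ := by
        gcongr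
        refine (enorm_sum_le _ _).trans (le_of_eq ?_)
        refine sum_congr rfl fun a _ => ?_
        rw [add_smul, add_assoc]
    _ ≤ ((2^i : ℕ) : ENN)⁻¹ * (((2*(2*2^i)+1 : ℕ):ENN) * Mv v (fun y => ‖F y‖ₑ) x) := by gcongr
    _ ≤ ((2^i : ℕ) : ENN)⁻¹ * ((((2^i:ℕ) * 5 : ℕ):ENN) * Mv v (fun y => ‖F y‖ₑ) x) := by
        gcongr
        have : 1 ≤ 2^i := Nat.one_le_two_pow
        omega
    _ = _ := by
        rw [Nat.cast_mul, ← mul_assoc, ← mul_assoc, ENNReal.inv_mul_cancel (by simp) (by simp)]; simp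
def steinC (p : ℝ) : ENN := (ofReal (p*(p-1)/2))⁻¹ ^ (p/2) * (1 + 5^p * hlC p)
theorem steinC_ne_top {p : ℝ} (hp : 1 < p) : steinC p ≠ ⊤ := by
  have : 0 < p*(p-1)/2 := by nlinarith
  refine mul_ne_top (rpow_ne_top_of_nonneg (by linarith) (by simpa using this)) ?_
  refine ENNReal.add_ne_top.2 ⟨by simp, mul_ne_top ?_ (hlC_ne_top (by linarith))⟩
  exact rpow_ne_top_of_nonneg (by linarith) (by simp)
theorem stein (v : Z2) {p : ℝ} (hp : 1 < p) (hp2 : p ≤ 2) (F : Z2 → E) (R : ℕ) :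
    ∑' x, (∑ i ∈ Finset.range R, ‖ve v i F x‖ₑ ^ (2:ℝ)) ^ (p/2) ≤ steinC p * ∑' x, ‖F x‖ₑ ^ p := by
  have hp0 : 0 < p := by linarith
  have hc0 : 0 < p*(p-1)/2 := by nlinarith
  by_cases hfin : ∑' x, ‖F x‖ₑ ^ p = ⊤
  · rw [hfin, mul_top]; · exact le_top
    refine mul_ne_zero ?_ (by simp)
    simp [rpow_eq_zero_iff]; intro h; linarith
  set S : EF := fun x => 5 * Mv v (fun y => ‖F y‖ₑ) x with hS
  have hSp : ∑' x, S x ^ p ≤ 5^p * hlC p * ∑' x, ‖F x‖ₑ ^ p := by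
    simp only [hS, mul_rpow_of_nonneg _ _ hp0.le]
    rw [ENNReal.tsum_mul_left, mul_assoc]; gcongr
    exact Mv_bdd v hp _
  have hSpt : ∑' x, S x ^ p ≠ ⊤ := ne_top_of_le_ne_top (mul_ne_top (mul_ne_top
    (rpow_ne_top_of_nonneg hp0.le (by simp)) (hlC_ne_top hp0.le)) hfin) hSp
  have hSt : ∀ x, S x ≠ ⊤ := fun x hx => by
    have := ne_top_of_tsum_ne_top hSpt x
    rw [hx] at this; simp [hp0] at this
  set c := ofReal (p*(p-1)/2) with hc
  have hcne : c ≠ 0 := by simpa [hc] using hc0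
  have hct : c ≠ ⊤ := by simp [hc]
  have hb0 : ∀ i x, ‖vm v i F x‖ₑ ≤ S x := fun i x => by
    simpa using enorm_vm_le v i F x 0 (Or.inl rfl)
  have hb1 : ∀ i x, ‖vm v i F (x + ((2:ℤ)^i) • v)‖ₑ ≤ S x := fun i x => by
    simpa using enorm_vm_le v i F x (2^i) (Or.inr rfl)
  have hz : ∀ i x, S x = 0 → ve v i F x = 0 := fun i x hx => by
    have h0 := hb0 i x; have h1 := hb1 i x
    rw [hx] at h0 h1
    simp only [nonpos_iff_eq_zero, enorm_eq_zero] at h0 h1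
    rw [ve, h0, h1]; simp
  have step : ∀ i, (∑' x, c * (‖ve v i F x‖ₑ^(2:ℝ) * S x ^ (p-2))) + ∑' x, ‖vm v (i+1) F x‖ₑ^p ≤ ∑' x, ‖vm v i F x‖ₑ^p := by
    intro i
    have hsh : ∑' x, ‖vm v i F (x + ((2:ℤ)^i) • v)‖ₑ^p = ∑' x, ‖vm v i F x‖ₑ^p :=
      (Equiv.addRight (((2:ℤ)^i) • v)).tsum_eq (fun x => ‖vm v i F x‖ₑ^p)
    rw [← tsum_add]
    calc _ ≤ ∑' x, 2⁻¹ * (‖vm v i F x‖ₑ^p + ‖vm v i F (x + ((2:ℤ)^i) • v)‖ₑ^p) := by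
          refine tsum_le_tsum fun x => ?_
          rw [vm_succ, ve]
          by_cases hx : S x = 0
          · have h0 := hb0 i x; have h1 := hb1 i x
            rw [hx] at h0 h1
            simp only [nonpos_iff_eq_zero, enorm_eq_zero] at h0 h1
            rw [h0, h1]; simp [hp0]
          · exact two_point_E hp hp2 hx (hSt x) _ _ (hb0 i x) (hb1 i x)
      _ = _ := by
          rw [ENNReal.tsum_mul_left, tsum_add, hsh, ← two_mul, ← mul_assoc,
            ENNReal.inv_mul_cancel (by simp) (by simp), one_mul]
  have tele : ∀ R : ℕ, (∑ i ∈ Finset.range R, ∑' x, c * (‖ve v i F x‖ₑ^(2:ℝ) * S x ^ (p-2))) + ∑' x, ‖vm v R F x‖ₑ^p ≤ ∑' x, ‖F x‖ₑ^p := by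
    intro R
    induction R with
    | zero => simp [vm]
    | succ R ih =>
      rw [sum_range_succ, add_assoc]
      exact (add_le_add le_rfl (step R)).trans ih
  set Y : EF := fun x => ∑ i ∈ Finset.range R, ‖ve v i F x‖ₑ ^ (2:ℝ) with hY
  have hYS : ∑' x, Y x * S x ^ (p-2) ≤ c⁻¹ * ∑' x, ‖F x‖ₑ^p := by
    rw [← ENNReal.div_eq_inv_mul, ENNReal.le_div_iff_mul_le (Or.inl hcne) (Or.inl hct), mul_comm]
    refine le_trans (le_of_eq ?_) (le_self_add.trans (tele R))
    rw [← ENNReal.tsum_mul_left, ← Summable.tsum_finsetSum (fun _ _ => summable)]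
    refine tsum_congr fun x => ?_
    rw [hY]; beta_reduce; rw [sum_mul, mul_sum]
  have hYz : ∀ x, S x = 0 → Y x = 0 := fun x hx => by
    rw [hY]; simp [hz _ x hx]
  change ∑' x, Y x ^ (p/2) ≤ _
  rcases hp2.eq_or_lt with h2 | h2
  · have : ∑' x, Y x ^ (p/2) = ∑' x, Y x * S x ^ (p-2) := by
      refine tsum_congr fun x => ?_
      rw [h2]; simp
    rw [this, steinC]
    refine hYS.trans ?_
    rw [h2]
    gcongr
    simp only [div_self (two_ne_zero' ℝ), rpow_one]
    rw [hc, h2]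
    calc _ = (ofReal (2 * (2-1)/2))⁻¹ * 1 := by rw [mul_one]
      _ ≤ _ := by gcongr; exact le_self_add
  have hd : 0 < 2 - p := by linarith
  have hconj : (2/p).HolderConjugate (2/(2-p)) := by
    rw [Real.holderConjugate_iff]
    constructor
    · rw [lt_div_iff₀ hp0]; linarith
    · field_simp; ring
  have h3 := tsum_holder hconj (fun x => (Y x * S x ^ (p-2)) ^ (p/2)) (fun x => (S x ^ (2-p)) ^ (p/2))
  have e1 : ∀ x, (Y x * S x ^ (p-2)) ^ (p/2) * (S x ^ (2-p)) ^ (p/2) = Y x ^ (p/2) := fun x => by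
    by_cases hx : S x = 0
    · rw [hYz x hx]; simp [hp0]
    · rw [← mul_rpow_of_nonneg _ _ (by positivity), mul_assoc, ← rpow_add _ _ hx (hSt x)]
      simp
  have e2 : ∀ x, ((Y x * S x ^ (p-2)) ^ (p/2)) ^ (2/p) = Y x * S x ^ (p-2) := fun x => by
    rw [← rpow_mul]
    have : p/2*(2/p) = 1 := by field_simp
    rw [this, rpow_one]
  have e3 : ∀ x, ((S x ^ (2-p)) ^ (p/2)) ^ (2/(2-p)) = S x ^ p := fun x => by
    rw [← rpow_mul, ← rpow_mul]; congr 1; field_simp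
  simp only [e1, e2, e3] at h3
  have e4 : 1 / (2/p) = p/2 := by field_simp
  have e5 : 1 / (2/(2-p)) = 1 - p/2 := by field_simp
  rw [e4, e5] at h3
  have hhalf : 0 < 1 - p/2 := by linarith
  set X := ∑' x, ‖F x‖ₑ^p with hX
  refine h3.trans ?_
  calc _ ≤ (c⁻¹ * X) ^ (p/2) * (5^p * hlC p * X) ^ (1-p/2) := by gcongr
    _ = c⁻¹ ^ (p/2) * (5^p * hlC p)^(1-p/2) * (X^(p/2) * X^(1-p/2)) := by
      rw [mul_rpow_of_nonneg _ _ (by positivity), mul_rpow_of_nonneg _ _ hhalf.le]; ring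
    _ ≤ _ := by
      rw [← rpow_add_of_nonneg _ _ (by positivity) hhalf.le, steinC]
      have : p/2 + (1-p/2) = 1 := by ring
      rw [this, rpow_one]
      gcongr
      calc _ ≤ (1 + 5^p * hlC p)^(1-p/2) := by gcongr; exact le_add_self
        _ ≤ (1 + 5^p * hlC p)^(1:ℝ) := rpow_le_rpow_of_exponent_le le_self_add (by linarith)
        _ = _ := rpow_one _
end
abbrev KA := AddMonoidAlgebra ℝ Z2
abbrev RF := Z2 → ℝ
def shiftHom : Multiplicative Z2 →* Module.End ℝ RF where
  toFun v := { toFun := fun f x => f (x + v.toAdd), map_add' := fun f g => rfl, map_smul' := fun c f => rfl }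
  map_one' := by ext f x; simp
  map_mul' v w := by
    ext f x
    simp only [toAdd_mul, LinearMap.coe_mk, AddHom.coe_mk, Module.End.mul_apply]
    congr 1; abel
def act : KA →ₐ[ℝ] Module.End ℝ RF := AddMonoidAlgebra.lift ℝ _ Z2 shiftHom
def τ (v : Z2) : KA := AddMonoidAlgebra.of ℝ Z2 (Multiplicative.ofAdd v)
theorem act_τ (v : Z2) (f : RF) (x : Z2) : act (τ v) f x = f (x + v) := by
  simp only [act, τ, AddMonoidAlgebra.lift_of]; rfl
theorem τ_add (v w : Z2) : τ (v + w) = τ v * τ w := by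
  simp only [τ, ofAdd_add, map_mul]
theorem τ_zero : τ 0 = 1 := by simp only [τ, ofAdd_zero, map_one]
theorem τ_nsmul (n : ℕ) (v : Z2) : τ (n • v) = τ v ^ n := by
  simp only [τ, ofAdd_nsmul, map_pow]
theorem τ_natsmul (n : ℕ) (v : Z2) : τ ((n:ℤ) • v) = τ v ^ n := by
  rw [natCast_zsmul, τ_nsmul]
theorem τ_neg_mul (v : Z2) : τ v * τ (-v) = 1 := by rw [← τ_add, add_neg_cancel, τ_zero]
theorem act_mul (P Q : KA) (f : RF) : act (P * Q) f = act P (act Q f) := by rw [map_mul]; rfl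
theorem act_add (P Q : KA) (f : RF) (x : Z2) : act (P + Q) f x = act P f x + act Q f x := by rw [map_add]; rfl
theorem act_sub (P Q : KA) (f : RF) (x : Z2) : act (P - Q) f x = act P f x - act Q f x := by rw [map_sub]; rfl
theorem act_neg (P : KA) (f : RF) (x : Z2) : act (-P) f x = - act P f x := by rw [map_neg]; rfl
theorem act_smul (c : ℝ) (P : KA) (f : RF) (x : Z2) : act (c • P) f x = c * act P f x := by rw [map_smul]; rfl
theorem act_one (f : RF) : act 1 f = f := by rw [map_one]; rfl
theorem act_sum {ι : Type*} (s : Finset ι) (P : ι → KA) (f : RF) (x : Z2) :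
    act (∑ i ∈ s, P i) f x = ∑ i ∈ s, act (P i) f x := by
  rw [map_sum, LinearMap.sum_apply, Finset.sum_apply]
theorem act_τpow (n : ℕ) (v : Z2) (f : RF) (x : Z2) : act (τ v ^ n) f x = f (x + (n:ℤ) • v) := by
  rw [← τ_natsmul, act_τ]
def gs (v : Z2) (N : ℕ) : KA := ∑ a ∈ Finset.range N, τ v ^ a
def box (v : Z2) (N : ℕ) : KA := (N:ℝ)⁻¹ • gs v N
def tent (v : Z2) (N : ℕ) : KA := box v N * box (-v) N
def eta (v : Z2) (N : ℕ) : KA := (1/2:ℝ) • ((1 - τ v ^ N) * box v N)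
theorem act_box (v : Z2) (N : ℕ) (f : RF) (x : Z2) :
    act (box v N) f x = (N:ℝ)⁻¹ * ∑ a ∈ Finset.range N, f (x + (a:ℤ) • v) := by
  rw [box, act_smul, gs, act_sum]; simp only [act_τpow]
theorem gs_mul (v : Z2) (N : ℕ) : gs v N * (τ v - 1) = τ v ^ N - 1 := geom_sum_mul _ _
theorem gs_exch (v : Z2) (s N : ℕ) : (τ v ^ s - 1) * gs v N = (τ v ^ N - 1) * gs v s := by
  rw [← gs_mul, ← gs_mul]; ring
theorem box_exch (v : Z2) (s N : ℕ) : (τ v ^ s - 1) * box v N = ((s:ℝ) / N) • ((τ v ^ N - 1) * box v s) := by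
  by_cases hs : s = 0
  · simp [hs]
  have : (s:ℝ) ≠ 0 := by exact_mod_cast hs
  rw [box, box, mul_smul_comm, mul_smul_comm, smul_smul, gs_exch]
  congr 1; field_simp
theorem gs_add (v : Z2) (M N : ℕ) : gs v (M + N) = gs v M + τ v ^ M * gs v N := by
  rw [gs, gs, gs, sum_range_add, mul_sum]; simp only [pow_add]
theorem box_two (v : Z2) (N : ℕ) : box v (2 * N) = (1/2:ℝ) • ((1 + τ v ^ N) * box v N) := by
  rw [box, box, two_mul, gs_add, mul_smul_comm, smul_smul, add_mul, one_mul]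
  congr 1; push_cast
  by_cases h : (N:ℝ) = 0
  · simp [h]
  · field_simp; ring
theorem box_one (v : Z2) : box v 1 = 1 := by simp [box, gs]
theorem tent_one (v : Z2) : tent v 1 = 1 := by simp [tent, box_one]
theorem tent_sub (v : Z2) (N : ℕ) : tent v N - tent v (2 * N) = eta v N * eta (-v) N := by
  have h : τ v ^ N * τ (-v) ^ N = 1 := by rw [← mul_pow, τ_neg_mul, one_pow]
  rw [tent, tent, eta, eta, box_two, box_two]
  simp only [smul_mul_smul_comm]
  have e : (1 - τ v ^ N) * box v N * ((1 - τ (-v) ^ N) * box (-v) N) + (1 + τ v ^ N) * box v N * ((1 + τ (-v) ^ N) * box (-v) N)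
     = (4:ℝ) • (box v N * box (-v) N) := by
    have : (4:ℝ) • (box v N * box (-v) N) = 4 * (box v N * box (-v) N) := by
      rw [Algebra.smul_def, map_ofNat]
    rw [this]
    linear_combination (2 * box v N * box (-v) N) * h
  rw [sub_eq_iff_eq_add, ← smul_add, e, smul_smul]; norm_num
theorem act_eta_pow (v : Z2) (i : ℕ) (f : RF) (x : Z2) : act (eta v (2^i)) f x = ve v i f x := by
  rw [eta, act_smul, sub_mul, one_mul, act_sub, act_mul, act_τpow, act_box, act_box, ve, vm, vm]
  simp
def Adj (P P' : KA) : Prop := ∀ f h : RF, (Function.support h).Finite →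
  (Function.support (act P' h)).Finite ∧ ∑' x, act P f x * h x = ∑' x, f x * act P' h x
theorem summable_fin (f h : RF) (hh : (Function.support h).Finite) : Summable (fun x => f x * h x) :=
  summable_of_finite_support (hh.subset (fun x hx => by
    simp only [Function.mem_support] at hx ⊢; exact right_ne_zero_of_mul hx))
theorem Adj.τ (v : Z2) : Adj (τ v) (τ (-v)) := fun f h hh => by
  constructor
  · refine (hh.preimage (f := fun x => x + -v) (add_left_injective _).injOn).subset ?_
    intro x hx; simpa [act_τ] using hx
  · rw [← (Equiv.addRight (-v)).tsum_eq]
    refine tsum_congr fun x => ?_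
    simp [act_τ]
theorem Adj.mul {P P' Q Q' : KA} (h1 : Adj P P') (h2 : Adj Q Q') : Adj (P * Q) (P' * Q') := fun f h hh => by
  obtain ⟨a, b⟩ := h1 (act Q f) h hh
  obtain ⟨c, d⟩ := h2 f _ a
  rw [mul_comm P' Q', act_mul, act_mul]
  exact ⟨c, b.trans d⟩
theorem Adj.add {P P' Q Q' : KA} (h1 : Adj P P') (h2 : Adj Q Q') : Adj (P + Q) (P' + Q') := fun f h hh => by
  obtain ⟨a, b⟩ := h1 f h hh
  obtain ⟨c, d⟩ := h2 f h hh
  refine ⟨(a.union c).subset ?_, ?_⟩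
  · intro x hx
    simp only [Function.mem_support, act_add] at hx
    by_contra hc
    simp only [mem_union, Function.mem_support, not_or, not_not] at hc
    rw [hc.1, hc.2] at hx; simp at hx
  · simp only [act_add, add_mul, mul_add]
    rw [Summable.tsum_add (summable_fin _ _ hh) (summable_fin _ _ hh), Summable.tsum_add (summable_fin _ _ a) (summable_fin _ _ c), b, d]
theorem Adj.smul {P P' : KA} (h1 : Adj P P') (c : ℝ) : Adj (c • P) (c • P') := fun f h hh => by
  obtain ⟨a, b⟩ := h1 f h hh
  refine ⟨a.subset ?_, ?_⟩
  · intro x hx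
    simp only [Function.mem_support, act_smul] at hx ⊢; exact right_ne_zero_of_mul hx
  · simp only [act_smul, mul_assoc, mul_left_comm _ c]
    rw [tsum_mul_left, tsum_mul_left, b]
theorem Adj.one : Adj 1 1 := fun f h hh => by simp only [act_one]; exact ⟨hh, trivial⟩
theorem Adj.sub {P P' Q Q' : KA} (h1 : Adj P P') (h2 : Adj Q Q') : Adj (P - Q) (P' - Q') := by
  have := h1.add (h2.smul (-1)); simpa [sub_eq_add_neg] using this
theorem Adj.sum {ι : Type*} (s : Finset ι) {P P' : ι → KA} (h : ∀ i ∈ s, Adj (P i) (P' i)) : Adj (∑ i ∈ s, P i) (∑ i ∈ s, P' i) := by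
  classical
  induction s using Finset.induction_on with
  | empty => simpa using Adj.one.smul 0
  | insert a s ha ih =>
    rw [sum_insert ha, sum_insert ha]
    exact (h _ (by simp)).add (ih fun i hi => h i (by simp [hi]))
theorem Adj.pow {P P' : KA} (h : Adj P P') (n : ℕ) : Adj (P ^ n) (P' ^ n) := by
  induction n with
  | zero => simpa using Adj.one
  | succ n ih => rw [pow_succ, pow_succ]; exact ih.mul h
theorem Adj.eta (v : Z2) (N : ℕ) : Adj (eta v N) (eta (-v) N) :=
  ((Adj.one.sub ((Adj.τ v).pow N)).mul ((Adj.sum _ fun i _ => (Adj.τ v).pow i).smul _)).smul _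
def del (v : Z2) (i : ℕ) : KA := eta v (2^i) * eta (-v) (2^i)
theorem Adj.del (v : Z2) (i : ℕ) : Adj (del v i) (del v i) := by
  have := (Adj.eta v (2^i)).mul (Adj.eta (-v) (2^i))
  rw [neg_neg, mul_comm (LacMax.eta (-v) _)] at this; exact this
def sh (v : Z2) (g : EF) (x : Z2) : ENN := g (x + v)
theorem isAvg_sh (v : Z2) : IsAvg (sh v) := by
  have := isAvg_finset (Finset.range 1) (fun _ => v) 1 (by simp)
  simp only [Finset.range_one, Finset.sum_singleton, one_mul] at this; exact this
theorem IsAvg.comm {A B : EF → EF} (hA : IsAvg A) (hB : IsAvg B) (g : EF) : A (B g) = B (A g) := by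
  obtain ⟨ι, _, w, v, h1, h2⟩ := hA
  obtain ⟨κ, _, w', v', h1', h2'⟩ := hB
  funext x
  simp only [h2, h2', mul_sum]
  rw [sum_comm]
  refine sum_congr rfl fun j _ => sum_congr rfl fun i _ => ?_
  rw [mul_left_comm, add_right_comm]
theorem IsAvg.monotone {A : EF → EF} (hA : IsAvg A) : Monotone A := fun _ _ h => hA.mono h
theorem IsMax.monotone {A : EF → EF} (hA : IsMax A) : Monotone A := fun _ _ h => hA.mono h
theorem IsAvg.sum {A : EF → EF} (hA : IsAvg A) {κ : Type*} (s : Finset κ) (f : κ → EF) (x : Z2) :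
    A (fun y => ∑ k ∈ s, f k y) x = ∑ k ∈ s, A (f k) x := by
  obtain ⟨ι, _, w, v, h1, h2⟩ := hA
  simp only [h2, mul_sum]
  rw [sum_comm]
def Dm (P : KA) (A : EF → EF) : Prop := ∀ f x, ‖act P f x‖ₑ ≤ A (fun y => ‖f y‖ₑ) x
namespace Dm
variable {P Q : KA} {A B : EF → EF}
theorem one : Dm 1 (fun g => g) := fun f x => by rw [act_one]
theorem τ (v : Z2) : Dm (τ v) (sh v) := fun f x => by rw [act_τ, sh]
theorem le (h : Dm P A) (hAB : ∀ g x, A g x ≤ B g x) : Dm P B := fun f x => (h f x).trans (hAB _ _)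
theorem mul (h : Dm P A) (h' : Dm Q B) (hA : Monotone A) : Dm (P * Q) (fun g => A (B g)) := fun f x => by
  rw [act_mul]
  exact (h _ x).trans (hA (fun y => h' f y) x)
theorem add (h : Dm P A) (h' : Dm Q B) : Dm (P + Q) (fun g x => A g x + B g x) := fun f x => by
  rw [act_add]; exact (enorm_add_le _ _).trans (add_le_add (h f x) (h' f x))
theorem neg (h : Dm P A) : Dm (-P) A := fun f x => by
  rw [act_neg, enorm_neg]; exact h f x
theorem sub (h : Dm P A) (h' : Dm Q B) : Dm (P - Q) (fun g x => A g x + B g x) := by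
  rw [sub_eq_add_neg]; exact h.add h'.neg
theorem smul (h : Dm P A) (c : ℝ) : Dm (c • P) (fun g x => ‖c‖ₑ * A g x) := fun f x => by
  rw [act_smul, enorm_mul]; exact mul_le_mul_right (h f x) _
theorem sum {ι : Type*} (s : Finset ι) {P : ι → KA} {A : ι → EF → EF} (h : ∀ i ∈ s, Dm (P i) (A i)) :
    Dm (∑ i ∈ s, P i) (fun g x => ∑ i ∈ s, A i g x) := fun f x => by
  rw [act_sum]; exact (enorm_sum_le _ _).trans (sum_le_sum fun i hi => h i hi f x)
theorem τpow (v : Z2) (n : ℕ) : Dm (LacMax.τ v ^ n) (sh ((n:ℤ) • v)) := by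
  rw [← τ_natsmul]; exact .τ _
theorem box (v : Z2) (N : ℕ) : Dm (box v N) (bx v N) := by
  refine ((Dm.sum (Finset.range N) fun i _ => Dm.τpow v i).smul _).le fun g x => ?_
  rw [bx]
  rcases Nat.eq_zero_or_pos N with h | h
  · simp [h]
  · rw [enorm_inv (by positivity)]
    simp only [sh]; gcongr; simp
end Dm
theorem bx_two (v : Z2) (N : ℕ) (g : EF) (x : Z2) : bx v (2*N) g x = 2⁻¹ * (bx v N g x + bx v N g (x + (N:ℤ) • v)) := by
  rw [bx, bx, bx, two_mul, sum_range_add, ← mul_add, ← mul_assoc]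
  congr 1
  · rw [← two_mul, Nat.cast_mul, ENNReal.mul_inv (by simp) (by simp)]; simp
  · congr 1
    refine sum_congr rfl fun a _ => ?_
    congr 1; push_cast; rw [add_smul]; abel
theorem Dm.eta (v : Z2) (N : ℕ) : Dm (eta v N) (bx v (2*N)) := by
  have h := (((Dm.one.sub (Dm.τpow v N)).mul (Dm.box v N) ?_).smul (1/2))
  · refine h.le fun g x => ?_
    rw [bx_two]
    have : ‖(1/2:ℝ)‖ₑ = 2⁻¹ := by
      rw [one_div, enorm_inv (by norm_num)]; simp [Real.enorm_eq_ofReal]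
    rw [this]; simp only [sh]; exact le_rfl
  · intro f g hfg x
    exact add_le_add (hfg x) ((isAvg_sh _).mono hfg x)
theorem inv_le_mul_inv {a b K : ℕ} (ha : 0 < a) (hb : 0 < b) (h : b ≤ K * a) : (a:ENN)⁻¹ ≤ K * (b:ENN)⁻¹ := by
  have ha' : (a:ENN) ≠ 0 := by simp; omega
  have hb' : (b:ENN) ≠ 0 := by simp; omega
  have h' : (b:ENN) ≤ K * a := by exact_mod_cast h
  calc (a:ENN)⁻¹ = (a:ENN)⁻¹ * (b * (b:ENN)⁻¹) := by rw [ENNReal.mul_inv_cancel hb' (by simp), mul_one]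
    _ ≤ (a:ENN)⁻¹ * (K * a * (b:ENN)⁻¹) := by gcongr
    _ = ((a:ENN)⁻¹ * a) * (K * (b:ENN)⁻¹) := by ring
    _ = _ := by rw [ENNReal.inv_mul_cancel ha' (by simp), one_mul]
theorem sum_le_bl (v : Z2) (N c K : ℕ) (s : Finset ℤ) (hs : ∀ t ∈ s, -(N:ℤ) ≤ t ∧ t ≤ N) (hc : 0 < c)
    (h : 2 * N + 1 ≤ K * c) (g : EF) (x : Z2) : (c:ENN)⁻¹ * ∑ t ∈ s, g (x + t • v) ≤ K * bl v N g x := by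
  rw [bl, ← mul_assoc]
  gcongr ?_ * ?_
  · exact inv_le_mul_inv hc (by omega) h
  · exact sum_le_sum_of_subset fun t ht => Finset.mem_Icc.2 (hs t ht)
theorem bx_sh_le_bl (v : Z2) (n N K : ℕ) (c : ℤ) (h1 : -(N:ℤ) ≤ c) (h2 : c + n ≤ N + 1) (h : 2 * N + 1 ≤ K * n) (g : EF) (x : Z2) :
    bx v n g (x + c • v) ≤ K * bl v N g x := by
  rcases Nat.eq_zero_or_pos n with hn | hn
  · subst hn; omega
  have := sum_le_bl v N n K ((Finset.range n).image (fun a : ℕ => c + (a:ℤ))) (by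
    intro t ht; simp only [Finset.mem_image, Finset.mem_range] at ht; obtain ⟨a, ha, rfl⟩ := ht; constructor <;> omega) hn h g x
  rw [sum_image (by intro a _ b _ h; simpa using h)] at this
  refine le_trans (le_of_eq ?_) this
  rw [bx]; congr 1
  refine sum_congr rfl fun a _ => ?_
  rw [add_smul, add_assoc]
theorem bl_neg (v : Z2) (N : ℕ) (g : EF) (x : Z2) : bl (-v) N g x = bl v N g x := by
  rw [bl, bl]; congr 1
  refine Finset.sum_nbij' (fun t => -t) (fun t => -t) ?_ ?_ ?_ ?_ ?_ <;> simp
  · intro a h1 h2; omega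
  · intro a h1 h2; omega
theorem bx_le_bl (v : Z2) (N : ℕ) (g : EF) (x : Z2) : bx v N g x ≤ 3 * bl v N g x := by
  rcases Nat.eq_zero_or_pos N with h | h
  · simp [h, bx]
  have := bx_sh_le_bl v N N 3 0 (by omega) (by omega) (by omega) g x
  simpa using this
theorem bl_le_Mv (v : Z2) (N : ℕ) (g : EF) (x : Z2) : bl v N g x ≤ Mv v g x := le_iSup (fun N => bl v N g x) N
theorem Mv_neg (v : Z2) (g : EF) (x : Z2) : Mv (-v) g x = Mv v g x := by simp only [Mv, bl_neg]
theorem bx_le_Mv (v : Z2) (N : ℕ) (g : EF) (x : Z2) : bx v N g x ≤ 3 * Mv v g x :=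
  (bx_le_bl v N g x).trans (by gcongr; exact bl_le_Mv _ _ _ _)
theorem tsum_mul_bx (v : Z2) (N : ℕ) (g w : EF) : ∑' x, bx v N g x * w x = ∑' x, g x * bx (-v) N w x := by
  simp only [bx, mul_sum, sum_mul]
  rw [Summable.tsum_finsetSum (fun _ _ => summable), Summable.tsum_finsetSum (fun _ _ => summable)]
  refine sum_congr rfl fun a _ => ?_
  rw [← (Equiv.addRight ((a:ℤ) • (-v))).tsum_eq]
  refine tsum_congr fun x => ?_
  simp only [Equiv.coe_addRight]
  rw [smul_neg, neg_add_cancel_right]; ring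
def synC : ENN := 5 * steinC 2
theorem synC_ne_top : synC ≠ ⊤ := mul_ne_top (by simp) (steinC_ne_top (by norm_num))
theorem ve_congr (v : Z2) (i : ℕ) (f g : RF) (y : Z2) (h : ∀ a : ℕ, a < 2^(i+1) → f (y + (a:ℤ) • v) = g (y + (a:ℤ) • v)) :
    ve v i f y = ve v i g y := by
  have e : (2:ℕ)^(i+1) = 2^i + 2^i := by rw [pow_succ, mul_two]
  have hvm : vm v i f y = vm v i g y := by
    rw [vm, vm]; congr 1
    refine sum_congr rfl fun a ha => h a ?_
    have := Finset.mem_range.1 ha; omega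
  have hvm2 : vm v i f (y + ((2:ℤ)^i) • v) = vm v i g (y + ((2:ℤ)^i) • v) := by
    rw [vm, vm]; congr 1
    refine sum_congr rfl fun a ha => ?_
    have := h (2^i + a) (by have := Finset.mem_range.1 ha; omega)
    push_cast at this
    rwa [add_smul, ← add_assoc] at this
  rw [ve, ve, hvm, hvm2]
theorem ofPred_meas (a : ENN) : MeasurableSet {t : ℝ | ofReal t < a} :=
  measurableSet_lt (measurable_ofReal) measurable_const
theorem layer1 {a : ENN} (ha : a ≠ ⊤) (b : ENN) : b * a = ∫⁻ t in Ioi (0:ℝ), (if ofReal t < a then b else 0) := by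
  have h := layer (q := 1) one_pos ha
  simp only [sub_self, Real.rpow_zero, ofReal_one, one_mul, rpow_one] at h
  conv_lhs => rw [← h]
  rw [← lintegral_const_mul]
  · simp
  · exact Measurable.ite (ofPred_meas a) measurable_const measurable_const
theorem analysis (v : Z2) (w : EF) {B : ENN} (hB : B ≠ ⊤) (hwt : ∀ x, w x ≠ ⊤) (hA1 : ∀ x, Mv v w x ≤ B * w x)
    (R : ℕ) (h : RF) : ∑ i ∈ Finset.range R, ∑' x, ‖act (del v i) h x‖ₑ ^ (2:ℝ) * w x ≤ synC * B * ∑' x, ‖h x‖ₑ ^ (2:ℝ) * w x := by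
  set W : ℕ → EF := fun i => bx (-v) (2 * 2^i) w with hW
  have h1 : ∀ i x, ‖act (del v i) h x‖ₑ ^ (2:ℝ) ≤ bx v (2 * 2^i) (fun y => ‖ve (-v) i h y‖ₑ ^ (2:ℝ)) x := by
    intro i x
    rw [del, act_mul]
    have := Dm.eta v (2^i) (act (eta (-v) (2^i)) h) x
    simp only [act_eta_pow (-v)] at this
    exact (rpow_le_rpow this (by norm_num)).trans ((isAvg_bx _ _).jensen (by norm_num) _ x)
  have h2 : ∀ i, ∑' x, ‖act (del v i) h x‖ₑ ^ (2:ℝ) * w x ≤ ∑' y, ‖ve (-v) i h y‖ₑ ^ (2:ℝ) * W i y := by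
    intro i
    rw [← tsum_mul_bx]
    exact tsum_le_tsum fun x => by gcongr; exact h1 i x
  have hWt : ∀ i y, W i y ≠ ⊤ := fun i y => by
    rw [hW]; simp only [bx]
    exact mul_ne_top (by simp) (ENNReal.sum_ne_top.2 fun a _ => hwt _)
  have hwin : ∀ i y (a : ℕ), a < 2^(i+1) → W i y ≤ 5 * B * w (y + (a:ℤ) • (-v)) := by
    intro i y a ha
    have e : (2:ℕ)^(i+1) = 2 * 2^i := by rw [pow_succ, mul_comm]
    rw [e] at ha
    set m := 2 * 2^i with hm
    have := bx_sh_le_bl (-v) m (2*m) 5 (-(a:ℤ)) (by push_cast; omega) (by push_cast; omega) (by omega) w (y + (a:ℤ) • (-v))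
    rw [add_assoc, ← add_smul, add_neg_cancel, zero_smul, add_zero, bl_neg] at this
    refine this.trans ?_
    rw [mul_assoc]
    push_cast
    gcongr
    exact (bl_le_Mv _ _ _ _).trans (hA1 _)
  have hw't : ∀ x, 5 * B * w x ≠ ⊤ := fun x => mul_ne_top (mul_ne_top (by simp) hB) (hwt x)
  have h3 : ∀ t : ℝ, ∑ i ∈ Finset.range R, ∑' y, (if ofReal t < W i y then ‖ve (-v) i h y‖ₑ ^ (2:ℝ) else 0)
      ≤ steinC 2 * ∑' x, (if ofReal t < 5 * B * w x then ‖h x‖ₑ ^ (2:ℝ) else 0) := by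
    intro t
    set ht : RF := fun x => if ofReal t < 5 * B * w x then h x else 0 with hht
    have hs := stein (-v) (p := 2) (by norm_num) le_rfl ht R
    simp only [div_self (two_ne_zero' ℝ), rpow_one] at hs
    rw [Summable.tsum_finsetSum (fun _ _ => summable)] at hs
    refine le_trans (sum_le_sum fun i _ => tsum_le_tsum fun y => ?_) (hs.trans (le_of_eq ?_))
    · split_ifs with hc
      · rw [ve_congr (-v) i h ht y]
        intro a ha
        rw [hht]; beta_reduce; rw [if_pos (hc.trans_le (hwin i y a ha))]
      · exact zero_le
    · congr 1; refine tsum_congr fun x => ?_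
      rw [hht]; beta_reduce; split_ifs <;> simp
  have meas : ∀ a b : ENN, Measurable (fun t : ℝ => if ofReal t < a then b else 0) := fun a b =>
    Measurable.ite (ofPred_meas a) measurable_const measurable_const
  calc _ ≤ ∑ i ∈ Finset.range R, ∑' y, ‖ve (-v) i h y‖ₑ ^ (2:ℝ) * W i y := sum_le_sum fun i _ => h2 i
    _ = ∑ i ∈ Finset.range R, ∑' y, ∫⁻ t in Ioi (0:ℝ), (if ofReal t < W i y then ‖ve (-v) i h y‖ₑ ^ (2:ℝ) else 0) := by
        refine sum_congr rfl fun i _ => tsum_congr fun y => layer1 (hWt i y) _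
    _ = ∫⁻ t in Ioi (0:ℝ), ∑ i ∈ Finset.range R, ∑' y, (if ofReal t < W i y then ‖ve (-v) i h y‖ₑ ^ (2:ℝ) else 0) := by
        rw [lintegral_finsetSum]
        · refine sum_congr rfl fun i _ => ?_
          rw [lintegral_tsum]
          exact fun y => (meas _ _).aemeasurable
        · exact fun i _ => Measurable.tsum fun y => meas _ _
    _ ≤ ∫⁻ t in Ioi (0:ℝ), steinC 2 * ∑' x, (if ofReal t < 5 * B * w x then ‖h x‖ₑ ^ (2:ℝ) else 0) := lintegral_mono fun t => h3 t
    _ = steinC 2 * ∑' x, ‖h x‖ₑ ^ (2:ℝ) * (5 * B * w x) := by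
        rw [lintegral_const_mul _ (Measurable.tsum fun y => meas _ _), lintegral_tsum (fun y => (meas _ _).aemeasurable)]
        congr 1
        exact tsum_congr fun x => (layer1 (hw't x) _).symm
    _ = _ := by
        rw [synC, ← ENNReal.tsum_mul_left, ← ENNReal.tsum_mul_left]
        refine tsum_congr fun x => by ring
theorem cs_sum {κ : Type*} (s : Finset κ) (f g : κ → EF) :
    ∑ i ∈ s, ∑' x, f i x * g i x ≤ (∑ i ∈ s, ∑' x, f i x ^ (2:ℝ)) ^ (1/2:ℝ) * (∑ i ∈ s, ∑' x, g i x ^ (2:ℝ)) ^ (1/2:ℝ) := by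
  have h := tsum_holder (p := 2) (q := 2) (by rw [Real.holderConjugate_iff]; norm_num) (fun z : s × Z2 => f z.1 z.2) (fun z : s × Z2 => g z.1 z.2)
  rw [tsum_prod' (α := s) (β := Z2), tsum_prod' (α := s) (β := Z2), tsum_prod' (α := s) (β := Z2), tsum_fintype, tsum_fintype, tsum_fintype] at h
  rw [sum_coe_sort s (fun i => ∑' x, f i x * g i x), sum_coe_sort s (fun i => ∑' x, f i x ^ (2:ℝ)),
    sum_coe_sort s (fun i => ∑' x, g i x ^ (2:ℝ))] at h
  exact h
theorem absorb_sqrt {a Y K : ENN} (ha : a ≠ ⊤) (h : a ≤ Y ^ (1/2:ℝ) * (K * a) ^ (1/2:ℝ)) : a ≤ K * Y := by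
  rcases eq_or_ne a 0 with h0 | h0
  · rw [h0]; exact zero_le
  have h2 := rpow_le_rpow h (z := 2) (by norm_num)
  rw [mul_rpow_of_nonneg _ _ (by norm_num), ← rpow_mul, ← rpow_mul] at h2
  norm_num at h2
  rw [sq] at h2
  have : a * a ≤ (K * Y) * a := by refine h2.trans (le_of_eq (by ring))
  exact (ENNReal.mul_le_mul_iff_left h0 ha).1 this
theorem synth (v : Z2) (w : EF) {B : ENN} (hB : B ≠ ⊤) (hw0 : ∀ x, w x ≠ 0) (hwt : ∀ x, w x ≠ ⊤) (hA1 : ∀ x, Mv v w x ≤ B * w x)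
    (R : ℕ) (β : ℕ → RF) :
    ∑' x, ‖∑ i ∈ Finset.range R, act (del v i) (β i) x‖ₑ ^ (2:ℝ) / w x ≤
      synC * B * ∑ i ∈ Finset.range R, ∑' x, ‖β i x‖ₑ ^ (2:ℝ) / w x := by
  set F : RF := fun x => ∑ i ∈ Finset.range R, act (del v i) (β i) x with hF
  change ∑' x, ‖F x‖ₑ ^ (2:ℝ) / w x ≤ _
  rw [tsum_eq_iSup_sum]
  refine iSup_le fun S => ?_
  set h : RF := fun x => if x ∈ S then F x / (w x).toReal else 0 with hh
  have hwr : ∀ x, 0 < (w x).toReal := fun x => toReal_pos (hw0 x) (hwt x)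
  have hsupp : (Function.support h).Finite := S.finite_toSet.subset (fun x hx => by
    by_contra hc; simp only [Finset.mem_coe] at hc
    simp [hh, hc] at hx)
  have hew : ∀ x, ‖(w x).toReal‖ₑ = w x := fun x => by
    rw [Real.enorm_eq_ofReal (hwr x).le, ofReal_toReal (hwt x)]
  have ea : ∑ x ∈ S, ‖F x‖ₑ ^ (2:ℝ) / w x = ∑' x, ‖h x‖ₑ ^ (2:ℝ) * w x := by
    rw [tsum_eq_sum (s := S) (fun x hx => by simp [hh, hx])]
    refine sum_congr rfl fun x hx => ?_
    rw [hh]; beta_reduce; rw [if_pos hx, div_eq_mul_inv (F x), enorm_mul, enorm_inv (hwr x).ne', hew, mul_rpow_of_nonneg _ _ (by norm_num),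
      mul_assoc, ENNReal.div_eq_inv_mul, mul_comm]
    congr 1
    rw [rpow_two, sq, mul_assoc, ENNReal.inv_mul_cancel (hw0 x) (hwt x), mul_one]
  have eb : ∑ x ∈ S, ‖F x‖ₑ ^ (2:ℝ) / w x = ofReal (∑' x, F x * h x) := by
    rw [tsum_eq_sum (s := S) (fun x hx => by simp [hh, hx]), ofReal_sum_of_nonneg]
    · refine sum_congr rfl fun x hx => ?_
      rw [hh]; beta_reduce; rw [if_pos hx, ← mul_div_assoc, ofReal_div_of_pos (hwr x), ofReal_toReal (hwt x),
        rpow_two, sq, ← enorm_mul, Real.enorm_eq_ofReal (mul_self_nonneg _)]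
    · intro x hx
      rw [hh]; beta_reduce; rw [if_pos hx, ← mul_div_assoc]; exact div_nonneg (mul_self_nonneg _) (hwr x).le
  have ec : ∑' x, F x * h x = ∑ i ∈ Finset.range R, ∑' x, β i x * act (del v i) h x := by
    simp only [hF, sum_mul]
    rw [Summable.tsum_finsetSum (fun i _ => summable_fin _ _ hsupp)]
    exact sum_congr rfl fun i _ => (Adj.del v i (β i) h hsupp).2
  have ed : ofReal (∑' x, F x * h x) ≤ ∑ i ∈ Finset.range R, ∑' x, (‖β i x‖ₑ * (w x)⁻¹ ^ (1/2:ℝ)) * (‖act (del v i) h x‖ₑ * w x ^ (1/2:ℝ)) := by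
    rw [ec]
    refine (Real.ofReal_le_enorm _).trans ((enorm_sum_le _ _).trans (sum_le_sum fun i _ => ?_))
    have hs : (Function.support (act (del v i) h)).Finite := (Adj.del v i (β i) h hsupp).1
    refine (enorm_tsum_le_tsum_enorm).trans (tsum_le_tsum fun x => le_of_eq ?_)
    rw [enorm_mul, mul_mul_mul_comm, ← mul_rpow_of_nonneg _ _ (by norm_num), ENNReal.inv_mul_cancel (hw0 x) (hwt x), ENNReal.one_rpow, mul_one]
  have ee := ed.trans (cs_sum _ _ _)
  have sq1 : ∀ a b : ENN, (a * b ^ (1/2:ℝ)) ^ (2:ℝ) = a ^ (2:ℝ) * b := fun a b => by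
    rw [mul_rpow_of_nonneg _ _ (by norm_num), ← rpow_mul]; norm_num
  simp only [sq1, ← div_eq_mul_inv] at ee
  rw [← eb] at ee
  refine absorb_sqrt (K := synC * B) ?_ (ee.trans ?_)
  · rw [eb]; exact ENNReal.ofReal_ne_top
  · gcongr
    rw [ea]; exact analysis v w hB hwt hA1 R h
def e1 : Z2 := (1, 0)
def e2 : Z2 := (0, 1)
def M (g : EF) (x : Z2) : ENN := Mv e1 g x ⊔ Mv e2 g x
theorem isMax_M : IsMax M := (isMax_Mv e1).sup (isMax_Mv e2)
def Dir (v : Z2) : Prop := ∀ g x, Mv v g x ≤ M g x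
theorem dir_e1 : Dir e1 := fun _ _ => le_sup_left
theorem dir_e2 : Dir e2 := fun _ _ => le_sup_right
theorem Dir.neg {v : Z2} (h : Dir v) : Dir (-v) := fun g x => by rw [Mv_neg]; exact h g x
theorem le_M (g : EF) : g ≤ M g := fun x => (le_Mv e1 g x).trans le_sup_left
theorem le_Mit (a : ℕ) (g : EF) : g ≤ M^[a] g := by
  induction a with
  | zero => exact le_rfl
  | succ a ih => rw [Function.iterate_succ_apply']; exact ih.trans (le_M _)
theorem Mit_le {a b : ℕ} (h : a ≤ b) (g : EF) : M^[a] g ≤ M^[b] g := by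
  obtain ⟨c, rfl⟩ := Nat.exists_eq_add_of_le h
  rw [Function.iterate_add_apply]
  exact isMax_M.iterate_mono a (le_Mit c g)
theorem IsMax.le_avg {S A : EF → EF} (hS : IsMax S) (hA : IsAvg A) (g : EF) : S (A g) ≤ A (S g) := by
  obtain ⟨ι, T, h1, h2⟩ := hS
  intro x
  rw [h2]
  refine iSup_le fun i => ?_
  rw [(h1 i).comm hA]
  refine hA.mono (fun y => ?_) x
  rw [h2]; exact le_iSup (fun i => T i g y) i
theorem Mit_le_avg {A : EF → EF} (hA : IsAvg A) (a : ℕ) (g : EF) : M^[a] (A g) ≤ A (M^[a] g) := by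
  induction a with
  | zero => exact le_rfl
  | succ a ih =>
    rw [Function.iterate_succ_apply', Function.iterate_succ_apply']
    exact (isMax_M.mono ih).trans (isMax_M.le_avg hA _)
structure Dom (c : ℝ) (a : ℕ) (P : KA) : Prop where
  nn : 0 ≤ c
  dm : Dm P (fun g x => ofReal c * M^[a] g x)
namespace Dom
variable {P Q : KA} {c c' : ℝ} {a a' : ℕ}
theorem le (h : Dom c a P) (hc : c ≤ c') (ha : a ≤ a') : Dom c' a' P :=
  ⟨h.nn.trans hc, h.dm.le fun g x => mul_le_mul' (ofReal_le_ofReal hc) (Mit_le ha g x)⟩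
theorem one : Dom 1 0 1 := ⟨zero_le_one, Dm.one.le fun g x => by simp⟩
theorem mul (h : Dom c a P) (h' : Dom c' a' Q) : Dom (c * c') (a + a') (P * Q) := by
  refine ⟨mul_nonneg h.nn h'.nn, (h.dm.mul h'.dm ?_).le fun g x => ?_⟩
  · intro f g hfg x; beta_reduce; gcongr; exact isMax_M.iterate_mono a hfg x
  · beta_reduce
    rw [isMax_M.iterate_smul]
    beta_reduce
    rw [Function.iterate_add_apply, ofReal_mul h.nn, mul_assoc]
theorem add (h : Dom c a P) (h' : Dom c' a Q) : Dom (c + c') a (P + Q) :=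
  ⟨add_nonneg h.nn h'.nn, (h.dm.add h'.dm).le fun g x => by rw [ofReal_add h.nn h'.nn, add_mul]⟩
theorem neg (h : Dom c a P) : Dom c a (-P) := ⟨h.nn, h.dm.neg⟩
theorem sub (h : Dom c a P) (h' : Dom c' a Q) : Dom (c + c') a (P - Q) := by
  rw [sub_eq_add_neg]; exact h.add h'.neg
theorem smul (h : Dom c a P) (r : ℝ) : Dom (|r| * c) a (r • P) :=
  ⟨mul_nonneg (abs_nonneg _) h.nn, (h.dm.smul r).le fun g x => by
    rw [ofReal_mul (abs_nonneg _), mul_assoc, ← Real.enorm_eq_ofReal_abs]⟩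
theorem of_dm {A : EF → EF} (h : Dm P A) (hc : 0 ≤ c) (hA : ∀ g x, A g x ≤ ofReal c * M^[a] g x) : Dom c a P :=
  ⟨hc, h.le hA⟩
end Dom
theorem dom_box {v : Z2} (hv : Dir v) (N : ℕ) : Dom 3 1 (box v N) :=
  .of_dm (Dm.box v N) (by norm_num) fun g x => by
    have := (bx_le_Mv v N g x).trans (mul_le_mul_right (hv g x) 3)
    simpa using this
theorem dom_sbox {v : Z2} (hv : Dir v) (s N : ℕ) (hs : s ≤ N) : Dom 5 1 (τ v ^ s * box v N) :=
  .of_dm ((Dm.τpow v s).mul (Dm.box v N) (isAvg_sh _).monotone) (by norm_num) fun g x => by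
    rcases Nat.eq_zero_or_pos N with h | h
    · simp [h, sh, bx]
    have := bx_sh_le_bl v N (2*N) 5 s (by push_cast; omega) (by push_cast; omega) (by omega) g x
    have := this.trans (mul_le_mul_right ((bl_le_Mv _ _ _ _).trans (hv g x)) _)
    simpa [sh] using this
theorem dom_tent {v : Z2} (hv : Dir v) (N : ℕ) : Dom 9 2 (tent v N) :=
  ((dom_box hv N).mul (dom_box hv.neg N)).le (by norm_num) le_rfl
theorem dom_eta {v : Z2} (hv : Dir v) (N : ℕ) : Dom 3 1 (eta v N) :=
  .of_dm (Dm.eta v N) (by norm_num) fun g x => by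
    have := (bx_le_Mv v (2*N) g x).trans (mul_le_mul_right (hv g x) 3)
    simpa using this
theorem tent_neg (v : Z2) (N : ℕ) : tent (-v) N = tent v N := by
  rw [tent, tent, neg_neg, mul_comm]
theorem enorm_div_nat (s N : ℕ) : ‖(s:ℝ)/N‖ₑ = ofReal ((s:ℝ)/N) := Real.enorm_eq_ofReal (by positivity)
theorem L1 (v : Z2) (s N : ℕ) (hs : s ≤ 2 * N) (hN : 0 < N) :
    Dm ((1 - τ v ^ s) * tent v N) (fun g x => ofReal (18 * s / N) * bl v (4*N) g x) := by
  have e : (1 - τ v ^ s) * tent v N = ((s:ℝ)/N) • ((1 - τ v ^ N) * box (-v) N * box v s) := by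
    have := box_exch v s N
    calc _ = -((τ v ^ s - 1) * box v N) * box (-v) N := by rw [tent]; ring
      _ = -(((s:ℝ)/N) • ((τ v ^ N - 1) * box v s)) * box (-v) N := by rw [this]
      _ = _ := by rw [← smul_neg, smul_mul_assoc]; congr 1; ring
  rw [e]
  have hm : Monotone (fun (g : EF) (x : Z2) => (g x + sh ((N:ℤ) • v) g x)) := fun f g h x =>
    add_le_add (h x) ((isAvg_sh _).mono h x)
  refine ((((Dm.one.sub (Dm.τpow v N)).mul (Dm.box (-v) N) hm).mul (Dm.box v s) ?_).smul _).le fun g x => ?_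
  · exact hm.comp (isAvg_bx _ _).monotone
  · rw [enorm_div_nat]
    have key : ∀ c : ℕ, c = 0 ∨ c = N → bx (-v) N (bx v s g) (x + (c:ℤ) • v) ≤ 9 * bl v (4*N) g x := by
      intro c hc
      have hA : IsAvg (fun g : EF => bx v s g) := isAvg_bx v s
      rw [(isAvg_bx (-v) N).comm (isAvg_bx v s)]
      rw [bx]
      calc _ ≤ (s:ENN)⁻¹ * ∑ a ∈ Finset.range s, 9 * bl v (4*N) g x := by
            gcongr with a ha
            have ha := Finset.mem_range.1 ha
            have := bx_sh_le_bl (-v) N (4*N) 9 (-((c + a : ℕ):ℤ)) (by rcases hc with h | h <;> push_cast <;> omega)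
              (by push_cast; omega) (by omega) g x
            rw [bl_neg] at this
            refine le_trans (le_of_eq ?_) this
            congr 1; push_cast; rw [smul_neg, neg_smul, neg_neg, add_smul]; abel
        _ ≤ _ := by
            rw [sum_const, card_range, nsmul_eq_mul, ← mul_assoc]
            calc _ ≤ 1 * (9 * bl v (4*N) g x) := by gcongr; exact ENNReal.inv_mul_le_one _
              _ = _ := one_mul _
    have k0 := key 0 (Or.inl rfl)
    have k1 := key N (Or.inr rfl)
    simp only [Nat.cast_zero, zero_smul, add_zero] at k0
    calc _ ≤ ofReal ((s:ℝ)/N) * (9 * bl v (4*N) g x + 9 * bl v (4*N) g x) := by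
          simp only [sh]; gcongr
      _ = _ := by
          rw [← add_mul, ← mul_assoc]; norm_num
          congr 1
          rw [mul_div_assoc, ofReal_mul (by norm_num), mul_comm]; simp
theorem L1z (v : Z2) (s t m N : ℕ) (hs : s ≤ m) (ht : t ≤ m) (hm : m ≤ 2 * N) (hN : 0 < N) :
    Dm ((1 - τ v ^ s * τ (-v) ^ t) * tent v N) (fun g x => ofReal (18 * m / N) * bl v (4*N) g x) := by
  rcases le_total t s with h | h
  · have : τ v ^ s * τ (-v) ^ t = τ v ^ (s - t) := by
      obtain ⟨k, rfl⟩ := Nat.exists_eq_add_of_le h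
      rw [Nat.add_sub_cancel_left, pow_add, mul_right_comm, ← mul_pow, τ_neg_mul, one_pow, one_mul]
    rw [this]
    refine (L1 v (s-t) N (by omega) hN).le fun g x => ?_
    gcongr; omega
  · have : τ v ^ s * τ (-v) ^ t = τ (-v) ^ (t - s) := by
      obtain ⟨k, rfl⟩ := Nat.exists_eq_add_of_le h
      rw [Nat.add_sub_cancel_left, pow_add, ← mul_assoc, ← mul_pow, τ_neg_mul, one_pow, one_mul]
    rw [this, ← tent_neg]
    refine (L1 (-v) (t-s) N (by omega) hN).le fun g x => ?_
    rw [bl_neg]; gcongr; omega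
theorem tent_eq (v : Z2) (m : ℕ) : tent v m = ((m:ℝ)⁻¹ * (m:ℝ)⁻¹) • ∑ a ∈ Finset.range m, ∑ b ∈ Finset.range m, τ v ^ a * τ (-v) ^ b := by
  rw [tent, box, box, smul_mul_smul_comm, gs, gs, sum_mul_sum]
theorem avg2_one (m : ℕ) (hm : 0 < m) (P : KA) : P = ((m:ℝ)⁻¹ * (m:ℝ)⁻¹) • ∑ _a ∈ Finset.range m, ∑ _b ∈ Finset.range m, P := by
  have : (m:ℝ) ≠ 0 := by positivity
  rw [sum_const, sum_const, card_range, smul_smul, ← Nat.cast_smul_eq_nsmul ℝ, smul_smul]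
  push_cast
  have : ((m:ℝ)⁻¹ * (m:ℝ)⁻¹ * (m * m)) = 1 := by field_simp
  rw [this, one_smul]
theorem enorm_inv2 (m : ℕ) (hm : 0 < m) : ‖((m:ℝ)⁻¹ * (m:ℝ)⁻¹)‖ₑ = (m:ENN)⁻¹ * (m:ENN)⁻¹ := by
  rw [enorm_mul, enorm_inv (by positivity)]; simp
theorem avg2_le (m : ℕ) (c : ENN) : (m:ENN)⁻¹ * (m:ENN)⁻¹ * ∑ _a ∈ Finset.range m, ∑ _b ∈ Finset.range m, c ≤ c := by
  simp only [sum_const, card_range, nsmul_eq_mul]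
  calc _ = ((m:ENN)⁻¹ * m) * ((m:ENN)⁻¹ * m) * c := by ring
    _ ≤ 1 * 1 * c := by gcongr <;> exact ENNReal.inv_mul_le_one _
    _ = c := by ring
theorem L2 (v : Z2) (n m N : ℕ) (hm : 0 < m) (h : n * m ≤ 2 * N) (hN : 0 < N) :
    Dm ((1 - tent ((n:ℤ) • v) m) * tent v N) (fun g x => ofReal (18 * (n * m : ℕ) / N) * bl v (4*N) g x) := by
  have e : (1 - tent ((n:ℤ) • v) m) * tent v N = ((m:ℝ)⁻¹ * (m:ℝ)⁻¹) • ∑ a ∈ Finset.range m, ∑ b ∈ Finset.range m,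
      (1 - τ v ^ (n * a) * τ (-v) ^ (n * b)) * tent v N := by
    have h1 := avg2_one m hm (1:KA)
    conv_lhs => rw [h1, tent_eq]
    rw [← smul_sub, smul_mul_assoc]; congr 1
    rw [← sum_sub_distrib, sum_mul]
    refine sum_congr rfl fun a _ => ?_
    rw [← sum_sub_distrib, sum_mul]
    refine sum_congr rfl fun b _ => ?_
    rw [← smul_neg, τ_natsmul, τ_natsmul, pow_mul, pow_mul]
  rw [e]
  refine ((Dm.sum _ fun a ha => Dm.sum _ fun b hb => L1z v (n*a) (n*b) (n*m) N ?_ ?_ h hN).smul _).le fun g x => ?_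
  · have := Finset.mem_range.1 ha; gcongr
  · have := Finset.mem_range.1 hb; gcongr
  · rw [enorm_inv2 m hm]; exact avg2_le _ _
theorem bx_nsmul (v : Z2) (n N : ℕ) (g : EF) (x : Z2) : bx ((n:ℤ) • v) N (bx v n g) x = bx v (n * N) g x := by
  simp only [bx]
  rw [← mul_sum, ← mul_assoc, Nat.cast_mul, ENNReal.mul_inv (by simp) (by simp), mul_comm (n:ENN)⁻¹]
  congr 1
  induction N with
  | zero => simp
  | succ N ih =>
    rw [sum_range_succ, ih, Nat.mul_succ, sum_range_add]
    congr 1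
    refine sum_congr rfl fun a _ => ?_
    congr 1; push_cast; rw [smul_smul, add_smul, mul_comm (n:ℤ)]; abel
theorem bx_le_nbx (v : Z2) (n N : ℕ) (hn : 0 < n) (h : n ≤ N) (g : EF) (x : Z2) : bx v N g x ≤ 5 * bx v n (bl v (2*N) g) x := by
  have : ∀ a ∈ Finset.range n, bx v N g x ≤ 5 * bl v (2*N) g (x + (a:ℤ) • v) := fun a ha => by
    have ha := Finset.mem_range.1 ha
    have := bx_sh_le_bl v N (2*N) 5 (-(a:ℤ)) (by push_cast; omega) (by push_cast; omega) (by omega) g (x + (a:ℤ) • v)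
    rwa [add_assoc, ← add_smul, add_neg_cancel, zero_smul, add_zero] at this
  have h2 := sum_le_sum this
  rw [sum_const, card_range, nsmul_eq_mul] at h2
  have hn' : (n:ENN) ≠ 0 := by simp; omega
  calc _ = (n:ENN)⁻¹ * (n * bx v N g x) := by rw [← mul_assoc, ENNReal.inv_mul_cancel hn' (by simp), one_mul]
    _ ≤ (n:ENN)⁻¹ * ∑ a ∈ Finset.range n, 5 * bl v (2*N) g (x + (a:ℤ) • v) := by gcongr
    _ = _ := by rw [bx, ← mul_sum]; ring
theorem comb_le (v : Z2) (n m N : ℕ) (hn : 0 < n) (h : n ≤ N) (g : EF) (x : Z2) :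
    bx ((n:ℤ) • v) m (bx v N g) x ≤ 5 * bx v (n * m) (bl v (2*N) g) x := by
  rw [← bx_nsmul, ← (isAvg_bx _ _).smul]
  exact (isAvg_bx _ _).mono (fun y => bx_le_nbx v n N hn h g y) x
theorem dom_comb {v : Z2} (hv : Dir v) (n m N : ℕ) (hn : 0 < n) (h : n ≤ N) : Dom 15 2 (box ((n:ℤ) • v) m * box v N) :=
  .of_dm ((Dm.box _ m).mul (Dm.box v N) (isAvg_bx _ _).monotone) (by norm_num) fun g x => by
    refine (comb_le v n m N hn h g x).trans ?_
    calc _ ≤ 5 * (3 * M (bl v (2*N) g) x) := by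
          gcongr; exact (bx_le_Mv v _ _ x).trans (mul_le_mul_right (hv _ x) 3)
      _ ≤ 5 * (3 * M (M g) x) := by
          gcongr; exact isMax_M.mono (fun y => (bl_le_Mv _ _ _ _).trans (hv _ y)) x
      _ = _ := by rw [← mul_assoc]; norm_num
theorem dom_scomb {v : Z2} (hv : Dir v) (n m N : ℕ) (hn : 0 < n) (h : n ≤ N) :
    Dom 25 2 (τ ((n:ℤ) • v) ^ m * (box (-((n:ℤ) • v)) m * box (-v) N)) :=
  .of_dm ((Dm.τpow _ m).mul ((Dm.box _ m).mul (Dm.box _ N) (isAvg_bx _ _).monotone) (isAvg_sh _).monotone) (by norm_num) fun g x => by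
    rcases Nat.eq_zero_or_pos m with hm | hm
    · simp [hm, sh, bx]
    rw [sh, ← smul_neg]
    refine (comb_le (-v) n m N hn h g _).trans ?_
    have hnm : 0 < n * m := Nat.mul_pos hn hm
    have := bx_sh_le_bl (-v) (n*m) (2*(n*m)) 5 (-((n*m:ℕ):ℤ)) (by push_cast; nlinarith) (by push_cast; nlinarith) (by omega) (bl (-v) (2*N) g) x
    have ee : x + (m:ℤ) • (n:ℤ) • v = x + (-((n*m:ℕ):ℤ)) • (-v) := by
      rw [smul_neg, neg_smul, neg_neg, smul_smul]; push_cast; rw [mul_comm]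
    rw [ee]
    calc _ ≤ 5 * (5 * M (bl (-v) (2*N) g) x) := by
          gcongr; exact this.trans (mul_le_mul_right ((bl_le_Mv _ _ _ _).trans (hv.neg _ x)) 5)
      _ ≤ 5 * (5 * M (M g) x) := by
          gcongr; exact isMax_M.mono (fun y => (bl_le_Mv _ _ _ _).trans (hv.neg _ y)) x
      _ = _ := by rw [← mul_assoc]; norm_num
theorem dom_y {v : Z2} (hv : Dir v) (n m N : ℕ) (hn : 0 < n) (h : n ≤ N) : Dom 225 4 (tent ((n:ℤ) • v) m * tent v N) := by
  have := (dom_comb hv n m N hn h).mul (dom_comb hv.neg n m N hn h)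
  rw [smul_neg] at this
  rw [tent, tent, mul_mul_mul_comm]
  exact this.le (by norm_num) le_rfl
theorem dom_ygain {v : Z2} (hv : Dir v) (n m q N : ℕ) (hn : 0 < n) (h : n ≤ N) :
    Dom (600 * q / m) 4 (tent ((n:ℤ) • v) m * (1 - τ ((n:ℤ) • v) ^ q) * tent v N) := by
  set z := (n:ℤ) • v with hz
  have e : tent z m * (1 - τ z ^ q) * tent v N = ((q:ℝ)/m) • ((box z q * box v N) * (box (-z) m * box (-v) N - τ z ^ m * (box (-z) m * box (-v) N))) := by
    have := box_exch z q m
    calc _ = -((τ z ^ q - 1) * box z m) * (box (-z) m * tent v N) := by rw [tent]; ring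
      _ = -(((q:ℝ)/m) • ((τ z ^ m - 1) * box z q)) * (box (-z) m * tent v N) := by rw [this]
      _ = _ := by rw [← smul_neg, smul_mul_assoc]; congr 1; rw [tent]; ring
  rw [e]
  have h2 := dom_comb hv.neg n m N hn h
  rw [smul_neg] at h2
  refine (((dom_comb hv n q N hn h).mul (h2.sub (dom_scomb hv n m N hn h))).smul _).le (le_of_eq ?_) le_rfl
  rw [abs_of_nonneg (by positivity)]; ring
theorem dom_L2 {v : Z2} (hv : Dir v) (n m N : ℕ) (hm : 0 < m) (h : n * m ≤ 2 * N) (hN : 0 < N) :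
    Dom (18 * (n * m : ℕ) / N) 1 ((1 - tent ((n:ℤ) • v) m) * tent v N) :=
  .of_dm (L2 v n m N hm h hN) (by positivity) fun g x => by
    gcongr; exact (bl_le_Mv _ _ _ _).trans (hv _ _)
theorem dom_L2' {v : Z2} (hv : Dir v) (m N : ℕ) (hm : 0 < m) (h : m ≤ 2 * N) (hN : 0 < N) :
    Dom (18 * (m:ℝ) / N) 1 ((1 - tent v m) * tent v N) := by
  have := dom_L2 hv 1 m N hm (by omega) hN
  simpa using this
theorem dom_L1 {v : Z2} (hv : Dir v) (s N : ℕ) (h : s ≤ 2 * N) (hN : 0 < N) :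
    Dom (18 * (s:ℝ) / N) 1 ((1 - τ v ^ s) * tent v N) :=
  .of_dm (L1 v s N h hN) (by positivity) fun g x => by
    gcongr; exact (bl_le_Mv _ _ _ _).trans (hv _ _)
def xk (i : ℕ) : KA := tent e1 (2^i)
def Tk (j : ℕ) : KA := tent e2 (2^j)
def yk (n i : ℕ) : KA := tent ((n:ℤ) • e2) (2^i)
theorem del_eq (v : Z2) (i : ℕ) : del v i = tent v (2^i) - tent v (2^(i+1)) := by
  rw [del, ← tent_sub, pow_succ, mul_comm]
def gc (i N : ℕ) : ℝ := min (2^i/2^N) (2^N/2^i)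
theorem gc_nn (i N : ℕ) : 0 ≤ gc i N := le_min (by positivity) (by positivity)
theorem gc_lt {i N : ℕ} (h : i ≤ N) : gc i N = 2^i/2^N := by
  have : (2:ℝ)^i ≤ 2^N := pow_le_pow_right₀ (by norm_num) h
  rw [gc, min_eq_left]
  rw [div_le_div_iff₀ (by positivity) (by positivity)]; gcongr
theorem gc_ge {i N : ℕ} (h : N ≤ i) : gc i N = 2^N/2^i := by
  have : (2:ℝ)^N ≤ 2^i := pow_le_pow_right₀ (by norm_num) h
  rw [gc, min_eq_right]
  rw [div_le_div_iff₀ (by positivity) (by positivity)]; gcongr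
theorem gc_le_one (i N : ℕ) : gc i N ≤ 1 := by
  rcases le_total i N with h | h
  · rw [gc_lt h, div_le_one (by positivity)]; exact pow_le_pow_right₀ (by norm_num) h
  · rw [gc_ge h, div_le_one (by positivity)]; exact pow_le_pow_right₀ (by norm_num) h
theorem sum_two_pow (N : ℕ) : ∑ i ∈ Finset.range N, (2:ℝ)^i = 2^N - 1 := by
  have := geom_sum_mul (2:ℝ) N; linarith
theorem sum_half_pow (N : ℕ) : ∑ i ∈ Finset.range N, 1/(2:ℝ)^i ≤ 2 := by
  have : ∀ N : ℕ, ∑ i ∈ Finset.range N, 1/(2:ℝ)^i = 2 - 2/2^N := by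
    intro N
    induction N with
    | zero => norm_num
    | succ N ih => rw [sum_range_succ, ih, pow_succ]; field_simp; ring
  rw [this]; have : (0:ℝ) < 2/2^N := by positivity
  linarith
theorem gc_sum (N R : ℕ) : ∑ i ∈ Finset.range R, gc i N ≤ 3 := by
  have h1 : ∑ i ∈ Finset.range N, gc i N ≤ 1 := by
    have : ∑ i ∈ Finset.range N, gc i N = ∑ i ∈ Finset.range N, 2^i/2^N :=
      sum_congr rfl fun i hi => gc_lt (Finset.mem_range.1 hi).le
    rw [this, ← sum_div, sum_two_pow, div_le_one (by positivity)]; linarith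
  calc _ ≤ ∑ i ∈ Finset.range (N + R), gc i N := sum_le_sum_of_subset_of_nonneg
        (range_mono (by omega)) (fun i _ _ => gc_nn i N)
    _ = ∑ i ∈ Finset.range N, gc i N + ∑ i ∈ Finset.range R, 1/(2:ℝ)^i := by
        rw [sum_range_add]; congr 1
        refine sum_congr rfl fun i _ => ?_
        rw [gc_ge (by omega), pow_add]; field_simp
    _ ≤ _ := by have := sum_half_pow R; linarith
theorem dom_cot1 (i N : ℕ) (h : i < N) : Dom (54 * gc i N) 1 (xk N * del e1 i) := by
  have hp : (2:ℕ)^(i+1) ≤ 2^N := pow_le_pow_right₀ (by norm_num) h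
  have hp' : (2:ℕ)^(i+1) = 2 * 2^i := by rw [pow_succ, mul_comm]
  have h1 := dom_L2' dir_e1 (2^i) (2^N) (by positivity) (by omega) (by positivity)
  have h2 := dom_L2' dir_e1 (2^(i+1)) (2^N) (by positivity) (by omega) (by positivity)
  have e : xk N * del e1 i = (1 - tent e1 (2^(i+1))) * tent e1 (2^N) - (1 - tent e1 (2^i)) * tent e1 (2^N) := by
    rw [del_eq, xk]; ring
  rw [e]
  refine (h2.sub h1).le (le_of_eq ?_) le_rfl
  rw [gc_lt h.le]; push_cast; rw [pow_succ]; field_simp; ring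
theorem dom_cot2 (i N : ℕ) (h : N ≤ i) : Dom (54 * gc i N) 1 ((1 - xk N) * del e1 i) := by
  have hp : (2:ℕ)^N ≤ 2^i := pow_le_pow_right₀ (by norm_num) h
  have hp' : (2:ℕ)^(i+1) = 2 * 2^i := by rw [pow_succ, mul_comm]
  have h1 := dom_L2' dir_e1 (2^N) (2^i) (by positivity) (by omega) (by positivity)
  have h2 := dom_L2' dir_e1 (2^N) (2^(i+1)) (by positivity) (by omega) (by positivity)
  have e : (1 - xk N) * del e1 i = (1 - tent e1 (2^N)) * tent e1 (2^i) - (1 - tent e1 (2^N)) * tent e1 (2^(i+1)) := by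
    rw [del_eq, xk]; ring
  rw [e]
  refine (h1.sub h2).le ?_ le_rfl
  rw [gc_ge h]; push_cast; rw [pow_succ]
  have : (0:ℝ) ≤ 2^N/2^i := by positivity
  have e2 : 18 * (2:ℝ)^N/2^i + 18*2^N/(2^i*2) = 27 * (2^N/2^i) := by field_simp; ring
  rw [e2]; linarith
theorem dom_one_sub_x (N : ℕ) : Dom 10 2 (1 - xk N) :=
  ((Dom.one.le le_rfl (by norm_num)).sub (dom_tent dir_e1 (2^N))).le (by norm_num) le_rfl
theorem act_fsum {ι : Type*} (P : KA) (s : Finset ι) (F : ι → RF) (x : Z2) :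
    act P (fun y => ∑ i ∈ s, F i y) x = ∑ i ∈ s, act P (F i) x := by
  have : (fun y => ∑ i ∈ s, F i y) = ∑ i ∈ s, F i := by ext y; simp
  rw [this, map_sum]; simp
theorem cotlar (R N : ℕ) (hN : N ≤ R) (β : ℕ → RF) (x : Z2) :
    ‖∑ i ∈ Finset.range N, act (del e1 i) (β i) x‖ₑ ≤
      10 * M^[2] (fun y => ‖∑ i ∈ Finset.range R, act (del e1 i) (β i) y‖ₑ) x
      + ∑ i ∈ Finset.range R, ofReal (54 * gc i N) * M (fun y => ‖β i y‖ₑ) x := by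
  set F : RF := fun y => ∑ i ∈ Finset.range R, act (del e1 i) (β i) y with hF
  have e : ∑ i ∈ Finset.range N, act (del e1 i) (β i) x = act (1 - xk N) F x +
      ∑ i ∈ Finset.range R, (if i < N then act (xk N * del e1 i) (β i) x else - act ((1 - xk N) * del e1 i) (β i) x) := by
    have h1 : act (1 - xk N) F x = ∑ i ∈ Finset.range R, act ((1 - xk N) * del e1 i) (β i) x := by
      rw [hF, act_fsum]; simp only [act_mul]
    rw [h1, ← sum_add_distrib]
    have h2 : ∑ i ∈ Finset.range N, act (del e1 i) (β i) x = ∑ i ∈ Finset.range R, if i < N then act (del e1 i) (β i) x else 0 := by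
      rw [← Finset.sum_filter]
      refine sum_congr ?_ fun _ _ => rfl
      ext i; simp; omega
    rw [h2]
    refine sum_congr rfl fun i _ => ?_
    split_ifs
    · rw [sub_mul, one_mul, act_sub]; ring
    · ring
  rw [e]
  refine (enorm_add_le _ _).trans (add_le_add ?_ ((enorm_sum_le _ _).trans (sum_le_sum fun i _ => ?_)))
  · simpa using (dom_one_sub_x N).dm F x
  · split_ifs with h
    · exact (dom_cot1 i N h).dm (β i) x
    · rw [enorm_neg]; exact (dom_cot2 i N (by omega)).dm (β i) x
theorem tele (X : ℕ → KA) (a b : ℕ) (h : a ≤ b) : X a - X b = ∑ i ∈ Finset.Ico a b, (X i - X (i+1)) := by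
  induction b, h using Nat.le_induction with
  | base => simp
  | succ b h ih => rw [sum_Ico_succ_top h, ← ih]; ring
theorem dom_xeta (i' α : ℕ) (h : i' ≤ α) : Dom (27 * (2^i'/2^α)) 2 (xk α * eta e1 (2^i')) := by
  have hp : (2:ℕ)^i' ≤ 2^α := pow_le_pow_right₀ (by norm_num) h
  have h1 := ((dom_L1 dir_e1 (2^i') (2^α) (by omega) (by positivity)).mul (dom_box dir_e1 (2^i'))).smul (1/2)
  have e : xk α * eta e1 (2^i') = (1/2:ℝ) • ((1 - τ e1 ^ 2^i') * tent e1 (2^α) * box e1 (2^i')) := by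
    rw [eta, mul_smul_comm, xk]; congr 1; ring
  rw [e]
  refine h1.le (le_of_eq ?_) le_rfl
  rw [abs_of_nonneg (by norm_num)]; push_cast; ring
theorem band_of_sum {ι : Type*} (s : Finset ι) (P : KA) (A B : ι → KA) (c : ι → ℝ) (a : ℕ)
    (hP : P = ∑ i ∈ s, A i * B i) (hA : ∀ i ∈ s, Dom (c i) a (A i)) (g : RF) (x : Z2) :
    ‖act P g x‖ₑ ≤ ∑ i ∈ s, ofReal (c i) * M^[a] (fun y => ‖act (B i) g y‖ₑ) x := by
  rw [hP, act_sum]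
  refine (enorm_sum_le _ _).trans (sum_le_sum fun i hi => ?_)
  rw [act_mul]
  exact (hA i hi).dm _ x
theorem gc_comm (i N : ℕ) : gc i N = gc N i := min_comm _ _
theorem hband (R i α β : ℕ) (hα : i ≤ α) (hβ : β ≤ i + 1) (hR : i < R) (g : RF) (x : Z2) :
    ‖act (xk α * (1 - xk β)) g x‖ₑ ≤ ∑ i' ∈ Finset.range R, ofReal (27 * gc i' i) *
      M^[2] (fun y => ‖act (eta (-e1) (2^i')) g y‖ₑ) x := by
  have e : xk α * (1 - xk β) = ∑ i' ∈ Finset.range β, (xk α * eta e1 (2^i')) * eta (-e1) (2^i') := by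
    have h0 : (1:KA) = xk 0 := by rw [xk, pow_zero, tent_one]
    conv_lhs => rw [h0]
    rw [tele xk 0 β (Nat.zero_le _), mul_sum, ← range_eq_Ico]
    refine sum_congr rfl fun k _ => ?_
    have := del_eq e1 k
    rw [xk, xk, xk, ← this, del, mul_assoc]
  refine (band_of_sum _ _ _ _ (fun i' => 27 * gc i' i) 2 e (fun i' hi => ?_) g x).trans ?_
  · have hi := Finset.mem_range.1 hi
    refine (dom_xeta i' α (by omega)).le ?_ le_rfl
    rw [gc_lt (by omega)]
    have : (2:ℝ)^i ≤ 2^α := pow_le_pow_right₀ (by norm_num) hα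
    gcongr
  · exact sum_le_sum_of_subset (range_mono (by omega))
def kV (n i j : ℕ) : ℝ := min (((n * 2^i : ℕ):ℝ)/2^j) (2^j/((n * 2^i : ℕ):ℝ)) + n/2^j
theorem kV_nn (n i j : ℕ) : 0 ≤ kV n i j := by unfold kV; positivity
def thj (J j : ℕ) : KA := if j < J then eta (-e2) (2^j) else 1
theorem dom_Y1 (n γ d : ℕ) (hn : 0 < n) (h : n ≤ 2^d) : Dom 225 4 (yk n γ * Tk d) := dom_y dir_e2 n _ _ hn h
theorem dom_Y2 (n γ d : ℕ) (hn : 0 < n) (h : n ≤ 2^d) : Dom 234 4 ((1 - yk n γ) * Tk d) := by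
  rw [sub_mul, one_mul]
  exact (((dom_tent dir_e2 (2^d)).le le_rfl (by norm_num)).sub (dom_Y1 n γ d hn h)).le (by norm_num) le_rfl
theorem dom_Y3 (n i δ j : ℕ) (hδ : δ ≤ i + 1) (h : n * 2^i ≤ 2^j) :
    Dom (36 * (((n * 2^i : ℕ):ℝ)/2^j)) 1 ((1 - yk n δ) * Tk j) := by
  have h2 : n * 2^δ ≤ 2 * (n * 2^i) := by
    have : 2^δ ≤ 2^(i+1) := Nat.pow_le_pow_right (by norm_num) hδ
    calc n * 2^δ ≤ n * 2^(i+1) := Nat.mul_le_mul_left _ this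
      _ = _ := by ring
  refine (dom_L2 dir_e2 n (2^δ) (2^j) (by positivity) (by omega) (by positivity)).le ?_ le_rfl
  have : ((n * 2^δ : ℕ):ℝ) ≤ 2 * ((n * 2^i : ℕ):ℝ) := by exact_mod_cast h2
  rw [Nat.cast_pow, Nat.cast_ofNat, mul_div_assoc]
  calc 18 * (((n * 2^δ : ℕ):ℝ)/2^j) ≤ 18 * ((2 * ((n * 2^i : ℕ):ℝ))/2^j) := by gcongr
    _ = _ := by ring
theorem dom_vj (n i γ δ d j : ℕ) (hn : 0 < n) (hnd : n ≤ 2^d) (hγ : i ≤ γ) (hδ : δ ≤ i + 1) :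
    Dom (10^7 * kV n i j) 11 (yk n γ * (1 - yk n δ) * Tk d^2 * (eta e2 (2^j) * (Tk j + Tk (j+1)))) := by
  have hn' : (0:ℝ) < n := by exact_mod_cast hn
  have hn0 : (0:ℝ) ≤ n/2^j := by positivity
  by_cases hc : n * 2^i ≤ 2^j
  · have hc' : ((n * 2^i : ℕ):ℝ) ≤ 2^j := by exact_mod_cast hc
    have h3 := ((dom_Y3 n i δ j hδ hc).add (dom_Y3 n i δ (j+1) hδ (hc.trans (Nat.pow_le_pow_right (by norm_num) (by omega)))))
    have h := (((dom_Y1 n γ d hn hnd).mul h3).mul (dom_tent dir_e2 (2^d))).mul (dom_eta dir_e2 (2^j))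
    have e : yk n γ * (1 - yk n δ) * Tk d^2 * (eta e2 (2^j) * (Tk j + Tk (j+1))) =
      yk n γ * Tk d * ((1 - yk n δ) * Tk j + (1 - yk n δ) * Tk (j + 1)) * tent e2 (2 ^ d) * eta e2 (2 ^ j) := by
      rw [show tent e2 (2^d) = Tk d from rfl]; ring
    rw [e]
    refine h.le ?_ (by norm_num)
    have hk : kV n i j = ((n * 2^i : ℕ):ℝ)/2^j + n/2^j := by
      rw [kV, min_eq_left]
      have : (0:ℝ) < ((n * 2^i : ℕ):ℝ) := by positivity
      rw [div_le_div_iff₀ (by positivity) this]; gcongr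
    rw [hk]
    have e3 : ((n * 2^i : ℕ):ℝ)/2^(j+1) = ((n * 2^i : ℕ):ℝ)/2^j/2 := by rw [pow_succ]; field_simp
    rw [e3]
    have : (0:ℝ) ≤ ((n * 2^i : ℕ):ℝ)/2^j := by positivity
    nlinarith
  · push Not at hc
    have hc' : (2:ℝ)^j ≤ ((n * 2^i : ℕ):ℝ) := by exact_mod_cast hc.le
    set q := 2^j / n with hq
    set ρ := 2^j % n with hρ
    have hqr : n * q + ρ = 2^j := Nat.div_add_mod _ _
    have hρn : ρ < n := Nat.mod_lt _ hn
    have hT : Dom 18 2 (Tk j + Tk (j+1)) := ((dom_tent dir_e2 _).add (dom_tent dir_e2 _)).le (by norm_num) le_rfl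
    have ha := (((dom_ygain dir_e2 n (2^γ) q (2^d) hn hnd).mul (dom_Y2 n δ d hn hnd)).mul (dom_box dir_e2 (2^j))).mul hT
    have hρ1 : ρ ≤ 2^j := by omega
    have hL := (dom_L1 dir_e2 ρ (2^j) (by omega) (by positivity)).add (dom_L1 dir_e2 ρ (2^(j+1)) (by rw [pow_succ]; omega) (by positivity))
    have hb := (((dom_Y1 n γ d hn hnd).mul (dom_Y2 n δ d hn hnd)).mul (dom_sbox dir_e2 (n*q) (2^j) (by omega))).mul hL
    have h := (ha.add (hb.le le_rfl (by norm_num))).smul (1/2)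
    have e : yk n γ * (1 - yk n δ) * Tk d^2 * (eta e2 (2^j) * (Tk j + Tk (j+1))) = (1/2:ℝ) •
      (tent ((n:ℤ) • e2) (2 ^ γ) * (1 - τ ((n:ℤ) • e2) ^ q) * tent e2 (2 ^ d) * ((1 - yk n δ) * Tk d) * box e2 (2 ^ j) * (Tk j + Tk (j + 1)) +
        yk n γ * Tk d * ((1 - yk n δ) * Tk d) * (τ e2 ^ (n * q) * box e2 (2 ^ j)) *
          ((1 - τ e2 ^ ρ) * tent e2 (2 ^ j) + (1 - τ e2 ^ ρ) * tent e2 (2 ^ (j + 1)))) := by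
      rw [eta, smul_mul_assoc, mul_smul_comm]; congr 1
      have e4 : τ ((n:ℤ) • e2) ^ q = τ e2 ^ (n * q) := by rw [τ_natsmul, pow_mul]
      have e5 : τ e2 ^ 2^j = τ e2 ^ (n*q) * τ e2 ^ ρ := by rw [← pow_add, hqr]
      rw [e4, e5, show tent e2 (2^j) = Tk j from rfl, show tent e2 (2^(j+1)) = Tk (j+1) from rfl,
        show tent e2 (2^d) = Tk d from rfl, show tent ((n:ℤ) • e2) (2^γ) = yk n γ from rfl]
      ring
    rw [e]
    refine h.le ?_ (by norm_num)
    have hk : kV n i j = 2^j/((n * 2^i : ℕ):ℝ) + n/2^j := by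
      rw [kV, min_eq_right]
      have : (0:ℝ) < ((n * 2^i : ℕ):ℝ) := by positivity
      rw [div_le_div_iff₀ this (by positivity)]; gcongr
    rw [hk, abs_of_nonneg (by norm_num)]
    have q1 : (q:ℝ)/((2^γ : ℕ):ℝ) ≤ 2^j/((n * 2^i : ℕ):ℝ) := by
      rw [div_le_div_iff₀ (by positivity) (by positivity)]
      have a1 : (n:ℝ) * q ≤ 2^j := by exact_mod_cast (by omega : n * q ≤ 2^j)
      have a2 : (2:ℝ)^i ≤ 2^γ := pow_le_pow_right₀ (by norm_num) hγ
      push_cast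
      calc (q:ℝ) * (n * 2^i) = (n * q) * 2^i := by ring
        _ ≤ 2^j * 2^γ := by gcongr
    have q2 : (ρ:ℝ)/((2^j : ℕ):ℝ) ≤ n/2^j := by push_cast; gcongr
    have q3 : 18 * (ρ:ℝ)/((2^(j+1) : ℕ):ℝ) = 9 * ((ρ:ℝ)/((2^j : ℕ):ℝ)) := by push_cast; rw [pow_succ]; field_simp; ring
    rw [q3, mul_div_assoc, mul_div_assoc]
    have : (0:ℝ) ≤ 2^j/((n * 2^i : ℕ):ℝ) := by positivity
    nlinarith
theorem vband (n i γ δ d J : ℕ) (hn : 0 < n) (hnd : n ≤ 2^d) (hγ : i ≤ γ) (hδ : δ ≤ i + 1) (hJ : d ≤ J)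
    (hJ2 : n * 2^i ≤ 2^J) (g : RF) (x : Z2) :
    ‖act (yk n γ * (1 - yk n δ) * Tk d^4) g x‖ₑ ≤ ∑ j ∈ Finset.Icc d J, ofReal (10^7 * kV n i j) *
      M^[11] (fun y => ‖act (thj J j) g y‖ₑ) x := by
  set A : ℕ → KA := fun j => if j < J then yk n γ * (1 - yk n δ) * Tk d^2 * (eta e2 (2^j) * (Tk j + Tk (j+1)))
    else yk n γ * (1 - yk n δ) * Tk d^2 * Tk j ^2 with hA
  refine band_of_sum _ _ A _ _ 11 ?_ (fun j hj => ?_) g x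
  · rw [← Finset.Ico_add_one_right_eq_Icc, sum_Ico_succ_top hJ]
    have h1 : ∑ k ∈ Finset.Ico d J, A k * thj J k = ∑ k ∈ Finset.Ico d J, yk n γ * (1 - yk n δ) * Tk d^2 * (Tk k^2 - Tk (k+1)^2) := by
      refine sum_congr rfl fun k hk => ?_
      have := (Finset.mem_Ico.1 hk).2
      simp only [hA, thj, this, if_true]
      have e := del_eq e2 k
      rw [del] at e
      change _ = Tk k - Tk (k+1) at e
      linear_combination yk n γ * (1 - yk n δ) * Tk d^2 * (Tk k + Tk (k+1)) * e
    rw [h1, ← mul_sum, ← tele (fun k => Tk k^2) d J hJ]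
    simp only [hA, thj, lt_irrefl, if_false]
    ring
  · have hj := Finset.mem_Icc.1 hj
    by_cases h : j < J
    · simp only [hA, h, if_true]; exact dom_vj n i γ δ d j hn hnd hγ hδ
    · have : j = J := by omega
      subst this
      simp only [hA, lt_irrefl, if_false]
      have h := (((dom_Y1 n γ d hn hnd).mul (dom_Y3 n i δ j hδ hJ2)).mul (dom_tent dir_e2 (2^d))).mul (dom_tent dir_e2 (2^j))
      have e : yk n γ * (1 - yk n δ) * Tk d^2 * Tk j ^ 2 = yk n γ * Tk d * ((1 - yk n δ) * Tk j) * tent e2 (2^d) * tent e2 (2^j) := by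
        rw [show tent e2 (2^j) = Tk j from rfl, show tent e2 (2^d) = Tk d from rfl]; ring
      rw [e]
      refine h.le ?_ (by norm_num)
      have hc' : ((n * 2^i : ℕ):ℝ) ≤ 2^j := by exact_mod_cast hJ2
      have hk : kV n i j = ((n * 2^i : ℕ):ℝ)/2^j + n/2^j := by
        rw [kV, min_eq_left]
        have : (0:ℝ) < ((n * 2^i : ℕ):ℝ) := by positivity
        rw [div_le_div_iff₀ (by positivity) this]; gcongr
      rw [hk]
      have : (0:ℝ) ≤ ((n * 2^i : ℕ):ℝ)/2^j := by positivity
      have : (0:ℝ) ≤ (n:ℝ)/2^j := by positivity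
      nlinarith
theorem comb_M {v : Z2} (hv : Dir v) (n m N : ℕ) (hn : 0 < n) (h : n ≤ N) (g : EF) (x : Z2) :
    bx ((n:ℤ) • v) m (bx v N g) x ≤ 15 * M (M g) x := by
  refine (comb_le v n m N hn h g x).trans ?_
  calc _ ≤ 5 * (3 * M (bl v (2*N) g) x) := by
        gcongr; exact (bx_le_Mv v _ _ x).trans (mul_le_mul_right (hv _ x) 3)
    _ ≤ 5 * (3 * M (M g) x) := by
        gcongr; exact isMax_M.mono (fun y => (bl_le_Mv _ _ _ _).trans (hv _ _)) x
    _ = _ := by rw [← mul_assoc]; norm_num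
theorem k4 {u v : Z2} (hu : Dir u) (hv : Dir v) (n N P K d : ℕ) (hn : 0 < n) (hd : n ≤ 2^d) (hP : 0 < P) (hPN : P ≤ N)
    (hK : N ≤ K * P) : Dom (75 * K) 3 (box (u + (n:ℤ) • v) N * box u P * box v (2^d)) := by
  refine .of_dm (((Dm.box _ N).mul (Dm.box u P) (isAvg_bx _ _).monotone).mul (Dm.box v (2^d))
    ((isAvg_bx _ _).monotone.comp (isAvg_bx _ _).monotone)) (by positivity) fun g x => ?_
  have h1 : ∀ h : EF, bx (u + (n:ℤ) • v) N (bx u P h) x ≤ (5*K:ℕ) * bx ((n:ℤ) • v) N (bl u (2*N) h) x := by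
    intro h
    rw [bx, bx, mul_left_comm]
    refine mul_le_mul_right (α := ENN) ?_ _
    rw [mul_sum]
    refine sum_le_sum fun a ha => ?_
    have ha := Finset.mem_range.1 ha
    have := bx_sh_le_bl u P (2*N) (5*K) a (by push_cast; omega) (by push_cast; omega) (by nlinarith) h (x + (a:ℤ) • ((n:ℤ) • v))
    rw [smul_add, ← add_assoc, add_right_comm]; exact this
  refine (h1 _).trans ?_
  rw [(isAvg_bx _ _).comm (isAvg_bl _ _)]
  calc _ ≤ ((5*K:ℕ):ENN) * M (fun y => 15 * M (M g) y) x := by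
        gcongr
        refine ((isAvg_bl u (2*N)).mono (fun y => comb_M hv n N (2^d) hn hd g y) x).trans ((bl_le_Mv _ _ _ _).trans (hu _ _))
    _ = ((5*K:ℕ):ENN) * (15 * M (M (M g)) x) := by rw [isMax_M.smul]
    _ = ofReal (75 * K) * M^[3] g x := by
        rw [ofReal_mul (by norm_num), ofReal_natCast, ← mul_assoc]
        congr 1
        push_cast; rw [ofReal_ofNat]; ring
theorem dom_nice (n r ρ m d : ℕ) (hn : 0 < n) (hd : n ≤ 2^d) (h1 : ρ ≤ r) (h2 : r ≤ ρ + m) :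
    Dom ((75 * 2^m)*(75*2^m)) 6 (tent (e1 + (n:ℤ) • e2) (2^r) * xk ρ * Tk d) := by
  have a1 : 2^ρ ≤ 2^r := Nat.pow_le_pow_right (by norm_num) h1
  have a2 : 2^r ≤ 2^m * 2^ρ := by rw [← pow_add]; exact Nat.pow_le_pow_right (by norm_num) (by omega)
  have p1 := k4 dir_e1 dir_e2 n (2^r) (2^ρ) (2^m) d hn hd (by positivity) a1 a2
  have p2 := k4 dir_e1.neg dir_e2.neg n (2^r) (2^ρ) (2^m) d hn hd (by positivity) a1 a2
  have hz : -e1 + (n:ℤ) • -e2 = -(e1 + (n:ℤ) • e2) := by rw [smul_neg]; abel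
  rw [hz] at p2
  have e : tent (e1 + (n:ℤ) • e2) (2^r) * xk ρ * Tk d =
    (box (e1 + (n:ℤ) • e2) (2^r) * box e1 (2^ρ) * box e2 (2^d)) * (box (-(e1 + (n:ℤ) • e2)) (2^r) * box (-e1) (2^ρ) * box (-e2) (2^d)) := by
    rw [tent, xk, Tk, tent, tent]; ring
  rw [e]
  exact (p1.mul p2).le (by push_cast; exact le_rfl) le_rfl
theorem k3 (n r γ : ℕ) (h : γ ≤ r + 1) : Dm (tent (e1 + (n:ℤ) • e2) (2^r) * (xk γ - yk n γ))
    (fun g x => ofReal (18 * (2^γ:ℕ) / (2^r:ℕ)) * bl (e1 + (n:ℤ) • e2) (4*2^r)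
      (bx ((n:ℤ) • -e2) (2^γ) (bx ((n:ℤ) • e2) (2^γ) g)) x) := by
  set z := e1 + (n:ℤ) • e2 with hz
  set m := 2^γ with hm
  set w := (n:ℤ) • e2 with hw
  have hm0 : 0 < m := by positivity
  have hmN : m ≤ 2 * 2^r := by rw [← pow_succ']; exact Nat.pow_le_pow_right (by norm_num) h
  have e1' : ∀ a b : ℕ, τ e1 ^ a * τ (-e1) ^ b = (τ z ^ a * τ (-z) ^ b) * (τ (-w) ^ a * τ w ^ b) := by
    intro a b
    have x1 : τ e1 = τ z * τ (-w) := by rw [← τ_add, hz]; congr 1; abel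
    have x2 : τ (-e1) = τ (-z) * τ w := by rw [← τ_add, hz]; congr 1; abel
    rw [x1, x2]; ring
  have ey : yk n γ = tent (-w) m := by rw [tent_neg]; rfl
  have e : tent z (2^r) * (yk n γ - xk γ) = (((m:ℝ)⁻¹ * (m:ℝ)⁻¹) • ∑ a ∈ Finset.range m, ∑ b ∈ Finset.range m,
      ((1 - τ z ^ a * τ (-z) ^ b) * tent z (2^r)) * (τ (-w) ^ a * τ w ^ b)) := by
    rw [ey, xk, tent_eq e1, tent_eq (-w), neg_neg, ← smul_sub, mul_smul_comm]; congr 1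
    rw [← sum_sub_distrib, mul_sum]
    refine sum_congr rfl fun a _ => ?_
    rw [← sum_sub_distrib, mul_sum]
    refine sum_congr rfl fun b _ => ?_
    rw [e1']; ring
  rw [show tent z (2^r) * (xk γ - yk n γ) = -(tent z (2^r) * (yk n γ - xk γ)) by ring, e]
  refine ((Dm.sum _ fun a ha => Dm.sum _ fun b hb => (L1z z a b m (2^r) (Finset.mem_range.1 ha).le (Finset.mem_range.1 hb).le hmN (by positivity)).mul
    ((Dm.τpow (-w) a).mul (Dm.τpow w b) (isAvg_sh _).monotone) ?_).smul _).neg.le fun g x => ?_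
  · intro f g hfg x; beta_reduce; gcongr; exact (isAvg_bl _ _).mono hfg x
  · rw [enorm_inv2 m hm0]
    apply le_of_eq
    simp only [← mul_sum]
    rw [mul_left_comm]; push_cast; congr 1
    have hx : bx ((n:ℤ) • -e2) m (bx w m g) = fun y => ((m:ENN)⁻¹ * (m:ENN)⁻¹) * ∑ a ∈ Finset.range m, ∑ b ∈ Finset.range m,
        sh ((a:ℤ) • -w) (sh ((b:ℤ) • w) g) y := by
      funext y
      rw [smul_neg, bx]; simp only [bx, sh]; rw [← mul_sum, ← mul_assoc]
    rw [hx, (isAvg_bl _ _).smul, (isAvg_bl _ _).sum]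
    congr 1
    refine sum_congr rfl fun a _ => ?_
    rw [(isAvg_bl _ _).sum]
theorem tent_le_bl (v : Z2) (N : ℕ) (g : EF) (x : Z2) : bx v N (bx (-v) N g) x ≤ 3 * bl v N g x := by
  rw [bx]
  calc _ ≤ (N:ENN)⁻¹ * ∑ a ∈ Finset.range N, (3:ℕ) * bl v N g x := by
        gcongr with a ha
        have ha := Finset.mem_range.1 ha
        have := bx_sh_le_bl (-v) N N 3 (-(a:ℤ)) (by omega) (by omega) (by omega) g x
        rw [bl_neg, neg_smul_neg] at this
        exact this
    _ ≤ _ := by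
        rw [sum_const, card_range, nsmul_eq_mul, ← mul_assoc]
        calc _ ≤ 1 * (((3:ℕ):ENN) * bl v N g x) := by gcongr; exact ENNReal.inv_mul_le_one _
          _ = _ := by simp
def ballK (v : Z2) (N : ℕ) : KA := τ (-v) ^ N * box v (2*N+1)
theorem bl_eq_bx (v : Z2) (N : ℕ) (g : EF) (x : Z2) : bl v N g x = bx v (2*N+1) g (x + (N:ℤ) • -v) := by
  rw [bl, bx]; congr 1
  have : Finset.Icc (-(N:ℤ)) N = (Finset.range (2*N+1)).image (fun a : ℕ => (a:ℤ) - N) := by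
    ext t; simp only [Finset.mem_Icc, Finset.mem_image, Finset.mem_range]
    constructor
    · intro h; exact ⟨(t + N).toNat, by omega, by omega⟩
    · rintro ⟨a, h, rfl⟩; omega
  rw [this, sum_image (by intro a _ b _ h; simpa using h)]
  refine sum_congr rfl fun a _ => ?_
  rw [sub_smul, smul_neg]; congr 1; abel
theorem Dm.ballK (v : Z2) (N : ℕ) : Dm (ballK v N) (bl v N) :=
  ((Dm.τpow (-v) N).mul (Dm.box v (2*N+1)) (isAvg_sh _).monotone).le fun g x => by
    rw [bl_eq_bx, sh]
def Pos (P : KA) (A : EF → EF) : Prop := ∀ f : RF, (∀ x, 0 ≤ f x) → (∀ x, 0 ≤ act P f x) ∧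
  ∀ x, A (fun y => ‖f y‖ₑ) x ≤ ‖act P f x‖ₑ
theorem Pos.mul {P Q : KA} {A B : EF → EF} (h : Pos P A) (h' : Pos Q B) (hA : Monotone A) : Pos (P * Q) (fun g => A (B g)) := fun f hf => by
  rw [act_mul]
  obtain ⟨a, b⟩ := h' f hf
  obtain ⟨c, d⟩ := h _ a
  exact ⟨c, fun x => (hA (fun y => b y) x).trans (d x)⟩
theorem Pos.τpow (v : Z2) (n : ℕ) : Pos (τ v ^ n) (sh ((n:ℤ) • v)) := fun f hf =>
  ⟨fun x => by rw [act_τpow]; exact hf _, fun x => by rw [act_τpow, sh]⟩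
theorem Pos.box (v : Z2) (N : ℕ) : Pos (box v N) (bx v N) := fun f hf => by
  have h0 : ∀ x, 0 ≤ act (LacMax.box v N) f x := fun x => by
    rw [act_box]; exact mul_nonneg (by positivity) (sum_nonneg fun _ _ => hf _)
  refine ⟨h0, fun x => ?_⟩
  rcases Nat.eq_zero_or_pos N with h | h
  · simp [h, bx]
  rw [act_box, enorm_mul, enorm_inv (by positivity), Real.enorm_eq_ofReal (sum_nonneg fun _ _ => hf _),
    ofReal_sum_of_nonneg (fun _ _ => hf _), bx]
  simp only [Real.enorm_eq_ofReal (hf _)]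
  gcongr; simp
theorem Pos.tent (v : Z2) (N : ℕ) : Pos (tent v N) (fun g => bx v N (bx (-v) N g)) :=
  (Pos.box v N).mul (Pos.box (-v) N) (isAvg_bx _ _).monotone
theorem Pos.ballK (v : Z2) (N : ℕ) : Pos (ballK v N) (bl v N) := by
  have := (Pos.τpow (-v) N).mul (Pos.box v (2*N+1)) (isAvg_sh _).monotone
  intro f hf
  refine ⟨(this f hf).1, fun x => ?_⟩
  rw [bl_eq_bx]; exact (this f hf).2 x
theorem bl_le_bx_sh (v : Z2) (N P K : ℕ) (c : ℤ) (h1 : N ≤ c) (h2 : c + N < P) (hK : P ≤ K * (2*N+1)) (g : EF) (x : Z2) :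
    bl v N g x ≤ K * bx v P g (x + (-c) • v) := by
  rw [bl, bx, ← mul_assoc]
  gcongr ?_ * ?_
  · exact inv_le_mul_inv (by omega) (by omega) hK
  · have e : ∑ t ∈ Finset.Icc (-(N:ℤ)) N, g (x + t • v) = ∑ t ∈ Finset.Icc (-(N:ℤ)) N, (fun a : ℕ => g (x + (-c) • v + (a:ℤ) • v)) (t + c).toNat := by
      refine sum_congr rfl fun t ht => ?_
      have := Finset.mem_Icc.1 ht
      beta_reduce
      rw [Int.toNat_of_nonneg (by omega), add_assoc, ← add_smul]; congr 3; ring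
    rw [e, ← sum_image (g := fun t : ℤ => (t + c).toNat) (f := fun a : ℕ => g (x + (-c) • v + (a:ℤ) • v))]
    · refine sum_le_sum_of_subset fun a ha => ?_
      simp only [Finset.mem_image, Finset.mem_Icc, Finset.mem_range] at ha ⊢
      obtain ⟨t, ht, rfl⟩ := ha; omega
    · intro a ha b hb h
      simp only [Finset.coe_Icc, Set.mem_Icc] at ha hb; simp only at h; omega
theorem bl_le_tent (v : Z2) (N P : ℕ) (hN : 0 < N) (h1 : 4 * N ≤ P) (h2 : P ≤ 8 * N) (g : EF) (x : Z2) :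
    bl v N g x ≤ 8 * bx v P (bx (-v) P g) x := by
  set h := bx (-v) P g with hh
  have hP : (P:ENN) ≠ 0 := by simp; omega
  have h3 : ∀ a ∈ Finset.Ico N (P - N), bl v N g x ≤ 4 * h (x + (a:ℤ) • v) := fun a ha => by
    have ha := Finset.mem_Ico.1 ha
    have := bl_le_bx_sh (-v) N P 4 a (by omega) (by omega) (by omega) g x
    rw [bl_neg, neg_smul_neg] at this; exact this
  have h4 : (P:ENN) * bl v N g x ≤ 8 * ∑ a ∈ Finset.range P, h (x + (a:ℤ) • v) := by
    calc (P:ENN) * bl v N g x ≤ ((2 * (P - N - N) : ℕ):ENN) * bl v N g x := by gcongr; omega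
      _ = 2 * ∑ a ∈ Finset.Ico N (P - N), bl v N g x := by
        rw [sum_const, Nat.card_Ico, nsmul_eq_mul, Nat.cast_mul, mul_assoc]; rfl
      _ ≤ 2 * ∑ a ∈ Finset.Ico N (P - N), 4 * h (x + (a:ℤ) • v) := by gcongr with a ha; exact h3 a ha
      _ = 8 * ∑ a ∈ Finset.Ico N (P - N), h (x + (a:ℤ) • v) := by rw [← mul_sum, ← mul_assoc]; norm_num
      _ ≤ _ := by
        gcongr
        refine fun a ha => ?_
        have := Finset.mem_Ico.1 ha
        simp; omega
  calc bl v N g x = (P:ENN)⁻¹ * (P * bl v N g x) := by rw [← mul_assoc, ENNReal.inv_mul_cancel hP (by simp), one_mul]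
    _ ≤ (P:ENN)⁻¹ * (8 * ∑ a ∈ Finset.range P, h (x + (a:ℤ) • v)) := by gcongr
    _ = _ := by rw [bx]; ring
theorem exists_tent (v : Z2) (N : ℕ) : ∃ r : ℕ, r ≤ N + 3 ∧ ∀ (g : EF) (x : Z2), bl v N g x ≤ 8 * bx v (2^r) (bx (-v) (2^r) g) x := by
  rcases Nat.eq_zero_or_pos N with h | h
  · refine ⟨0, by omega, fun g x => ?_⟩
    subst h
    have : bl v 0 g x = bx v (2^0) (bx (-v) (2^0) g) x := by simp [bl, bx]
    rw [this]
    exact le_mul_of_one_le_left (by simp) (by norm_num)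
  · refine ⟨Nat.log 2 N + 3, ?_, fun g x => ?_⟩
    · have := Nat.log_le_self 2 N; omega
    · have a := Nat.pow_log_le_self 2 h.ne'
      have b := Nat.lt_pow_succ_log_self (b := 2) (by norm_num) N
      rw [pow_succ] at b
      exact bl_le_tent v N _ h (by rw [pow_add]; omega) (by rw [pow_add]; omega) g x
def TE (d : ℕ) (g : EF) : EF := bx e2 (2^d) (bx (-e2) (2^d) g)
theorem isAvg_TE (d : ℕ) : IsAvg (TE d) := (isAvg_bx _ _).comp (isAvg_bx _ _)
theorem bl_le_blTE (e : ℕ) (g : EF) (x : Z2) : bl e2 (2^e) g x ≤ 16 * bl e2 (2^e) (TE (e+3) g) x := by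
  set D := 2^e with hD
  have hD0 : 0 < D := by positivity
  have h1 : ∀ s ∈ Finset.Icc (-(D:ℤ)) D, bl e2 D g x ≤ 16 * TE (e+3) g (x + s • e2) := fun s hs => by
    have hs := Finset.mem_Icc.1 hs
    have a := bx_sh_le_bl e2 (2*D+1) (2*D) 2 (-(s:ℤ) - D) (by push_cast; omega) (by push_cast; omega) (by omega) g (x + s • e2)
    have b := bl_le_tent e2 (2*D) (2^(e+3)) (by omega) (by rw [pow_add]; omega) (by rw [pow_add]; omega) g (x + s • e2)
    rw [bl_eq_bx]
    rw [add_assoc, ← add_smul] at a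
    have ee : x + (D:ℤ) • -e2 = x + (s + (-s - D)) • e2 := by
      congr 1; rw [smul_neg, ← neg_smul]; congr 1; ring
    rw [ee]
    refine a.trans ?_
    calc _ ≤ ((2:ℕ):ENN) * (8 * bx e2 (2^(e+3)) (bx (-e2) (2^(e+3)) g) (x + s • e2)) := by gcongr
      _ = _ := by rw [← mul_assoc, TE]; congr 1; norm_num
  have hc : ((2*D+1:ℕ):ENN) ≠ 0 := by simp
  calc bl e2 D g x = ((2*D+1:ℕ):ENN)⁻¹ * ∑ s ∈ Finset.Icc (-(D:ℤ)) D, bl e2 D g x := by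
        rw [sum_const, Int.card_Icc, nsmul_eq_mul, ← mul_assoc]
        have : ((D:ℤ) + 1 - -D).toNat = 2*D+1 := by omega
        rw [this, ENNReal.inv_mul_cancel hc (natCast_ne_top _), one_mul]
    _ ≤ ((2*D+1:ℕ):ENN)⁻¹ * ∑ s ∈ Finset.Icc (-(D:ℤ)) D, 16 * TE (e+3) g (x + s • e2) := by
        gcongr with s hs; exact h1 s hs
    _ = _ := by rw [← mul_sum, bl]; ring
theorem bl_le_blTE4 (e : ℕ) (g : EF) (x : Z2) : bl e2 (2^e) g x ≤ 16^4 * bl e2 (2^e) (TE (e+3) (TE (e+3) (TE (e+3) (TE (e+3) g)))) x := by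
  refine (bl_le_blTE e g x).trans ?_
  have := (bl_le_blTE e (TE (e+3) g) x).trans (mul_le_mul_right ((bl_le_blTE e (TE (e+3) (TE (e+3) g)) x).trans
    (mul_le_mul_right (bl_le_blTE e _ x) 16)) 16)
  refine (mul_le_mul_right this 16).trans (le_of_eq ?_)
  ring
theorem start (z : Z2) (e N : ℕ) : ∃ r ≤ N + 3, ∀ f : RF, (∀ x, 0 ≤ f x) → ∀ x,
    bl z N (bl e2 (2^e) (fun y => ‖f y‖ₑ)) x ≤ 8 * 16^4 * ‖act (tent z (2^r) * ballK e2 (2^e) * Tk (e+3)^4) f x‖ₑ := by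
  obtain ⟨r, hr, h⟩ := exists_tent z N
  refine ⟨r, hr, fun f hf x => ?_⟩
  have hT : Pos (Tk (e+3)) (TE (e+3)) := Pos.tent e2 _
  have mT := (isAvg_TE (e+3)).monotone
  have mz := ((isAvg_bx z (2^r)).comp (isAvg_bx (-z) (2^r)))
  have hp := (Pos.tent z (2^r)).mul ((Pos.ballK e2 (2^e)).mul (hT.mul (hT.mul (hT.mul hT mT) mT) mT) (isAvg_bl _ _).monotone) mz.monotone
  have hp := (hp f hf).2 x
  rw [show tent z (2^r) * ballK e2 (2^e) * Tk (e+3)^4 = tent z (2^r) * (ballK e2 (2^e) * (Tk (e+3) * (Tk (e+3) * (Tk (e+3) * Tk (e+3))))) by ring]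
  calc _ ≤ 8 * bx z (2^r) (bx (-z) (2^r) (bl e2 (2^e) (fun y => ‖f y‖ₑ))) x := h _ x
    _ ≤ 8 * bx z (2^r) (bx (-z) (2^r) (fun y => 16^4 * bl e2 (2^e) (TE (e+3) (TE (e+3) (TE (e+3) (TE (e+3) (fun y => ‖f y‖ₑ))))) y)) x := by
        gcongr; exact mz.mono (fun y => bl_le_blTE4 e _ y) x
    _ = 8 * 16^4 * bx z (2^r) (bx (-z) (2^r) (bl e2 (2^e) (TE (e+3) (TE (e+3) (TE (e+3) (TE (e+3) (fun y => ‖f y‖ₑ))))))) x := by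
        have := mz.smul (16^4) (bl e2 (2^e) (TE (e+3) (TE (e+3) (TE (e+3) (TE (e+3) (fun y => ‖f y‖ₑ))))))
        rw [mul_assoc]; congr 1
        exact this x
    _ ≤ _ := by gcongr
def zn (n : ℕ) : Z2 := e1 + (n:ℤ) • e2
def Dn (e n : ℕ) (g : EF) (x : Z2) : ENN := ⨆ N : ℕ, bl (zn n) N (bl e2 (2^e) g) x
theorem isMax_Dn (e n : ℕ) : IsMax (Dn e n) :=
  IsMax.of_family (A := fun (N : ℕ) g => bl (zn n) N (bl e2 (2^e) g)) fun _ => (isAvg_bl _ _).comp (isAvg_bl _ _)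
theorem le_Dn (e n N : ℕ) (g : EF) (x : Z2) : bl (zn n) N (bl e2 (2^e) g) x ≤ Dn e n g x :=
  le_iSup (fun N => bl (zn n) N (bl e2 (2^e) g) x) N
theorem err (e d n r γ : ℕ) (hn : 0 < n) (hd : n ≤ 2^d) (hγ : γ ≤ r + 1) {c : ℝ} {a : ℕ} {W : KA} (hW : Dom c a W) :
    Dm (tent (zn n) (2^r) * (xk γ - yk n γ) * Tk d * W * ballK e2 (2^e))
      (fun g x => ofReal (18 * (2^γ/2^r) * 225 * c) * Dn e n (M^[a+4] g) x) := by
  have hk := k3 n r γ hγ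
  have m1 : Monotone (fun (g : EF) x => ofReal (18 * (2^γ:ℕ) / (2^r:ℕ)) * bl (e1 + (n:ℤ) • e2) (4*2^r)
      (bx ((n:ℤ) • -e2) (2^γ) (bx ((n:ℤ) • e2) (2^γ) g)) x) := by
    intro f g hfg x; beta_reduce; gcongr
    exact (isAvg_bl _ _).mono ((isAvg_bx _ _).mono ((isAvg_bx _ _).mono hfg)) x
  have hT : Dm (Tk d) (TE d) := (Dm.box e2 _).mul (Dm.box (-e2) _) (isAvg_bx _ _).monotone
  have mW : Monotone (fun (g : EF) x => ofReal c * M^[a] g x) := by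
    intro f g hfg x; beta_reduce; gcongr; exact isMax_M.iterate_mono a hfg x
  refine (((hk.mul hT m1).mul hW.dm (m1.comp (isAvg_TE d).monotone)).mul (Dm.ballK e2 (2^e))
    ((m1.comp (isAvg_TE d).monotone).comp mW)).le fun g x => ?_
  set h : EF := fun y => ofReal c * M^[a] (bl e2 (2^e) g) y with hh
  have s1 : ∀ y, bx ((n:ℤ) • -e2) (2^γ) (bx ((n:ℤ) • e2) (2^γ) (TE d h)) y ≤ 225 * M^[4] h y := by
    intro y
    calc _ ≤ bx ((n:ℤ) • -e2) (2^γ) (fun y => 15 * M^[2] (bx (-e2) (2^d) h) y) y :=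
          (isAvg_bx _ _).mono (fun y => comb_M dir_e2 n _ _ hn hd _ y) y
      _ ≤ bx ((n:ℤ) • -e2) (2^γ) (fun y => 15 * bx (-e2) (2^d) (M^[2] h) y) y :=
          (isAvg_bx _ _).mono (fun y => mul_le_mul_right (Mit_le_avg (isAvg_bx _ _) 2 h y) _) y
      _ = 15 * bx ((n:ℤ) • -e2) (2^γ) (bx (-e2) (2^d) (M^[2] h)) y := (isAvg_bx _ _).smul _ _ _
      _ ≤ 15 * (15 * M^[4] h y) := by gcongr; exact comb_M dir_e2.neg n _ _ hn hd _ y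
      _ = _ := by rw [← mul_assoc]; norm_num
  have s2 : ∀ y, 225 * M^[4] h y ≤ (225 * ofReal c) * bl e2 (2^e) (M^[a+4] g) y := by
    intro y
    rw [hh, isMax_M.iterate_smul, ← mul_assoc, add_comm a 4]
    gcongr
    rw [← Function.iterate_add_apply]
    exact Mit_le_avg (isAvg_bl _ _) _ g y
  calc _ ≤ ofReal (18 * (2^γ:ℕ) / (2^r:ℕ)) * bl (zn n) (4*2^r) (fun y => (225 * ofReal c) * bl e2 (2^e) (M^[a+4] g) y) x := by
        gcongr; exact (isAvg_bl _ _).mono (fun y => (s1 y).trans (s2 y)) x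
    _ = ofReal (18 * (2^γ:ℕ) / (2^r:ℕ)) * ((225 * ofReal c) * bl (zn n) (4*2^r) (bl e2 (2^e) (M^[a+4] g)) x) := by
        rw [(isAvg_bl _ _).smul]
    _ ≤ ofReal (18 * (2^γ:ℕ) / (2^r:ℕ)) * ((225 * ofReal c) * Dn e n (M^[a+4] g) x) := by
        gcongr; exact le_Dn _ _ _ _ _
    _ = _ := by
        rw [← mul_assoc, ← mul_assoc]; congr 1
        rw [ofReal_mul (by positivity), ofReal_mul (by positivity), ofReal_ofNat]
        push_cast; rw [mul_div_assoc]
abbrev Q4 := Fin 2 × Fin 2 × Fin 2 × Fin 2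
def kap (q : Q4) : ℕ :=
  if (q.1:ℕ) + q.2.1 + q.2.2.1 + q.2.2.2 = 0 ∨ (q.1:ℕ) + q.2.1 + q.2.2.1 + q.2.2.2 = 4 then 12 else
  if (q.1:ℕ) + q.2.1 + q.2.2.1 + q.2.2.2 = 2 then 2 else 3
theorem kap_le (q : Q4) : kap q ≤ 12 := by unfold kap; split_ifs <;> norm_num
def hx (q : Q4) (i : ℕ) : KA := xk (i + q.1) * (1 - xk (i + q.2.1))
def vx (q : Q4) (i : ℕ) : KA := xk (i + q.2.2.1) * (1 - xk (i + q.2.2.2))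
def vy (n : ℕ) (q : Q4) (i : ℕ) : KA := yk n (i + q.2.2.1) * (1 - yk n (i + q.2.2.2))
def P2 (x : KA) : KA := 20 * x^3 - 30 * x^4 + 12 * x^5
theorem poly_id (i : ℕ) : P2 (xk i) - P2 (xk (i+1)) = ∑ q : Q4, (kap q : KA) * (del e1 i * hx q i * vx q i) := by
  rw [del_eq]
  change _ = ∑ q : Q4, (kap q : KA) * ((xk i - xk (i+1)) * hx q i * vx q i)
  simp only [Fintype.sum_prod_type, Fin.sum_univ_two, hx, vx, kap, P2]
  norm_num
  ring
theorem decomp (A b T : KA) (n ρ : ℕ) : 2 * (A * b * T^4) = A * P2 (xk ρ) * b * T^4 +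
    ∑ i ∈ Finset.range ρ, ∑ q : Q4, (kap q : KA) * (A * (del e1 i * hx q i * (vx q i - vy n q i)) * b * T^4) +
    ∑ q : Q4, (kap q : KA) * ((A * b) * ∑ i ∈ Finset.range ρ, del e1 i * (hx q i * (vy n q i * T^4))) := by
  have h0 : P2 (xk 0) = 2 := by rw [xk, pow_zero, tent_one, P2]; norm_num
  have h1 := tele (fun i => P2 (xk i)) 0 ρ (Nat.zero_le _)
  simp only [h0, ← range_eq_Ico, poly_id] at h1
  have h2 : ∑ q : Q4, (kap q : KA) * ((A * b) * ∑ i ∈ Finset.range ρ, del e1 i * (hx q i * (vy n q i * T^4))) =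
    ∑ i ∈ Finset.range ρ, ∑ q : Q4, (kap q : KA) * ((A * b) * (del e1 i * (hx q i * (vy n q i * T^4)))) := by
    rw [sum_comm]; simp only [mul_sum]
  rw [h2, add_assoc, ← sum_add_distrib]
  have h3 : ∑ i ∈ Finset.range ρ, (∑ q : Q4, (kap q : KA) * (A * (del e1 i * hx q i * (vx q i - vy n q i)) * b * T^4) +
     ∑ q : Q4, (kap q : KA) * ((A * b) * (del e1 i * (hx q i * (vy n q i * T^4))))) =
      (A * b * T^4) * ∑ i ∈ Finset.range ρ, ∑ q : Q4, (kap q : KA) * (del e1 i * hx q i * vx q i) := by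
    rw [mul_sum]
    refine sum_congr rfl fun i _ => ?_
    rw [← sum_add_distrib, mul_sum]
    refine sum_congr rfl fun q _ => ?_
    ring
  rw [h3, ← h1]; ring
theorem dom_del (i : ℕ) : Dom 9 2 (del e1 i) := ((dom_eta dir_e1 _).mul (dom_eta dir_e1.neg _)).le (by norm_num) le_rfl
theorem dom_T (d : ℕ) : Dom 9 2 (Tk d) := dom_tent dir_e2 _
theorem dom_x (d : ℕ) : Dom 9 2 (xk d) := dom_tent dir_e1 _
theorem errq (e d n r i : ℕ) (q : Q4) (hn : 0 < n) (hd : n ≤ 2^d) (hi : i ≤ r) :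
    Dm (tent (zn n) (2^r) * (del e1 i * hx q i * (vx q i - vy n q i)) * ballK e2 (2^e) * Tk d^4)
      (fun g x => ofReal (4 * 10^12 * (2^i/2^r)) * Dn e n (M^[18] g) x) := by
  have hh : Dom (9*9*10) 6 (del e1 i * hx q i) := ((dom_del i).mul ((dom_x _).mul (dom_one_sub_x _))).le (by norm_num) le_rfl
  have hW1 : Dom (2*10^8) 14 (del e1 i * hx q i * (1 - xk (i + q.2.2.2)) * Tk d * Tk d * Tk d) :=
    ((((hh.mul (dom_one_sub_x _)).mul (dom_T d)).mul (dom_T d)).mul (dom_T d)).le (by norm_num) (by norm_num)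
  have hW2 : Dom (2*10^8) 14 (del e1 i * hx q i * (yk n (i + q.2.2.1) * Tk d) * Tk d * Tk d) :=
    (((hh.mul (dom_Y1 n _ d hn hd)).mul (dom_T d)).mul (dom_T d)).le (by norm_num) (by norm_num)
  have b1 : i + (q.2.2.1:ℕ) ≤ r + 1 := by have := q.2.2.1.isLt; omega
  have b2 : i + (q.2.2.2:ℕ) ≤ r + 1 := by have := q.2.2.2.isLt; omega
  have h1 := err e d n r _ hn hd b1 hW1
  have h2 := err e d n r _ hn hd b2 hW2
  have ee : tent (zn n) (2^r) * (del e1 i * hx q i * (vx q i - vy n q i)) * ballK e2 (2^e) * Tk d^4 =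
    tent (zn n) (2 ^ r) * (xk (i + q.2.2.1) - yk n (i + q.2.2.1)) * Tk d *
        (del e1 i * hx q i * (1 - xk (i + q.2.2.2)) * Tk d * Tk d * Tk d) * ballK e2 (2 ^ e) -
    tent (zn n) (2 ^ r) * (xk (i + q.2.2.2) - yk n (i + q.2.2.2)) * Tk d *
        (del e1 i * hx q i * (yk n (i + q.2.2.1) * Tk d) * Tk d * Tk d) * ballK e2 (2 ^ e) := by
    rw [vx, vy]; ring
  rw [ee]
  have key : ∀ t : Fin 2, ofReal (18 * (2^(i + (t:ℕ))/2^r) * 225 * (2*10^8)) ≤ ofReal (2 * 10^12 * (2^i/2^r)) := by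
    intro t
    apply ofReal_le_ofReal
    have : (2:ℝ)^(i + (t:ℕ)) ≤ 2 * 2^i := by
      rw [← pow_succ']; exact pow_le_pow_right₀ (by norm_num) (by have := t.isLt; omega)
    calc _ ≤ 18 * ((2 * (2:ℝ)^i)/2^r) * 225 * (2*10^8) := by gcongr
      _ ≤ _ := by
        rw [mul_div_assoc]
        have : (0:ℝ) ≤ 2^i/2^r := by positivity
        nlinarith
  refine (h1.sub h2).le fun g x => ?_
  rw [← add_mul]
  refine mul_le_mul_left ((add_le_add (key _) (key _)).trans ?_) _
  rw [← ofReal_add (by positivity) (by positivity)]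
  apply ofReal_le_ofReal; apply le_of_eq; ring
def niceC (m : ℕ) : ℝ := (75 * 2^m)*(75*2^m) * (20*81+30*729+12*6561) * 729
theorem dom_nicep (e d n r ρ m : ℕ) (hn : 0 < n) (hd : n ≤ 2^d) (h1 : ρ ≤ r) (h2 : r ≤ ρ + m) :
    Dom (niceC m) 21 (tent (zn n) (2^r) * P2 (xk ρ) * ballK e2 (2^e) * Tk d^4) := by
  have hx := dom_x ρ
  have hb : Dom 1 1 (ballK e2 (2^e)) := .of_dm (Dm.ballK _ _) (by norm_num) fun g x => by
    simpa using (bl_le_Mv _ _ _ _).trans (dir_e2 g x)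
  have hp : Dom (20*81+30*729+12*6561) 8 ((20:ℝ) • (xk ρ * xk ρ) - (30:ℝ) • (xk ρ * xk ρ * xk ρ) + (12:ℝ) • (xk ρ * xk ρ * xk ρ * xk ρ)) := by
    refine (((((hx.mul hx).smul 20).le le_rfl ?_).sub ((((hx.mul hx).mul hx).smul 30).le le_rfl ?_)).add
      (((((hx.mul hx).mul hx).mul hx).smul 12))).le ?_ ?_ <;> norm_num
  have h := (((dom_nice n r ρ m d hn hd h1 h2).mul hp).mul (((dom_T d).mul (dom_T d)).mul (dom_T d))).mul hb
  have ee : tent (zn n) (2^r) * P2 (xk ρ) * ballK e2 (2^e) * Tk d^4 = tent (e1 + (n:ℤ) • e2) (2 ^ r) * xk ρ * Tk d *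
          ((20:ℝ) • (xk ρ * xk ρ) - (30:ℝ) • (xk ρ * xk ρ * xk ρ) + (12:ℝ) • (xk ρ * xk ρ * xk ρ * xk ρ)) *
        (Tk d * Tk d * Tk d) * ballK e2 (2 ^ e) := by
    have k : ∀ (c : ℝ) (X : KA), c • X = algebraMap ℝ KA c * X := fun c X => Algebra.smul_def c X
    rw [k 20, k 30, k 12, map_ofNat, map_ofNat, map_ofNat, P2, zn]; ring
  rw [ee]
  refine h.le (le_of_eq ?_) (by norm_num)
  rw [niceC]; norm_num
def SR (R : ℕ) (β : ℕ → RF) (y : Z2) : ENN := (Finset.range (R+1)).sup fun N => ‖∑ i ∈ Finset.range N, act (del e1 i) (β i) y‖ₑ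
def bet (n d : ℕ) (q : Q4) (f : RF) (i : ℕ) : RF := act (hx q i * (vy n q i * Tk d^4)) f
theorem ptw (e d n r R m : ℕ) (hn : 0 < n) (hd : n ≤ 2^d) (hr : r ≤ R) (f : RF) (x : Z2) :
    2 * ‖act (tent (zn n) (2^r) * ballK e2 (2^e) * Tk d^4) f x‖ₑ ≤
      ofReal (niceC m) * M^[21] (fun y => ‖f y‖ₑ) x +
      ofReal (10^15/2^m) * Dn e n (M^[18] (fun y => ‖f y‖ₑ)) x +
      ∑ q : Q4, 36 * Dn e n (SR R (bet n d q f)) x := by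
  set F : EF := fun y => ‖f y‖ₑ with hF
  set ρ := r - m with hρ
  have h2 : (2:ENN) * ‖act (tent (zn n) (2^r) * ballK e2 (2^e) * Tk d^4) f x‖ₑ =
      ‖act (2 * (tent (zn n) (2^r) * ballK e2 (2^e) * Tk d^4)) f x‖ₑ := by
    rw [two_mul (tent (zn n) (2^r) * ballK e2 (2^e) * Tk d^4), act_add, ← two_mul (act _ f x), enorm_mul]; congr 1; simp [Real.enorm_eq_ofReal]
  rw [h2, decomp _ _ _ n ρ, act_add, act_add]
  refine (enorm_add_le _ _).trans (add_le_add ((enorm_add_le _ _).trans (add_le_add ?_ ?_)) ?_)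
  · exact (dom_nicep e d n r ρ m hn hd (by omega) (by omega)).dm f x
  · rw [act_sum]
    calc _ ≤ ∑ i ∈ Finset.range ρ, ∑ q : Q4, ofReal (48 * 10^12 * (2^i/2^r)) * Dn e n (M^[18] F) x := by
          refine (enorm_sum_le _ _).trans (sum_le_sum fun i hi => ?_)
          rw [act_sum]
          refine (enorm_sum_le _ _).trans (sum_le_sum fun q _ => ?_)
          have hi := Finset.mem_range.1 hi
          have := ((errq e d n r i q hn hd (by omega)).smul (kap q)) f x
          rw [Nat.cast_smul_eq_nsmul, nsmul_eq_mul] at this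
          refine this.trans ?_
          beta_reduce
          rw [← mul_assoc]
          gcongr
          rw [Real.enorm_eq_ofReal (by positivity), ← ofReal_mul (by positivity)]
          apply ofReal_le_ofReal
          have : (kap q:ℝ) ≤ 12 := by exact_mod_cast kap_le q
          calc _ ≤ 12 * (4 * 10^12 * ((2:ℝ)^i/2^r)) := by gcongr
            _ = _ := by ring
      _ = ofReal (∑ i ∈ Finset.range ρ, 16 * (48 * 10^12 * (2^i/2^r))) * Dn e n (M^[18] F) x := by
          rw [ofReal_sum_of_nonneg (fun i _ => by positivity), sum_mul]
          refine sum_congr rfl fun i _ => ?_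
          rw [sum_const, card_univ, nsmul_eq_mul, ofReal_mul (by norm_num), ← mul_assoc]
          simp [Q4]
      _ ≤ _ := by
          gcongr
          rw [← mul_sum, ← mul_sum, ← sum_div, sum_two_pow]
          have : ((2:ℝ)^ρ - 1)/2^r ≤ 1/2^m := by
            rw [div_le_div_iff₀ (by positivity) (by positivity)]
            by_cases h : m ≤ r
            · have : (2:ℝ)^r = 2^ρ * 2^m := by rw [← pow_add]; congr 1; omega
              rw [this]; have : (0:ℝ) < 2^m := by positivity
              nlinarith
            · have : ρ = 0 := by omega
              rw [this]; simp
          calc _ ≤ 16 * (48 * 10^12 * (1/2^m:ℝ)) := by gcongr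
            _ ≤ _ := by
              have : (0:ℝ) ≤ 1/2^m := by positivity
              rw [div_eq_mul_one_div (10^15:ℝ)]; nlinarith
  · rw [act_sum]
    refine (enorm_sum_le _ _).trans (sum_le_sum fun q _ => ?_)
    have hA : Dm (tent (zn n) (2^r) * ballK e2 (2^e)) (fun g x => 3 * Dn e n g x) := by
      refine (((Dm.box (zn n) (2^r)).mul (Dm.box _ _) (isAvg_bx _ _).monotone).mul (Dm.ballK e2 (2^e))
        ((isAvg_bx _ _).comp (isAvg_bx _ _)).monotone).le fun g x => ?_
      exact (tent_le_bl _ _ _ x).trans (by gcongr; exact le_Dn _ _ _ _ _)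
    have := (hA.smul (kap q)) (act (∑ i ∈ Finset.range ρ, del e1 i * (hx q i * (vy n q i * Tk d^4))) f) x
    rw [Nat.cast_smul_eq_nsmul, nsmul_eq_mul, ← act_mul, mul_assoc] at this
    refine this.trans ?_
    calc _ ≤ 12 * (3 * Dn e n (SR R (bet n d q f)) x) := by
          have hk : (kap q:ENN) ≤ 12 := by exact_mod_cast kap_le q
          have hk2 : ‖(kap q:ℝ)‖ₑ = (kap q:ENN) := by simp
          beta_reduce
          rw [hk2]
          refine mul_le_mul' hk (mul_le_mul_right ?_ _)
          refine (isMax_Dn e n).mono (fun y => ?_) x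
          have hs : act (∑ i ∈ Finset.range ρ, del e1 i * (hx q i * (vy n q i * Tk d^4))) f y =
            ∑ i ∈ Finset.range ρ, act (del e1 i) (bet n d q f i) y := by
            rw [act_sum]; simp only [act_mul _ _ f, bet]
          beta_reduce
          rw [hs]
          exact le_sup (f := fun N => ‖∑ i ∈ Finset.range N, act (del e1 i) (bet n d q f i) y‖ₑ) (Finset.mem_range.2 (by omega))
      _ = _ := by rw [← mul_assoc]; norm_num
def Sparse (K : Finset ℕ) (Λ : ℝ) : Prop := ∀ Q : ℝ, 0 < Q → ∑ n ∈ K, min ((n:ℝ)/Q) (Q/n) ≤ Λ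
theorem kV_row (n i d J : ℕ) (hn : 0 < n) (hd : n ≤ 2^d) : ∑ j ∈ Finset.Icc d J, kV n i j ≤ 8 := by
  set k := Nat.log 2 (n * 2^i) with hk
  have h0 : 0 < n * 2^i := by positivity
  have k1 : ((2:ℝ)^k) ≤ ((n * 2^i : ℕ):ℝ) := by exact_mod_cast Nat.pow_log_le_self 2 h0.ne'
  have k2 : ((n * 2^i : ℕ):ℝ) ≤ 2 * 2^k := by
    rw [← pow_succ']; exact_mod_cast (Nat.lt_pow_succ_log_self (by norm_num) (n * 2^i)).le
  have hb : ∀ j, kV n i j ≤ 2 * gc j k + (n:ℝ)/2^j := by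
    intro j
    unfold kV gc
    gcongr
    rw [mul_min_of_nonneg _ _ (by norm_num : (0:ℝ) ≤ 2), min_comm]
    apply min_le_min
    · calc (2:ℝ)^j/((n * 2^i : ℕ):ℝ) ≤ 2^j/2^k := by gcongr
        _ ≤ _ := by have : (0:ℝ) ≤ 2^j/2^k := by positivity
                    linarith
    · rw [← mul_div_assoc]; gcongr
  calc _ ≤ ∑ j ∈ Finset.Icc d J, (2 * gc j k + (n:ℝ)/2^j) := sum_le_sum fun j _ => hb j
    _ = 2 * ∑ j ∈ Finset.Icc d J, gc j k + ∑ j ∈ Finset.Icc d J, (n:ℝ)/2^j := by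
        rw [sum_add_distrib, mul_sum]
    _ ≤ 2 * 3 + 2 := by
        gcongr
        · refine (sum_le_sum_of_subset_of_nonneg (t := Finset.range (J+1)) ?_ fun j _ _ => gc_nn j k).trans (gc_sum k _)
          intro j hj; have := Finset.mem_Icc.1 hj; exact Finset.mem_range.2 (by omega)
        · rw [← Finset.Ico_add_one_right_eq_Icc, Finset.sum_Ico_eq_sum_range]
          refine le_trans (sum_le_sum fun t _ => ?_) (sum_half_pow (J+1-d))
          have : (n:ℝ) ≤ 2^d := by exact_mod_cast hd
          rw [pow_add, div_le_div_iff₀ (by positivity) (by positivity), one_mul]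
          exact mul_le_mul_of_nonneg_right this (by positivity)
    _ = 8 := by norm_num
theorem kV_col (K : Finset ℕ) {Λ : ℝ} (hK : Sparse K Λ) (i d j : ℕ) (hd : ∀ n ∈ K, 0 < n ∧ n ≤ 2^d) (hj : d ≤ j) :
    ∑ n ∈ K, kV n i j ≤ 2 * Λ := by
  have h1 := hK (2^j/2^i) (by positivity)
  have h2 := hK (2^j) (by positivity)
  rw [two_mul]
  refine le_trans (le_of_eq ?_) (add_le_add h1 h2)
  rw [← sum_add_distrib]
  refine sum_congr rfl fun n hn => ?_
  obtain ⟨n0, n1⟩ := hd n hn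
  have n0' : (0:ℝ) < n := by exact_mod_cast n0
  have n2 : (n:ℝ) ≤ 2^j := by exact_mod_cast n1.trans (Nat.pow_le_pow_right (by norm_num) hj)
  unfold kV
  congr 1
  · push_cast; congr 1 <;> field_simp
  · rw [min_eq_left]; rw [div_le_div_iff₀ (by positivity) n0']; gcongr
theorem sq_sum_le {ι : Type*} (s : Finset ι) (c b : ι → ENN) :
    (∑ i ∈ s, c i * b i)^(2:ℝ) ≤ (∑ i ∈ s, c i) * ∑ i ∈ s, c i * b i ^(2:ℝ) := by
  have h := inner_le_weight_mul_Lp_of_nonneg s (p := 2) (by norm_num) c b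
  calc _ ≤ _ := rpow_le_rpow h (by norm_num)
    _ = _ := by
      rw [mul_rpow_of_nonneg _ _ (by norm_num), ← rpow_mul, ← rpow_mul]; norm_num
def Wn (w g : EF) : ENN := ∑' x, g x ^ (2:ℝ) / w x
theorem Wn_sum (w : EF) {ι : Type*} (s : Finset ι) (c : ι → ENN) (b : ι → EF) (g : EF)
    (h : ∀ x, g x ^ (2:ℝ) ≤ ∑ i ∈ s, c i * b i x ^ (2:ℝ)) : Wn w g ≤ ∑ i ∈ s, c i * Wn w (b i) := by
  calc Wn w g ≤ ∑' x, ∑ i ∈ s, c i * (b i x ^ (2:ℝ) / w x) := by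
        refine tsum_le_tsum fun x => ?_
        refine (ENNReal.div_le_div_right (h x) _).trans (le_of_eq ?_)
        rw [ENNReal.div_eq_inv_mul, mul_sum]
        refine sum_congr rfl fun i _ => ?_
        rw [ENNReal.div_eq_inv_mul]; ring
    _ = _ := by
        rw [Summable.tsum_finsetSum fun _ _ => summable]
        exact sum_congr rfl fun i _ => ENNReal.tsum_mul_left
theorem Wn_iter {𝒮 : Set (EF → EF)} {B : ENN} {w : EF} (hw : GoodW 𝒮 B w) {S : EF → EF} (hS : S ∈ 𝒮) (a : ℕ) (g : EF) :
    Wn w (S^[a] g) ≤ B^a * Wn w g := by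
  induction a with
  | zero => simp
  | succ a ih =>
    rw [Function.iterate_succ_apply']
    refine (hw.l2 S hS _).trans ?_
    rw [pow_succ', mul_assoc]; gcongr; exact ih
def srC (B : ENN) : ENN := 400 * B^2 * (synC * B) + 34992 * B
theorem Wn_SR {𝒮 : Set (EF → EF)} {B : ENN} {w : EF} (hw : GoodW 𝒮 B w) (hM : M ∈ 𝒮) (hB : B ≠ ⊤) (R : ℕ) (β : ℕ → RF) :
    Wn w (SR R β) ≤ srC B * ∑ i ∈ Finset.range R, Wn w (fun y => ‖β i y‖ₑ) := by
  set F : EF := fun y => ‖∑ i ∈ Finset.range R, act (del e1 i) (β i) y‖ₑ with hF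
  have h2 : ∀ x, SR R β x ^ (2:ℝ) ≤ ∑ o ∈ (Finset.range R).insertNone,
      (o.elim 400 fun _ => 34992) * (o.elim (M^[2] F x) fun i => M (fun y => ‖β i y‖ₑ) x) ^ (2:ℝ) := by
    intro x
    rw [sum_insertNone]
    simp only [Option.elim]
    rw [← le_rpow_inv_iff (by norm_num)]
    refine Finset.sup_le fun N hN => ?_
    rw [le_rpow_inv_iff (by norm_num)]
    have hN : N ≤ R := by have := Finset.mem_range.1 hN; omega
    have c := cotlar R N hN β x
    refine (rpow_le_rpow c (by norm_num)).trans ((add_rpow_le_two (by norm_num) _ _).trans ?_)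
    rw [mul_add]
    refine add_le_add ?_ ?_
    · rw [mul_rpow_of_nonneg _ _ (by norm_num), ← mul_assoc]
      refine mul_le_mul_left (le_of_eq ?_) _
      norm_num
    · refine (mul_le_mul_right (sq_sum_le _ _ _) _).trans ?_
      have s1 : ∑ i ∈ Finset.range R, ofReal (54 * gc i N) ≤ 162 := by
        rw [← ofReal_sum_of_nonneg fun i _ => mul_nonneg (by norm_num) (gc_nn i N), ← mul_sum]
        refine (ofReal_le_ofReal (mul_le_mul_of_nonneg_left (gc_sum N R) (by norm_num))).trans ?_
        norm_num
      have s2 : ∀ i, ofReal (54 * gc i N) ≤ 54 := fun i => by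
        refine (ofReal_le_ofReal (mul_le_mul_of_nonneg_left (gc_le_one i N) (by norm_num))).trans ?_
        norm_num
      calc _ ≤ (2:ENN)^(2:ℝ) * (162 * ∑ i ∈ Finset.range R, 54 * M (fun y => ‖β i y‖ₑ) x ^ (2:ℝ)) := by
            gcongr with i; exact s2 i
        _ = _ := by
            rw [← mul_sum, ← mul_sum, ← mul_assoc, ← mul_assoc]; norm_num
  have h3 := Wn_sum w _ _ _ _ h2
  rw [sum_insertNone] at h3
  simp only [Option.elim] at h3
  refine h3.trans ?_
  rw [srC, add_mul]
  refine add_le_add ?_ ?_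
  · calc _ ≤ 400 * (B^2 * (synC * B * ∑ i ∈ Finset.range R, Wn w (fun y => ‖β i y‖ₑ))) := by
          gcongr
          refine (Wn_iter hw hM 2 F).trans ?_
          gcongr
          exact synth e1 w hB hw.ne_zero hw.ne_top (fun x => (dir_e1 w x).trans (hw.a1 M hM x)) R β
      _ = _ := by ring
  · rw [mul_sum]
    refine sum_le_sum fun i _ => ?_
    rw [mul_assoc]; gcongr
    exact hw.l2 M hM _
def Gij (J : ℕ) (f : RF) (i j : ℕ) : RF := act (thj J j) (act (eta (-e1) (2^i)) f)
theorem bet_le (R d n i : ℕ) (q : Q4) (hn : 0 < n) (hd : n ≤ 2^d) (hi : i < R) (f : RF) (x : Z2) :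
    ‖bet n d q f i x‖ₑ ≤ ∑ t ∈ Finset.range R ×ˢ Finset.Icc d (d+R), ofReal (27 * 10^7 * (gc t.1 i * kV n i t.2)) *
      M^[13] (fun y => ‖Gij (d+R) f t.1 t.2 y‖ₑ) x := by
  rw [bet, act_mul]
  refine (hband R i _ _ (by omega) (by have := q.2.1.isLt; omega) hi _ x).trans ?_
  rw [sum_product]
  refine sum_le_sum fun i' _ => ?_
  have h1 : ∀ y, ‖act (eta (-e1) (2^i')) (act (vy n q i * Tk d^4) f) y‖ₑ ≤ ∑ j ∈ Finset.Icc d (d+R), ofReal (10^7 * kV n i j) *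
      M^[11] (fun y => ‖Gij (d+R) f i' j y‖ₑ) y := by
    intro y
    rw [← act_mul, mul_comm (eta _ _), act_mul]
    refine vband n i _ _ d (d+R) hn hd (by omega) (by have := q.2.2.2.isLt; omega) (by omega) ?_ _ y
    rw [pow_add]; exact Nat.mul_le_mul hd (Nat.pow_le_pow_right (by norm_num) hi.le)
  refine (mul_le_mul_right (isMax_M.iterate_mono 2 h1 x) _).trans ?_
  refine (mul_le_mul_right (isMax_M.iterate_sum_le 2 _ _ x) _).trans ?_
  rw [mul_sum]
  refine sum_le_sum fun j _ => le_of_eq ?_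
  rw [isMax_M.iterate_smul, ← mul_assoc, ← ofReal_mul (mul_nonneg (by norm_num) (gc_nn _ _)), ← Function.iterate_add_apply]
  congr 2; ring
def wC (B : ENN) (Λ : ℝ) : ENN := B * srC B * (ofReal (27 * 10^7 * 24) * B^13 * ofReal (27 * 10^7 * (6 * Λ)))
theorem wC_ne_top {B : ENN} (hB : B ≠ ⊤) (Λ : ℝ) : wC B Λ ≠ ⊤ := by
  have := synC_ne_top
  unfold wC srC; finiteness
theorem wmain {𝒮 : Set (EF → EF)} {B : ENN} {w : EF} (hw : GoodW 𝒮 B w) (hM : M ∈ 𝒮) (hB : B ≠ ⊤)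
    (e d R : ℕ) (K : Finset ℕ) (hD : ∀ n ∈ K, Dn e n ∈ 𝒮) {Λ : ℝ} (hK : Sparse K Λ) (hd : ∀ n ∈ K, 0 < n ∧ n ≤ 2^d)
    (q : Q4) (f : RF) :
    ∑ n ∈ K, Wn w (Dn e n (SR R (bet n d q f))) ≤ wC B Λ *
      ∑ t ∈ Finset.range R ×ˢ Finset.Icc d (d+R), Wn w (fun y => ‖Gij (d+R) f t.1 t.2 y‖ₑ) := by
  set T := Finset.range R ×ˢ Finset.Icc d (d+R) with hT
  set U : ℕ × ℕ → ENN := fun t => Wn w (fun y => ‖Gij (d+R) f t.1 t.2 y‖ₑ) with hU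
  set c : ℕ → ℕ → ℕ × ℕ → ENN := fun n i t => ofReal (27 * 10^7 * (gc t.1 i * kV n i t.2)) with hc
  have cn : ∀ n i t, 0 ≤ gc (t:ℕ×ℕ).1 i * kV n i t.2 := fun n i t => mul_nonneg (gc_nn _ _) (kV_nn _ _ _)
  have hrow : ∀ n ∈ K, ∀ i, ∑ t ∈ T, c n i t ≤ ofReal (27 * 10^7 * 24) := by
    intro n hn i
    rw [← ofReal_sum_of_nonneg fun t _ => mul_nonneg (by norm_num) (cn n i t), ← mul_sum, hT, sum_product]
    simp only [← mul_sum]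
    rw [← sum_mul]
    apply ofReal_le_ofReal
    have := mul_le_mul (gc_sum i R) (kV_row n i d (d+R) (hd n hn).1 (hd n hn).2) (sum_nonneg fun j _ => kV_nn _ _ _) (by norm_num)
    linarith
  have hcol : ∀ t ∈ T, ∑ n ∈ K, ∑ i ∈ Finset.range R, c n i t ≤ ofReal (27 * 10^7 * (6*Λ)) := by
    intro t ht
    have ht := (Finset.mem_Icc.1 (Finset.mem_product.1 ht).2).1
    have : ∀ n ∈ K, ∑ i ∈ Finset.range R, c n i t = ofReal (∑ i ∈ Finset.range R, 27 * 10^7 * (gc t.1 i * kV n i t.2)) := fun n _ =>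
      (ofReal_sum_of_nonneg fun i _ => mul_nonneg (by norm_num) (cn n i t)).symm
    rw [sum_congr rfl this, ← ofReal_sum_of_nonneg fun n _ => sum_nonneg fun i _ => mul_nonneg (by norm_num) (cn n i t)]
    apply ofReal_le_ofReal
    simp only [← mul_sum]
    rw [sum_comm]
    simp only [← mul_sum]
    gcongr
    have hΛ : 0 ≤ Λ := le_trans (sum_nonneg fun n _ => by positivity) (hK 1 one_pos)
    calc _ ≤ ∑ i ∈ Finset.range R, gc i t.1 * (2 * Λ) := by
          refine sum_le_sum fun i _ => ?_
          rw [gc_comm]; exact mul_le_mul_of_nonneg_left (kV_col K hK i d t.2 hd ht) (gc_nn _ _)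
      _ ≤ _ := by rw [← sum_mul]; nlinarith [gc_sum t.1 R]
  have hb : ∀ n ∈ K, ∀ i ∈ Finset.range R, Wn w (fun y => ‖bet n d q f i y‖ₑ) ≤
      ofReal (27 * 10^7 * 24) * B^13 * ∑ t ∈ T, c n i t * U t := by
    intro n hn i hi
    have h1 := Wn_sum w T (fun t => ofReal (27 * 10^7 * 24) * c n i t) (fun t => M^[13] (fun y => ‖Gij (d+R) f t.1 t.2 y‖ₑ))
      (fun y => ‖bet n d q f i y‖ₑ) fun x => by
        refine (rpow_le_rpow (bet_le R d n i q (hd n hn).1 (hd n hn).2 (Finset.mem_range.1 hi) f x) (by norm_num)).trans ?_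
        refine (sq_sum_le _ _ _).trans ?_
        refine (mul_le_mul_left (hrow n hn i) _).trans (le_of_eq ?_)
        rw [mul_sum]
        exact sum_congr rfl fun t _ => (mul_assoc _ _ _).symm
    refine h1.trans ?_
    rw [mul_sum]
    refine sum_le_sum fun t _ => ?_
    calc _ ≤ ofReal (27 * 10^7 * 24) * c n i t * (B^13 * U t) := by gcongr; exact Wn_iter hw hM 13 _
      _ = _ := by ring
  calc _ ≤ ∑ n ∈ K, B * (srC B * ∑ i ∈ Finset.range R, ofReal (27 * 10^7 * 24) * B^13 * ∑ t ∈ T, c n i t * U t) := by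
        refine sum_le_sum fun n hn => (hw.l2 _ (hD n hn) _).trans ?_
        gcongr
        refine (Wn_SR hw hM hB R _).trans ?_
        gcongr with i hi
        exact hb n hn i hi
    _ = B * srC B * (ofReal (27 * 10^7 * 24) * B^13 * ∑ t ∈ T, (∑ n ∈ K, ∑ i ∈ Finset.range R, c n i t) * U t) := by
        have : ∑ t ∈ T, (∑ n ∈ K, ∑ i ∈ Finset.range R, c n i t) * U t = ∑ n ∈ K, ∑ i ∈ Finset.range R, ∑ t ∈ T, c n i t * U t := by
          simp only [sum_mul]
          rw [sum_comm]
          exact sum_congr rfl fun n _ => sum_comm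
        rw [this]
        simp only [mul_sum]
        refine sum_congr rfl fun n _ => sum_congr rfl fun i _ => sum_congr rfl fun t _ => ?_
        ring
    _ ≤ B * srC B * (ofReal (27 * 10^7 * 24) * B^13 * ∑ t ∈ T, ofReal (27 * 10^7 * (6*Λ)) * U t) := by
        gcongr with t ht; exact hcol t ht
    _ = _ := by rw [← mul_sum, wC]; ring
def Gf (d R : ℕ) (f : RF) (y : Z2) : ENN :=
  (∑ t ∈ Finset.range R ×ˢ Finset.Icc d (d+R), ‖Gij (d+R) f t.1 t.2 y‖ₑ^(2:ℝ))^(2⁻¹:ℝ)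
theorem sq_sqrt' (a : ENN) : (a^(2⁻¹:ℝ))^(2:ℝ) = a := by rw [← rpow_mul]; norm_num
theorem Wn_Gf (w : EF) (d R : ℕ) (f : RF) :
    ∑ t ∈ Finset.range R ×ˢ Finset.Icc d (d+R), Wn w (fun y => ‖Gij (d+R) f t.1 t.2 y‖ₑ) = Wn w (Gf d R f) := by
  unfold Wn Gf
  simp only [sq_sqrt']
  rw [← Summable.tsum_finsetSum fun _ _ => summable]
  refine tsum_congr fun x => ?_
  simp only [ENNReal.div_eq_inv_mul, mul_sum]
theorem enorm_sq_eucl {ι : Type*} [Fintype ι] (v : EuclideanSpace ℝ ι) : ‖v‖ₑ^(2:ℝ) = ∑ i, ‖v i‖ₑ^(2:ℝ) := by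
  have h := EuclideanSpace.norm_sq_eq v
  have k : ∀ a : ENN, a^(2:ℝ) = a^2 := fun a => rpow_two a
  simp only [k, ← ofReal_norm, ← ENNReal.ofReal_pow (norm_nonneg _)]
  rw [h, ofReal_sum_of_nonneg fun i _ => by positivity]
theorem Gf_bound {p : ℝ} (hp : 1 < p) (hp2 : p ≤ 2) (d R : ℕ) (f : RF) :
    ∑' x, Gf d R f x ^ p ≤ steinC p * (steinC p + 1) * ∑' x, ‖f x‖ₑ^p := by
  set J := d + R with hJ
  set V : Z2 → EuclideanSpace ℝ (Finset.Icc d J) := fun x => WithLp.toLp 2 fun j => act (thj J j) f x with hV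
  have hve : ∀ i x (j : Finset.Icc d J), (ve (-e1) i V x) j = Gij J f i j x := by
    intro i x j
    have h1 : Gij J f i j x = ve (-e1) i (act (thj J j) f) x := by
      rw [Gij, ← act_mul, mul_comm, act_mul, act_eta_pow]
    rw [h1]
    simp [ve, vm, hV]
  have hG : ∀ x, Gf d R f x ^ p = (∑ i ∈ Finset.range R, ‖ve (-e1) i V x‖ₑ^(2:ℝ))^(p/2) := by
    intro x
    rw [Gf, ← rpow_mul, sum_product]
    congr 1
    · refine sum_congr rfl fun i _ => ?_
      rw [enorm_sq_eucl, ← sum_coe_sort (Finset.Icc d J)]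
      exact sum_congr rfl fun j _ => by rw [hve]
    · ring
  simp only [hG]
  refine (stein (-e1) hp hp2 V R).trans ?_
  rw [mul_assoc]
  gcongr
  have hVp : ∀ x, ‖V x‖ₑ^p ≤ (∑ j ∈ Finset.range J, ‖ve (-e2) j f x‖ₑ^(2:ℝ))^(p/2) + ‖f x‖ₑ^p := by
    intro x
    have e : ‖V x‖ₑ^p = (∑ j ∈ Finset.Icc d J, ‖act (thj J j) f x‖ₑ^(2:ℝ))^(p/2) := by
      rw [← sum_coe_sort (Finset.Icc d J), show p = 2*(p/2) by ring, rpow_mul, enorm_sq_eucl]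
      simp [hV]
    have e2 : ‖f x‖ₑ^p = (‖f x‖ₑ^(2:ℝ))^(p/2) := by rw [← rpow_mul]; congr 1; ring
    rw [e, e2]
    refine le_trans ?_ (ENNReal.rpow_add_le_add_rpow _ _ (by linarith) (by linarith))
    refine rpow_le_rpow ?_ (by linarith)
    calc _ ≤ ∑ j ∈ Finset.range (J+1), ‖act (thj J j) f x‖ₑ^(2:ℝ) := by
          refine sum_le_sum_of_subset fun j hj => ?_
          have := Finset.mem_Icc.1 hj; exact Finset.mem_range.2 (by omega)
      _ = _ := by
          rw [sum_range_succ]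
          congr 1
          · refine sum_congr rfl fun j hj => ?_
            rw [thj, if_pos (Finset.mem_range.1 hj), act_eta_pow]
          · rw [thj, if_neg (lt_irrefl _), act_one]
  refine (tsum_le_tsum hVp).trans ?_
  rw [tsum_add, add_mul, one_mul]
  gcongr
  exact stein (-e2) hp hp2 f J
theorem tsum_mono_lim {p : ℝ} (hp : 0 < p) (f : ℕ → EF) (hf : Monotone f) {C : ENN} (h : ∀ N, ∑' x, f N x ^ p ≤ C) :
    ∑' x, (⨆ N, f N x)^p ≤ C := by
  rw [tsum_eq_iSup_sum]
  refine iSup_le fun s => ?_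
  have : ∀ x, (⨆ N, f N x)^p = ⨆ N, f N x ^ p := fun x => (ENNReal.orderIsoRpow p hp).map_iSup fun N => f N x
  simp only [this]
  rw [ENNReal.finsetSum_iSup_of_monotone fun x i j hij => rpow_le_rpow (hf hij x) hp.le]
  exact iSup_le fun N => (ENNReal.sum_le_tsum s).trans (h N)
theorem sum_rpow_le {ι : Type*} (s : Finset ι) (b : ι → ENN) {p : ℝ} (hp : 0 < p) : (∑ i ∈ s, b i)^p ≤ (s.card:ENN)^p * ∑ i ∈ s, b i ^p := by
  have h1 : ∑ i ∈ s, b i ≤ s.card * s.sup b := by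
    rw [← nsmul_eq_mul]; exact sum_le_card_nsmul _ _ _ fun i hi => le_sup hi
  refine (rpow_le_rpow h1 hp.le).trans ?_
  rw [mul_rpow_of_nonneg _ _ hp.le]
  gcongr
  rw [← le_rpow_inv_iff hp]
  refine Finset.sup_le fun i hi => ?_
  rw [le_rpow_inv_iff hp]
  exact single_le_sum (f := fun i => b i ^ p) (fun _ _ => zero_le) hi
theorem M_bdd {p : ℝ} (hp : 1 < p) : Bdd p M (2 * hlC p) := by
  intro g
  calc _ ≤ ∑' x, (Mv e1 g x ^p + Mv e2 g x ^p) := by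
        refine tsum_le_tsum fun x => ?_
        rw [M]
        rcases le_total (Mv e1 g x) (Mv e2 g x) with h | h
        · rw [sup_eq_right.2 h]; exact le_add_self
        · rw [sup_eq_left.2 h]; exact le_self_add
    _ ≤ _ := by
        rw [tsum_add, two_mul, add_mul]
        exact add_le_add (Mv_bdd e1 hp g) (Mv_bdd e2 hp g)
theorem Dn_bdd (e n : ℕ) {p : ℝ} (hp : 1 < p) : Bdd p (Dn e n) (hlC p * hlC p) := by
  intro g
  calc _ ≤ ∑' x, Mv (zn n) (Mv e2 g) x ^ p := by
        refine tsum_le_tsum fun x => rpow_le_rpow (iSup_le fun N => ?_) (by linarith)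
        exact ((isAvg_bl _ _).mono (fun y => bl_le_Mv _ _ _ _) x).trans (bl_le_Mv _ _ _ _)
    _ ≤ _ := by
        refine (Mv_bdd _ hp _).trans ?_
        rw [mul_assoc]; gcongr; exact Mv_bdd _ hp _
def DD (e : ℕ) (K : Finset ℕ) (g : EF) (x : Z2) : ENN := ⨆ n : K, Dn e n g x
theorem isMax_DD (e : ℕ) (K : Finset ℕ) : IsMax (DD e K) := IsMax.iSup (T := fun n : K => Dn e n) fun n => isMax_Dn e n
theorem le_DD (e : ℕ) {K : Finset ℕ} {n : ℕ} (hn : n ∈ K) (g : EF) (x : Z2) : Dn e n g x ≤ DD e K g x :=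
  le_iSup (fun n : K => Dn e n g x) ⟨n, hn⟩
theorem iSup_rpow_le_sum (K : Finset ℕ) (b : ℕ → ENN) {p : ℝ} (hp : 0 < p) : (⨆ n : K, b n)^p ≤ ∑ n ∈ K, b n ^ p := by
  rw [← le_rpow_inv_iff hp]
  refine iSup_le fun n => ?_
  rw [le_rpow_inv_iff hp]
  exact single_le_sum (f := fun i => b i ^ p) (fun _ _ => zero_le) n.2
theorem DD_apriori (e : ℕ) (K : Finset ℕ) {p : ℝ} (hp : 1 < p) : Bdd p (DD e K) (K.card * (hlC p * hlC p)) := by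
  intro g
  calc _ ≤ ∑' x, ∑ n ∈ K, Dn e n g x ^ p :=
        tsum_le_tsum fun x => iSup_rpow_le_sum K (fun n => Dn e n g x) (by linarith)
    _ ≤ ∑ n ∈ K, (hlC p * hlC p * ∑' x, g x ^ p) := by
        rw [Summable.tsum_finsetSum fun _ _ => summable]
        exact sum_le_sum fun n _ => Dn_bdd e n hp g
    _ = _ := by rw [sum_const, nsmul_eq_mul]; ring
def fam (e : ℕ) (K : Finset ℕ) : Set (EF → EF) := {S | S = M ∨ ∃ n ∈ K, S = Dn e n}
def Ext (p : ℝ) (𝒮 : Set (EF → EF)) (B A : ENN) : Prop := ∀ C : ENN, 1 ≤ C → ∀ H G : EF,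
  (∀ w, GoodW 𝒮 B w → Wn w H ≤ C * Wn w G) → ∑' x, H x ^ p ≤ C^(p/2) * A * ∑' x, G x ^ p
def Hq (e d R : ℕ) (K : Finset ℕ) (q : Q4) (f : RF) (x : Z2) : ENN := (∑ n ∈ K, Dn e n (SR R (bet n d q f)) x ^ (2:ℝ))^(2⁻¹:ℝ)
theorem Hq_bound {p : ℝ} (hp : 1 < p) (hp2 : p ≤ 2) {B A : ENN} (hB : B ≠ ⊤) {Λ : ℝ} {e : ℕ} {K : Finset ℕ} (hK : Sparse K Λ)
    (hd : ∀ n ∈ K, 0 < n ∧ n ≤ 2^e) (hE : Ext p (fam e K) B A) (R : ℕ) (q : Q4) (f : RF) :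
    ∑' x, Hq e (e+3) R K q f x ^ p ≤ (1 + wC B Λ)^(p/2) * A * (steinC p * (steinC p + 1)) * ∑' x, ‖f x‖ₑ^p := by
  have h := hE (1 + wC B Λ) le_self_add (Hq e (e+3) R K q f) (Gf (e+3) R f) fun w hw => by
    have h1 := wmain hw (Or.inl rfl) hB e (e+3) R K (fun n hn => Or.inr ⟨n, hn, rfl⟩) hK
      (fun n hn => ⟨(hd n hn).1, (hd n hn).2.trans (Nat.pow_le_pow_right (by norm_num) (by omega))⟩) q f
    rw [Wn_Gf] at h1
    refine le_trans ?_ (h1.trans (mul_le_mul_left le_add_self _))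
    refine (Wn_sum w K (fun _ => 1) (fun n => Dn e n (SR R (bet n (e+3) q f))) _ fun x => ?_).trans (le_of_eq (by simp))
    rw [Hq, sq_sqrt']; simp
  refine h.trans ?_
  rw [mul_assoc (_ * A)]
  gcongr
  exact Gf_bound hp hp2 _ _ _
theorem ptwD {e : ℕ} {K : Finset ℕ} (hd : ∀ n ∈ K, 0 < n ∧ n ≤ 2^e) (m Nm : ℕ) (f : RF) (hf : ∀ x, 0 ≤ f x) (x : Z2)
    (n : ℕ) (hn : n ∈ K) (N : ℕ) (hN : N ≤ Nm) : bl (zn n) N (bl e2 (2^e) (fun y => ‖f y‖ₑ)) x ≤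
    4 * 16^4 * ofReal (niceC m) * M^[21] (fun y => ‖f y‖ₑ) x + 4*16^4*ofReal (10^15/2^m) * DD e K (M^[18] (fun y => ‖f y‖ₑ)) x
     + 4*16^4*36 * ∑ q : Q4, Hq e (e+3) (Nm+3) K q f x := by
  obtain ⟨r, hr, h⟩ := start (zn n) e N
  have h2 := ptw e (e+3) n r (Nm+3) m (hd n hn).1 ((hd n hn).2.trans (Nat.pow_le_pow_right (by norm_num) (by omega))) (by omega) f x
  calc _ ≤ _ := h f hf x
    _ = 4*16^4 * (2 * ‖act (tent (zn n) (2^r) * ballK e2 (2^e) * Tk (e+3)^4) f x‖ₑ) := by rw [← mul_assoc]; norm_num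
    _ ≤ _ := mul_le_mul_right h2 _
    _ ≤ 4*16^4 * (ofReal (niceC m) * M^[21] (fun y => ‖f y‖ₑ) x + ofReal (10^15/2^m) * DD e K (M^[18] (fun y => ‖f y‖ₑ)) x
        + ∑ q : Q4, 36 * Hq e (e+3) (Nm+3) K q f x) := by
        gcongr with q
        · exact le_DD e hn _ _
        · rw [Hq, le_rpow_inv_iff (by norm_num)]
          exact single_le_sum (f := fun n => Dn e n (SR (Nm+3) (bet n (e+3) q f)) x ^ (2:ℝ)) (fun _ _ => zero_le) hn
    _ = _ := by rw [← mul_sum]; ring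
theorem exists_m (c : ENN) (hc : c ≠ ⊤) {p : ℝ} (hp : 0 < p) :
    ∃ m : ℕ, c * (4*16^4*ofReal (10^15/2^m))^p ≤ 2⁻¹ := by
  have h1 : Tendsto (fun m : ℕ => (10:ℝ)^15/2^m) atTop (𝓝 0) :=
    tendsto_const_nhds.div_atTop (tendsto_pow_atTop_atTop_of_one_lt (by norm_num))
  have h2 := ENNReal.tendsto_ofReal h1
  rw [ENNReal.ofReal_zero] at h2
  have h3 := ENNReal.Tendsto.const_mul (a := 4*16^4) h2 (Or.inr (by finiteness))
  have h4 := (ENNReal.continuous_rpow_const (y := p)).tendsto _ |>.comp h3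
  have h5 := ENNReal.Tendsto.const_mul (a := c) h4 (Or.inr hc)
  rw [mul_zero, zero_rpow_of_pos hp, mul_zero] at h5
  obtain ⟨m, hm⟩ := (h5.eventually (gt_mem_nhds (by simp : (0:ENN) < 2⁻¹))).exists
  exact ⟨m, hm.le⟩
theorem core {p : ℝ} (hp : 1 < p) (hp2 : p ≤ 2) {B A : ENN} (hB : B ≠ ⊤) (hA : A ≠ ⊤) (Λ : ℝ) :
    ∃ C : ENN, C ≠ ⊤ ∧ ∀ (e : ℕ) (K : Finset ℕ), Sparse K Λ → (∀ n ∈ K, 0 < n ∧ n ≤ 2^e) → Ext p (fam e K) B A → Bdd p (DD e K) C := by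
  have hp0 : 0 < p := by linarith
  have hl := hlC_ne_top hp0.le
  set mC := 2 * hlC p with hmC
  have hmt : mC ≠ ⊤ := by finiteness
  have t2 : (2:ENN)^p ≠ ⊤ := rpow_ne_top_of_nonneg hp0.le (by simp)
  obtain ⟨m, hm⟩ := exists_m (2^p*2^p*mC^18) (by finiteness) hp0
  set a : ENN := 4 * 16^4 * ofReal (niceC m) with ha
  set b : ENN := 4*16^4*ofReal (10^15/2^m) with hb
  set hC : ENN := (1 + wC B Λ)^(p/2) * A * (steinC p * (steinC p + 1)) with hhC
  have hat : a^p ≠ ⊤ := rpow_ne_top_of_nonneg hp0.le (by finiteness)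
  have hct : (4*16^4*36 : ENN)^p ≠ ⊤ := rpow_ne_top_of_nonneg hp0.le (by finiteness)
  have h16 : ((Finset.univ : Finset Q4).card : ENN)^p ≠ ⊤ := rpow_ne_top_of_nonneg hp0.le (by finiteness)
  have hCt : hC ≠ ⊤ := by
    have h1 := wC_ne_top hB Λ
    have h2 := steinC_ne_top hp
    have h3 : (1 + wC B Λ)^(p/2) ≠ ⊤ := rpow_ne_top_of_nonneg (by linarith) (by finiteness)
    finiteness
  set c1 : ENN := 1 + 2^p*2^p*a^p*mC^21 + 2^p*(4*16^4*36)^p*(Finset.univ : Finset Q4).card^p*((Finset.univ : Finset Q4).card * hC) with hc1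
  have hc1t : c1 ≠ ⊤ := by finiteness
  refine ⟨2 * c1, by finiteness, fun e K hK hd hE => ?_⟩
  have imp : ∀ N, Bdd p (DD e K) N → Bdd p (DD e K) (c1 + 2⁻¹ * N) := by
    intro N hN g
    by_cases hg : ∑' x, g x ^ p = ⊤
    · rw [hg, mul_top]; exact le_top
      intro h; have := (add_eq_zero.1 h).1; rw [hc1] at this; simp at this
    have hgx : ∀ x, g x ≠ ⊤ := fun x hx => hg (by
      have := le_tsum (f := fun x => g x ^ p) x
      simp only [hx, ENNReal.top_rpow_of_pos hp0] at this
      exact top_le_iff.1 this)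
    set f : RF := fun x => (g x).toReal with hf
    have hfg : (fun y => ‖f y‖ₑ) = g := by
      funext y; rw [hf, Real.enorm_eq_ofReal toReal_nonneg, ofReal_toReal (hgx y)]
    set D : ℕ → EF := fun Nm x => ⨆ n : K, ⨆ N : Finset.range (Nm+1), bl (zn n) N (bl e2 (2^e) g) x with hD
    have hDm : Monotone D := by
      intro i j hij x
      refine iSup_mono fun n => iSup_le fun N => ?_
      exact le_iSup (fun N : Finset.range (j+1) => bl (zn n) N (bl e2 (2^e) g) x)
        ⟨N, Finset.mem_range.2 (by have := Finset.mem_range.1 N.2; omega)⟩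
    have hDs : ∀ x, DD e K g x ≤ ⨆ Nm, D Nm x := fun x => iSup_le fun n => iSup_le fun N =>
      le_iSup_of_le N (le_iSup_of_le n (le_iSup (fun N : Finset.range (N+1) => bl (zn n) N (bl e2 (2^e) g) x) ⟨N, by simp⟩))
    refine le_trans (tsum_le_tsum fun x => rpow_le_rpow (hDs x) hp0.le) ?_
    refine tsum_mono_lim hp0 D hDm fun Nm => ?_
    have q1 : ∀ x, D Nm x ^ p ≤ 2^p*2^p*a^p * M^[21] g x ^ p + 2^p*2^p*b^p * DD e K (M^[18] g) x ^ p +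
        2^p*(4*16^4*36)^p*(Finset.univ : Finset Q4).card^p*∑ q : Q4, Hq e (e+3) (Nm+3) K q f x ^ p := by
      intro x
      have r1 : D Nm x ≤ _ := iSup_le fun n => iSup_le fun N => by
        have := ptwD hd m Nm f (fun x => toReal_nonneg) x n n.2 N (by have := Finset.mem_range.1 N.2; omega)
        rw [hfg] at this
        exact this
      refine (rpow_le_rpow r1 hp0.le).trans ((add_rpow_le_two hp0.le _ _).trans ?_)
      calc _ ≤ 2^p * (2^p * ((a * M^[21] g x)^p + (b * DD e K (M^[18] g) x)^p) + (4*16^4*36 * ∑ q : Q4, Hq e (e+3) (Nm+3) K q f x)^p) := by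
            gcongr; exact add_rpow_le_two hp0.le _ _
        _ ≤ 2^p * (2^p * (a^p * M^[21] g x^p + b^p * DD e K (M^[18] g) x^p) + (4*16^4*36)^p * ((Finset.univ : Finset Q4).card^p * ∑ q : Q4, Hq e (e+3) (Nm+3) K q f x ^ p)) := by
            rw [mul_rpow_of_nonneg a _ hp0.le, mul_rpow_of_nonneg b _ hp0.le, mul_rpow_of_nonneg (4*16^4*36) _ hp0.le]
            gcongr; exact sum_rpow_le _ _ hp0
        _ = _ := by ring
    refine (tsum_le_tsum q1).trans ?_
    rw [tsum_add, tsum_add, ENNReal.tsum_mul_left, ENNReal.tsum_mul_left, ENNReal.tsum_mul_left,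
      Summable.tsum_finsetSum fun _ _ => summable]
    have b1 := (M_bdd hp).iterate 21 g
    have b2 := (hN (M^[18] g)).trans (mul_le_mul_right ((M_bdd hp).iterate 18 g) _)
    have b3 : ∀ q ∈ (Finset.univ : Finset Q4), ∑' x, Hq e (e+3) (Nm+3) K q f x ^ p ≤ hC * ∑' x, g x ^ p := by
      intro q _
      have := Hq_bound hp hp2 hB hK hd hE (Nm+3) q f
      simp only [congrFun hfg] at this
      exact this
    have b3' := sum_le_card_nsmul _ _ _ b3
    rw [nsmul_eq_mul] at b3'
    calc _ ≤ 2^p*2^p*a^p * (mC^21 * ∑' x, g x ^ p) + 2^p*2^p*b^p * (N * (mC^18 * ∑' x, g x ^ p)) +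
        2^p*(4*16^4*36)^p*(Finset.univ : Finset Q4).card^p*((Finset.univ : Finset Q4).card * (hC * ∑' x, g x ^ p)) := by gcongr
      _ = (2^p*2^p*a^p*mC^21 + 2^p*(4*16^4*36)^p*(Finset.univ : Finset Q4).card^p*((Finset.univ : Finset Q4).card * hC)) * ∑' x, g x ^ p +
          (2^p*2^p*mC^18*b^p) * N * ∑' x, g x ^ p := by ring
      _ ≤ c1 * ∑' x, g x ^ p + 2⁻¹ * N * ∑' x, g x ^ p := by
          gcongr
          rw [hc1, add_assoc 1]; exact le_add_self
      _ = _ := by ring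
  set N0 : ENN := K.card * (hlC p * hlC p) with hN0
  have it : ∀ k : ℕ, Bdd p (DD e K) (2*c1 + N0 * 2⁻¹^k) := by
    intro k
    induction k with
    | zero =>
      intro g; refine (DD_apriori e K hp g).trans ?_
      gcongr; rw [pow_zero, mul_one]; exact le_add_self
    | succ k ih =>
      have := imp _ ih
      have e1 : c1 + 2⁻¹ * (2*c1 + N0 * 2⁻¹^k) = 2*c1 + N0*2⁻¹^(k+1) := by
        rw [mul_add, ← mul_assoc, ENNReal.inv_mul_cancel (by simp) (by simp)]; ring
      rwa [e1] at this
  intro g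
  by_cases hg : ∑' x, g x ^ p = ⊤
  · rw [hg, mul_top]; exact le_top
    intro h; rw [hc1] at h; simp at h
  have lim : Tendsto (fun k : ℕ => (2*c1 + N0 * 2⁻¹^k) * ∑' x, g x ^ p) atTop (𝓝 ((2*c1 + N0 * 0) * ∑' x, g x ^ p)) := by
    refine ENNReal.Tendsto.mul_const ?_ (Or.inr hg)
    refine tendsto_const_nhds.add (ENNReal.Tendsto.const_mul ?_ (Or.inr (by finiteness)))
    exact ENNReal.tendsto_pow_atTop_nhds_zero_of_lt_one (by simp)
  rw [mul_zero, add_zero] at lim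
  exact ge_of_tendsto' lim fun k => it k g
def PB (p Λ : ℝ) : Prop := ∃ C : ENN, C ≠ ⊤ ∧ ∀ (e : ℕ) (K : Finset ℕ), Sparse K Λ → (∀ n ∈ K, 0 < n ∧ n ≤ 2^e) → Bdd p (DD e K) C
theorem fam_max {e : ℕ} {K : Finset ℕ} : ∀ S ∈ fam e K, IsMax S := by
  rintro S (rfl | ⟨n, _, rfl⟩)
  exacts [isMax_M, isMax_Dn e n]
theorem Bdd.mono {p : ℝ} {S : EF → EF} {C C' : ENN} (h : Bdd p S C) (hC : C ≤ C') : Bdd p S C' :=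
  fun g => (h g).trans (mul_le_mul_left hC _)
def fC (p : ℝ) : ENN := 1 + (2 * hlC p + hlC p * hlC p)
theorem fC_ne_top {p : ℝ} (hp : 1 < p) : fC p ≠ ⊤ := by
  have := hlC_ne_top (show 0 ≤ p by linarith)
  unfold fC; finiteness
theorem fam_bdd {p : ℝ} (hp : 1 < p) {e : ℕ} {K : Finset ℕ} : ∀ S ∈ fam e K, Bdd p S (fC p) := by
  rintro S (rfl | ⟨n, _, rfl⟩)
  · exact (M_bdd hp).mono (le_self_add.trans le_add_self)
  · exact (Dn_bdd e n hp).mono (le_add_self.trans le_add_self)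
theorem PB_two (Λ : ℝ) : PB 2 Λ := by
  obtain ⟨C, hC, h⟩ := core one_lt_two le_rfl (fC_ne_top one_lt_two) ENNReal.one_ne_top Λ
  refine ⟨C, hC, fun e K hK hd => h e K hK hd fun C' hC' H G hw => ?_⟩
  have := hw _ (goodW_one (𝒮 := fam e K) fam_max (N := fC 2) le_self_add (fam_bdd one_lt_two))
  simpa [Wn] using this
theorem PB_step {p p0 Λ : ℝ} (hp : 1 < p) (hp2 : p < 2) (hp0 : 1 < p0) (hpp : p0 < p / (2 - p)) (h0 : PB p0 Λ) : PB p Λ := by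
  obtain ⟨C0, hC0, h0⟩ := h0
  have hr : 1 < 2 - (2-p)*p0/p := by
    rw [lt_div_iff₀ (by linarith)] at hpp
    have : (2-p)*p0/p < 1 := by rw [div_lt_one (by linarith)]; linarith
    linarith
  set N0 : ENN := 1 + (2 * hlC p0 + C0) with hN0
  have hN0t : N0 ≠ ⊤ := by have := hlC_ne_top (show 0 ≤ p0 by linarith); finiteness
  have hN1t := fC_ne_top hr
  obtain ⟨C, hC, h⟩ := core hp hp2.le (B := 2 * N0 * fC (2 - (2-p)*p0/p)) (A := 2 * 4^p0) (by finiteness)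
    (mul_ne_top (by simp) (rpow_ne_top_of_nonneg (by linarith) (by simp))) Λ
  refine ⟨C, hC, fun e K hK hd => h e K hK hd fun C' hC' H G hw => ?_⟩
  refine extrap_lt hp hp2 hp0 hpp (𝒮 := fam e K) (S0 := fun g x => M g x ⊔ DD e K g x) (isMax_M.sup (isMax_DD e K)) fam_max ?_
    (N0 := N0) le_self_add hN0t le_self_add ?_ (fam_bdd hr) hC' H G hw
  · rintro S (rfl | ⟨n, hn, rfl⟩) g x
    exacts [le_sup_left, (le_DD e hn g x).trans le_sup_right]
  · intro g
    calc _ ≤ ∑' x, (M g x ^p0 + DD e K g x ^p0) := by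
          refine tsum_le_tsum fun x => ?_
          beta_reduce
          rcases le_total (M g x) (DD e K g x) with h | h
          · rw [sup_eq_right.2 h]; exact le_add_self
          · rw [sup_eq_left.2 h]; exact le_self_add
      _ ≤ (2 * hlC p0 + C0) * ∑' x, g x ^ p0 := by
          rw [tsum_add, add_mul]
          exact add_le_add (M_bdd hp0 g) (h0 e K hK hd g)
      _ ≤ _ := mul_le_mul_left le_add_self _
theorem PB_all {p : ℝ} (Λ : ℝ) (hp : 1 < p) : PB p Λ := by
  have key : ∀ k : ℕ, ∀ p : ℝ, 1 < p → p ≤ 2 → (2/3:ℝ)^k * (1/2) ≤ 1 - 1/p → PB p Λ := by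
    intro k
    induction k with
    | zero =>
      intro p h1 h2 h3
      have : p = 2 := by
        refine le_antisymm h2 ?_
        have : 1/p ≤ 1/2 := by linarith
        rwa [one_div_le_one_div (by linarith) (by norm_num)] at this
      subst this; exact PB_two Λ
    | succ k ih =>
      intro p h1 h2 h3
      rcases h2.lt_or_eq with h2 | rfl
      · set δ := 1 - 1/p with hδ
        have hδ0 : 0 < δ := by rw [hδ, sub_pos, div_lt_one (by linarith)]; exact h1
        set δ' := min (1/2) (3/2*δ) with hδ'
        have d0 : 0 < δ' := lt_min (by norm_num) (by linarith)
        have d1 : δ' ≤ 1/2 := min_le_left _ _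
        have d2 : δ' ≤ 3/2*δ := min_le_right _ _
        have hp0 : 1/(1/(1-δ')) = 1 - δ' := one_div_one_div _
        refine PB_step (p0 := 1/(1-δ')) h1 h2 ?_ ?_ (ih _ ?_ ?_ ?_)
        · rw [lt_div_iff₀ (by linarith)]; linarith
        · rw [div_lt_div_iff₀ (by linarith) (by linarith)]
          have : p * δ = p - 1 := by rw [hδ]; field_simp
          nlinarith
        · rw [lt_div_iff₀ (by linarith)]; linarith
        · rw [div_le_iff₀ (by linarith)]; linarith
        · rw [hp0, sub_sub_cancel]
          refine le_min ?_ ?_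
          · have : (2/3:ℝ)^k ≤ 1 := pow_le_one₀ (by norm_num) (by norm_num)
            linarith
          · rw [pow_succ] at h3; linarith
      · exact PB_two Λ
  rcases le_or_gt p 2 with h2 | h2
  · have hδ0 : 0 < 1 - 1/p := by rw [sub_pos, div_lt_one (by linarith)]; exact hp
    obtain ⟨k, hk⟩ := exists_pow_lt_of_lt_one hδ0 (show (2/3:ℝ) < 1 by norm_num)
    refine key k p hp h2 ?_
    have : (0:ℝ) ≤ (2/3)^k := by positivity
    linarith
  · obtain ⟨C, hC, h⟩ := PB_two Λ
    exact ⟨ofReal (p * 2^p / (p - 2)) * (C + 1), by finiteness, fun e K hK hd =>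
      Bdd.interp (isMax_DD e K) (by norm_num) h2 (h e K hK hd)⟩
theorem smear (v : Z2) (S D : ℕ) (h : EF) (y : Z2) :
    ∑ s ∈ Finset.Icc (-(S:ℤ)) S, h (y + s • v) ≤ ∑ s ∈ Finset.Icc (-((S+D:ℕ):ℤ)) (S+D:ℕ), bl v D h (y + s • v) := by
  have h1 : ∀ r ∈ Finset.Icc (-(D:ℤ)) D, ∑ s ∈ Finset.Icc (-(S:ℤ)) S, h (y + s • v) ≤
      ∑ s ∈ Finset.Icc (-((S+D:ℕ):ℤ)) (S+D:ℕ), h (y + s • v + r • v) := by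
    intro r hr
    have hr := Finset.mem_Icc.1 hr
    calc _ = ∑ s ∈ (Finset.Icc (-(S:ℤ)) S).image (fun s => s - r), h (y + s • v + r • v) := by
          rw [sum_image fun a _ b _ hab => by simpa using hab]
          refine sum_congr rfl fun s _ => ?_
          rw [add_assoc, ← add_smul, sub_add_cancel]
      _ ≤ _ := by
          refine sum_le_sum_of_subset fun t ht => ?_
          obtain ⟨s, hs, rfl⟩ := Finset.mem_image.1 ht
          have := Finset.mem_Icc.1 hs
          exact Finset.mem_Icc.2 (by push_cast; omega)
  have h2 := sum_le_sum h1
  rw [sum_const, Int.card_Icc, nsmul_eq_mul, show ((D:ℤ) + 1 - -(D:ℤ)).toNat = 2*D+1 by omega, sum_comm] at h2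
  simp only [bl]
  rw [← mul_sum]
  calc _ = ((2*D+1:ℕ):ENN)⁻¹ * (((2*D+1:ℕ):ENN) * ∑ s ∈ Finset.Icc (-(S:ℤ)) S, h (y + s • v)) := by
        rw [← mul_assoc, ENNReal.inv_mul_cancel (by simp) (by finiteness), one_mul]
    _ ≤ _ := mul_le_mul_right h2 _
def f0 (e : ℕ) (g : EF) : EF := fun y => g (y.1, y.2 / 2^e)
theorem transfer (e n L l : ℕ) (u : ℝ) (hu : |(n:ℝ) - u * 2^e| ≤ 1) (hL : L ≤ 2^e) (hL1 : 1 ≤ L) (hl1 : 1 ≤ l)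
    (P : Finset Z2) (hP : ∀ p ∈ P, |(p.1:ℝ)| ≤ L ∧ |(p.2:ℝ) - u * p.1| ≤ l) (g : EF) (y : Z2) :
    ∑ p ∈ P, g (y.1 + p.1, y.2 / 2^e + p.2) ≤ 27 * (L * l : ℕ) * Mv e2 (Dn e n (f0 e g)) y := by
  set D := 2^e with hD
  have hD0 : 0 < D := by positivity
  have hDz : (0:ℤ) < (2:ℤ)^e := by positivity
  have hDD : ((D:ℕ):ℤ) = (2:ℤ)^e := by simp [hD]
  set b : ℤ := y.2 % 2^e with hb
  have b0 : 0 ≤ b := Int.emod_nonneg _ hDz.ne'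
  have b1 : b < 2^e := Int.emod_lt_of_pos _ hDz
  have hy : 2^e * (y.2 / 2^e) + b = y.2 := Int.mul_ediv_add_emod _ _
  set Φ : Z2 × ℕ → ℤ × ℤ := fun z => (z.1.1, 2^e * z.1.2 + z.2 - b - z.1.1 * n) with hΦ
  set S := D * (l + 2) with hS
  have inj : Set.InjOn Φ (P ×ˢ Finset.range D : Finset (Z2 × ℕ)) := by
    rintro ⟨⟨t, v⟩, a⟩ h1 ⟨⟨t', v'⟩, a'⟩ h2 h
    simp only [hΦ, Prod.mk.injEq] at h
    obtain ⟨rfl, h⟩ := h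
    have a1 := Finset.mem_range.1 (Finset.mem_product.1 h1).2
    have a2 := Finset.mem_range.1 (Finset.mem_product.1 h2).2
    simp only at a1 a2
    have h3 : (2:ℤ)^e * v + a = 2^e * v' + a' := by linarith
    have hv : v = v' := by
      have := congrArg (· / (2:ℤ)^e) h3
      simp only [Int.mul_add_ediv_left _ _ hDz.ne'] at this
      rwa [Int.ediv_eq_zero_of_lt (by omega) (by rw [← hDD]; exact_mod_cast a1), Int.ediv_eq_zero_of_lt (by omega) (by rw [← hDD]; exact_mod_cast a2),
        add_zero, add_zero] at this
    subst hv
    simp only [Prod.mk.injEq, true_and]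
    omega
  have key : (D:ENN) * ∑ p ∈ P, g (y.1 + p.1, y.2 / 2^e + p.2) ≤
      ∑ t ∈ Finset.Icc (-(L:ℤ)) L, ∑ s ∈ Finset.Icc (-(S:ℤ)) S, f0 e g (y + t • zn n + s • e2) := by
    calc _ = ∑ z ∈ P ×ˢ Finset.range D, f0 e g (y + (Φ z).1 • zn n + (Φ z).2 • e2) := by
          rw [sum_product, mul_sum]
          refine sum_congr rfl fun p _ => ?_
          rw [sum_congr rfl (g := fun _ => g (y.1 + p.1, y.2 / 2^e + p.2)), sum_const, card_range, nsmul_eq_mul]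
          intro a ha
          have ha := Finset.mem_range.1 ha
          simp only [f0, zn, e1, e2, hΦ]
          congr 2
          · simp
          · have : (y + p.1 • (((1:ℤ), (0:ℤ)) + (n:ℤ) • ((0:ℤ), (1:ℤ))) + (2^e * p.2 + a - b - p.1 * n) • ((0:ℤ), (1:ℤ))).2 =
               2^e * (y.2 / 2^e + p.2) + a := by simp; linarith
            have h0 : (a:ℤ) / 2^e = 0 := Int.ediv_eq_zero_of_lt (by omega) (by rw [← hDD]; exact_mod_cast ha)
            rw [this, Int.mul_add_ediv_left _ _ hDz.ne', h0, add_zero]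
      _ = ∑ z ∈ (P ×ˢ Finset.range D).image Φ, f0 e g (y + z.1 • zn n + z.2 • e2) :=
          (sum_image (f := fun z : ℤ × ℤ => f0 e g (y + z.1 • zn n + z.2 • e2)) inj).symm
      _ ≤ ∑ z ∈ Finset.Icc (-(L:ℤ)) L ×ˢ Finset.Icc (-(S:ℤ)) S, f0 e g (y + z.1 • zn n + z.2 • e2) := by
          refine sum_le_sum_of_subset fun z hz => ?_
          obtain ⟨⟨⟨t, v⟩, a⟩, hw, rfl⟩ := Finset.mem_image.1 hz
          obtain ⟨hw1, hw2⟩ := Finset.mem_product.1 hw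
          obtain ⟨q1, q2⟩ := hP _ hw1
          have ha := Finset.mem_range.1 hw2
          simp only at q1 q2 ha
          rw [Finset.mem_product, Finset.mem_Icc, Finset.mem_Icc, ← abs_le, ← abs_le]
          refine ⟨by exact_mod_cast q1, ?_⟩
          have : |(((2:ℤ)^e * v + a - b - t * n : ℤ):ℝ)| ≤ ((S:ℤ):ℝ) := by
            have e1 : (((2:ℤ)^e * v + a - b - t * n : ℤ):ℝ) = 2^e * (v - u * t) + ((a:ℝ) - b) - t * (n - u * 2^e) := by push_cast; ring
            have a1 : (a:ℝ) ≤ 2^e := by exact_mod_cast ha.le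
            have b1' : (b:ℝ) ≤ 2^e := by exact_mod_cast b1.le
            have b0' : (0:ℝ) ≤ b := by exact_mod_cast b0
            have L1 : (L:ℝ) ≤ 2^e := by exact_mod_cast hL
            have a0 : (0:ℝ) ≤ a := by positivity
            have k1 : |(2:ℝ)^e * (v - u * t)| ≤ 2^e * l := by rw [abs_mul, abs_of_pos (by positivity)]; gcongr
            have k2 : |(a:ℝ) - b| ≤ 2^e := abs_le.2 ⟨by linarith, by linarith⟩
            have k3 : |(t:ℝ) * (n - u * 2^e)| ≤ 2^e := by
              rw [abs_mul]; calc _ ≤ (L:ℝ) * 1 := by gcongr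
                _ ≤ _ := by linarith
            have hSr : ((S:ℤ):ℝ) = 2^e * (l + 2) := by rw [hS, hD]; push_cast; ring
            rw [e1, hSr]
            calc _ ≤ _ := abs_sub _ _
              _ ≤ |(2:ℝ)^e * (v - u * t)| + |(a:ℝ) - b| + |(t:ℝ) * (n - u * 2^e)| := by gcongr; exact abs_add_le _ _
              _ ≤ _ := by linarith
          exact_mod_cast this
      _ = _ := sum_product _ _ _
  have hfin : (D:ENN) * ∑ p ∈ P, g (y.1 + p.1, y.2 / 2^e + p.2) ≤ D * (27 * (L * l : ℕ) * Mv e2 (Dn e n (f0 e g)) y) := by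
    refine key.trans ?_
    calc _ ≤ ∑ t ∈ Finset.Icc (-(L:ℤ)) L, ∑ s ∈ Finset.Icc (-((S+D:ℕ):ℤ)) (S+D:ℕ), bl e2 D (f0 e g) (y + t • zn n + s • e2) :=
          sum_le_sum fun t _ => smear _ _ _ _ _
      _ = ∑ s ∈ Finset.Icc (-((S+D:ℕ):ℤ)) (S+D:ℕ), ((2*L+1 : ℕ):ENN) * bl (zn n) L (bl e2 D (f0 e g)) (y + s • e2) := by
          rw [sum_comm]
          refine sum_congr rfl fun s _ => ?_
          rw [bl.eq_def (zn n), ← mul_assoc, ENNReal.mul_inv_cancel (by simp) (by finiteness), one_mul]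
          exact sum_congr rfl fun t _ => by rw [add_right_comm]
      _ ≤ ((2*L+1 : ℕ):ENN) * ∑ s ∈ Finset.Icc (-((S+D:ℕ):ℤ)) (S+D:ℕ), Dn e n (f0 e g) (y + s • e2) := by
          rw [mul_sum]; gcongr; exact le_Dn _ _ _ _ _
      _ ≤ ((2*L+1 : ℕ):ENN) * (((2*(S+D)+1 : ℕ):ENN) * Mv e2 (Dn e n (f0 e g)) y) := by
          gcongr; exact sum_le_Mv e2 _ y (S+D) _ fun t ht => by simpa using Finset.mem_Icc.1 ht
      _ ≤ _ := by
          rw [← mul_assoc, ← mul_assoc]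
          refine mul_le_mul_left ?_ _
          have : (2*L+1)*(2*(S+D)+1) ≤ D * (27 * (L*l)) := by
            have i1 : 2*L+1 ≤ 3*L := by omega
            have i2 : 2*(S+D)+1 ≤ D * (9*l) := by rw [hS]; nlinarith
            calc _ ≤ (3*L) * (D * (9*l)) := Nat.mul_le_mul i1 i2
              _ = _ := by ring
          exact_mod_cast this
  exact (ENNReal.mul_le_mul_iff_right (by simp [hD]) (by finiteness)).1 hfin
theorem cell (e : ℕ) (h : EF) : ∑' y : Z2, h (y.1, y.2 / 2^e) = 2^e * ∑' y, h y := by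
  rw [tsum_prod' (α := ℤ) (β := ℤ), tsum_prod' (α := ℤ) (β := ℤ), ← ENNReal.tsum_mul_left]
  refine tsum_congr fun x => ?_
  have : NeZero (2^e) := ⟨by positivity⟩
  rw [← ENNReal.tsum_mul_left]
  have h1 := (Int.divModEquiv (2^e)).tsum_eq (fun z : ℤ × Fin (2^e) => h (x, z.1))
  rw [tsum_prod'] at h1
  simp only [tsum_fintype, sum_const, card_univ, Fintype.card_fin, nsmul_eq_mul] at h1
  push_cast at h1
  rw [← h1]
  refine tsum_congr fun Y => ?_
  simp [Int.divModEquiv]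
theorem geo_aux (F : Set (ℝ × ℝ)) (c s u L l m1 m2 : ℝ) (hcs : c^2 + s^2 = 1) (hs : s = u * c) (hu : u ∈ Ioo (0:ℝ) 1)
    (hl : 8 ≤ l) (hlL : l ≤ L)
    (hF : ∀ q : ℝ × ℝ, q ∈ F ↔ |(q.1 - m1) * c + (q.2 - m2) * s| ≤ L/2 ∧ |-(q.1 - m1) * s + (q.2 - m2) * c| ≤ l/2)
    (h0 : ((0:ℝ),(0:ℝ)) ∈ F) : ∃ L' l' : ℕ, 1 ≤ L' ∧ 1 ≤ l' ∧ (latticePts F).Finite ∧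
      (∀ p ∈ latticePts F, |(p.1:ℝ)| ≤ L' ∧ |(p.2:ℝ) - u * p.1| ≤ l') ∧ L' * l' ≤ 288 * latticeCount F := by
  obtain ⟨u0, u1⟩ := hu
  have c1 : c^2 * (1 + u^2) = 1 := by rw [hs] at hcs; linarith
  have c2 : 1/2 ≤ c^2 := by nlinarith [mul_pos u0 u0, sq_nonneg c]
  have hL0 : 0 ≤ L := by linarith
  have c3 : 1/2 ≤ |c| := by rw [← abs_of_pos (by norm_num : (0:ℝ) < 1/2)]; exact sq_le_sq.1 (by linarith)
  have c4 : |c| ≤ 1 := by rw [← abs_one]; exact sq_le_sq.1 (by nlinarith [sq_nonneg s])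
  have s4 : |s| ≤ 1 := by rw [← abs_one]; exact sq_le_sq.1 (by nlinarith [sq_nonneg c])
  have cu : |c| * |u| = |s| := by rw [hs, abs_mul, mul_comm]
  have hc0 : c ≠ 0 := by rintro rfl; simp at c3; linarith
  have up : ∀ p ∈ latticePts F, |(p.1:ℝ)| ≤ 2 * L ∧ |(p.2:ℝ) - u * p.1| ≤ 2 * l := by
    intro p hp
    obtain ⟨a1, a2⟩ := (hF _).1 hp
    obtain ⟨b1, b2⟩ := (hF _).1 h0
    simp only at a1 a2 b1 b2
    rw [abs_le] at a1 a2 b1 b2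
    have d1 : |(p.1:ℝ) * c + p.2 * s| ≤ L := abs_le.2 ⟨by linarith, by linarith⟩
    have d2 : |-(p.1:ℝ) * s + p.2 * c| ≤ l := abs_le.2 ⟨by linarith, by linarith⟩
    constructor
    · have : (p.1:ℝ) = ((p.1:ℝ) * c + p.2 * s) * c - (-(p.1:ℝ) * s + p.2 * c) * s := by linear_combination (-(p.1:ℝ)) * hcs
      rw [this]
      calc _ ≤ |((p.1:ℝ) * c + p.2 * s) * c| + |(-(p.1:ℝ) * s + p.2 * c) * s| := abs_sub _ _
        _ ≤ L * 1 + l * 1 := by rw [abs_mul, abs_mul]; gcongr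
        _ ≤ _ := by linarith
    · have : ((p.2:ℝ) - u * p.1) * c = -(p.1:ℝ) * s + p.2 * c := by rw [hs]; ring
      rw [← this, abs_mul] at d2
      nlinarith [abs_nonneg ((p.2:ℝ) - u * p.1)]
  have low : ∀ p : Z2, |(p.1:ℝ) - m1| ≤ L/8 → |(p.2:ℝ) - m2 - u * (p.1 - m1)| ≤ l/4 → p ∈ latticePts F := by
    intro p h1 h2
    refine (hF _).2 ⟨?_, ?_⟩
    · have : ((p.1:ℝ) - m1) * c + (p.2 - m2) * s = (p.1 - m1) * (c * (1 + u^2)) + (p.2 - m2 - u * (p.1 - m1)) * s := by rw [hs]; ring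
      simp only
      rw [this]
      have c5 : |c * (1 + u^2)| ≤ 2 := by
        rw [abs_mul, abs_of_pos (by positivity : 0 < 1 + u^2)]
        have : |c| * (|c| * (1+u^2)) = 1 := by rw [← mul_assoc, ← sq, sq_abs, c1]
        nlinarith [mul_nonneg (abs_nonneg c) (by positivity : 0 ≤ 1 + u^2)]
      calc _ ≤ _ := abs_add_le _ _
        _ ≤ L/8 * 2 + l/4 * 1 := by rw [abs_mul (_ - m1), abs_mul _ s]; gcongr
        _ ≤ _ := by linarith
    · have : -((p.1:ℝ) - m1) * s + (p.2 - m2) * c = (p.2 - m2 - u * (p.1 - m1)) * c := by rw [hs]; ring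
      simp only
      rw [this, abs_mul]
      calc _ ≤ l/4 * 1 := by gcongr
        _ ≤ _ := by linarith
  have fin : (latticePts F).Finite := by
    refine ((Finset.Icc (-⌈2*L⌉) ⌈2*L⌉ ×ˢ Finset.Icc (-⌈2*l+2*L⌉) ⌈2*l+2*L⌉).finite_toSet).subset fun p hp => ?_
    obtain ⟨h1, h2⟩ := up p hp
    have h3 : |(p.2:ℝ)| ≤ 2*l+2*L := by
      calc _ = |((p.2:ℝ) - u * p.1) + u * p.1| := by rw [sub_add_cancel]
        _ ≤ _ := abs_add_le _ _
        _ ≤ 2*l + 1*(2*L) := by rw [abs_mul u, abs_of_pos u0]; gcongr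
        _ = _ := by ring
    have g : ∀ (x : ℤ) (A : ℝ), |(x:ℝ)| ≤ A → -⌈A⌉ ≤ x ∧ x ≤ ⌈A⌉ := fun x A h => by
      rw [← abs_le]; have : ((|x| : ℤ):ℝ) ≤ ⌈A⌉ := by push_cast; exact h.trans (Int.le_ceil _)
      exact_mod_cast this
    exact Finset.mem_coe.2 (Finset.mem_product.2 ⟨Finset.mem_Icc.2 (g _ _ h1), Finset.mem_Icc.2 (g _ _ h3)⟩)
  have cnt : ∀ A r : ℝ, 4 * r ≤ ((Finset.Icc ⌈A - 4*r⌉ ⌊A + 4*r⌋).card : ℝ) + 1 + (-4*r) := by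
    intro A r
    rw [Int.card_Icc]
    have h1 := Int.lt_floor_add_one (A + 4*r)
    have h2 := Int.ceil_lt_add_one (A - 4*r)
    have h3 : ((⌊A + 4*r⌋ + 1 - ⌈A - 4*r⌉ : ℤ):ℝ) ≤ ((⌊A + 4*r⌋ + 1 - ⌈A - 4*r⌉).toNat : ℤ) := by exact_mod_cast Int.self_le_toNat _
    push_cast at h3 ⊢
    linarith
  have lower : L * l / 32 ≤ (latticeCount F : ℝ) := by
    set S : Finset (Σ _ : ℤ, ℤ) := (Finset.Icc ⌈m1 - 4*(L/32)⌉ ⌊m1 + 4*(L/32)⌋).sigma fun x =>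
      Finset.Icc ⌈(m2 + u * (x - m1)) - 4*(l/16)⌉ ⌊(m2 + u * (x - m1)) + 4*(l/16)⌋ with hS
    have i1 : S.card ≤ latticeCount F := by
      rw [← Finset.card_image_of_injective S (f := fun z => ((z.1, z.2) : ℤ × ℤ)) (by
        rintro ⟨a, b⟩ ⟨a', b'⟩ h; simpa using h), latticeCount, ← Set.ncard_coe_finset]
      refine Set.ncard_le_ncard (fun p hp => ?_) fin
      obtain ⟨z, hz, rfl⟩ := Finset.mem_image.1 (Finset.mem_coe.1 hp)
      obtain ⟨z1, z2⟩ := Finset.mem_sigma.1 hz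
      rw [Finset.mem_Icc, Int.ceil_le, Int.le_floor] at z1 z2
      exact low _ (abs_le.2 ⟨by linarith, by linarith⟩) (abs_le.2 ⟨by simp only; linarith, by simp only; linarith⟩)
    have i2 : L * l / 32 ≤ (S.card : ℝ) := by
      rw [hS, Finset.card_sigma]; push_cast
      calc _ = (L/8) * (l/4) := by ring
        _ ≤ ((Finset.Icc ⌈m1 - 4*(L/32)⌉ ⌊m1 + 4*(L/32)⌋).card : ℝ) * (l/4) := by
            have := cnt m1 (L/32)
            gcongr; linarith
        _ = ∑ x ∈ Finset.Icc ⌈m1 - 4*(L/32)⌉ ⌊m1 + 4*(L/32)⌋, l/4 := by simp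
        _ ≤ _ := by
            refine sum_le_sum fun x _ => ?_
            have := cnt (m2 + u * (x - m1)) (l/16)
            linarith
    exact i2.trans (by exact_mod_cast i1)
  refine ⟨⌈2*L⌉₊, ⌈2*l⌉₊, Nat.one_le_iff_ne_zero.2 (Nat.ceil_pos.2 (by linarith)).ne', Nat.one_le_iff_ne_zero.2 (Nat.ceil_pos.2 (by linarith)).ne', fin,
    fun p hp => ⟨(up p hp).1.trans (Nat.le_ceil _), (up p hp).2.trans (Nat.le_ceil _)⟩, ?_⟩
  have h1 := (Nat.ceil_lt_add_one (by linarith : 0 ≤ 2*L)).le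
  have h2 := (Nat.ceil_lt_add_one (by linarith : 0 ≤ 2*l)).le
  have : ((⌈2*L⌉₊ * ⌈2*l⌉₊ : ℕ):ℝ) ≤ ((288 * latticeCount F : ℕ):ℝ) := by
    push_cast
    calc _ ≤ (3*L) * (3*l) := mul_le_mul (by linarith) (by linarith) (by positivity) (by linarith)
      _ ≤ _ := by linarith
  exact_mod_cast this
theorem geo (R : Rect) (u : ℝ) (hu : u ∈ Ioo (0:ℝ) 1) (h8 : 8 ≤ R.shortSide) (h0 : ((0:ℝ),(0:ℝ)) ∈ R.carrier) (hs : R.slope = u) :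
    ∃ L' l' : ℕ, 1 ≤ L' ∧ 1 ≤ l' ∧ (latticePts R.carrier).Finite ∧
      (∀ p ∈ latticePts R.carrier, |(p.1:ℝ)| ≤ L' ∧ |(p.2:ℝ) - u * p.1| ≤ l') ∧ L' * l' ≤ 288 * latticeCount R.carrier := by
  set c := Real.cos R.angle with hc
  set s := Real.sin R.angle with hs'
  have hcs : c^2 + s^2 = 1 := Real.cos_sq_add_sin_sq _
  have hF : ∀ q : ℝ × ℝ, q ∈ R.carrier ↔
      |(q.1 - (R.corner.1 + R.len1/2*c - R.len2/2*s)) * c + (q.2 - (R.corner.2 + R.len1/2*s + R.len2/2*c)) * s| ≤ R.len1/2 ∧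
      |-(q.1 - (R.corner.1 + R.len1/2*c - R.len2/2*s)) * s + (q.2 - (R.corner.2 + R.len1/2*s + R.len2/2*c)) * c| ≤ R.len2/2 := by
    intro q
    constructor
    · rintro ⟨a, b, ⟨a0, a1⟩, ⟨b0, b1⟩, rfl⟩
      simp only [Prod.fst_add, Prod.snd_add, Prod.smul_mk, smul_eq_mul, ← hc, ← hs']
      constructor
      · rw [show ∀ x y : ℝ, (x + a * c + b * -s - (x + R.len1/2*c - R.len2/2*s)) * c + (y + a * s + b * c - (y + R.len1/2*s + R.len2/2*c)) * s =
          (a - R.len1/2) * (c^2+s^2) from fun x y => by ring, hcs, abs_le]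
        constructor <;> linarith
      · rw [show ∀ x y : ℝ, -(x + a * c + b * -s - (x + R.len1/2*c - R.len2/2*s)) * s + (y + a * s + b * c - (y + R.len1/2*s + R.len2/2*c)) * c =
          (b - R.len2/2) * (c^2+s^2) from fun x y => by ring, hcs, abs_le]
        constructor <;> linarith
    · rintro ⟨h1, h2⟩
      rw [abs_le] at h1 h2
      have e1 : (q.1 - (R.corner.1 + R.len1/2*c - R.len2/2*s)) * c + (q.2 - (R.corner.2 + R.len1/2*s + R.len2/2*c)) * s =
        (q.1 - R.corner.1) * c + (q.2 - R.corner.2) * s - R.len1/2 := by linear_combination (-R.len1/2) * hcs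
      have e2 : -(q.1 - (R.corner.1 + R.len1/2*c - R.len2/2*s)) * s + (q.2 - (R.corner.2 + R.len1/2*s + R.len2/2*c)) * c =
        -(q.1 - R.corner.1) * s + (q.2 - R.corner.2) * c - R.len2/2 := by linear_combination (-R.len2/2) * hcs
      rw [e1] at h1; rw [e2] at h2
      refine ⟨(q.1 - R.corner.1) * c + (q.2 - R.corner.2) * s, -(q.1 - R.corner.1) * s + (q.2 - R.corner.2) * c,
        ⟨by linarith, by linarith⟩, ⟨by linarith, by linarith⟩, ?_⟩
      ext
      · simp only [Prod.fst_add, Prod.smul_mk, smul_eq_mul, ← hc, ← hs']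
        linear_combination (-(q.1 - R.corner.1)) * hcs
      · simp only [Prod.snd_add, Prod.smul_mk, smul_eq_mul, ← hc, ← hs']
        linear_combination (-(q.2 - R.corner.2)) * hcs
  rw [Rect.slope] at hs
  rw [Rect.shortSide, le_min_iff] at h8
  split_ifs at hs with h
  · have hc0 : c ≠ 0 := by
      intro h0
      rw [Real.tan_eq_sin_div_cos, ← hc, h0, div_zero] at hs
      exact hu.1.ne hs
    refine geo_aux _ c s u _ _ _ _ hcs ?_ hu h8.2 h hF h0
    rw [← hs, Real.tan_eq_sin_div_cos, ← hc, ← hs', div_mul_cancel₀ _ hc0]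
  · rw [Real.tan_eq_sin_div_cos, Real.sin_add_pi_div_two, Real.cos_add_pi_div_two, ← hc, ← hs'] at hs
    have hc0 : -s ≠ 0 := by
      intro h0
      rw [h0, div_zero] at hs
      exact hu.1.ne hs
    refine geo_aux _ (-s) c u R.len2 R.len1 (R.corner.1 + R.len1/2*c - R.len2/2*s) (R.corner.2 + R.len1/2*s + R.len2/2*c) (by rw [← hcs]; ring) (by rw [← hs, div_mul_cancel₀ _ hc0]) hu h8.1 (not_le.1 h).le (fun q => ?_) h0
    rw [hF q, and_comm]
    refine and_congr ?_ ?_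
    · rw [show ∀ x y : ℝ, -x * s + y * c = x * -s + y * c from fun x y => by ring]
    · rw [← abs_neg, show ∀ x y : ℝ, -(x * c + y * s) = -x * c + y * -s from fun x y => by ring]
theorem lac_sum (x : ℕ → ℝ) (x0 : ∀ k, 0 < x k) (l : ℝ) (hl : l ∈ Ioo (0:ℝ) 1) (hx : ∀ k, x (k+1) ≤ l * x k) (N : ℕ) :
    ∑ k ∈ Finset.range N, min (x k) (1 / x k) ≤ 4 / (1 - l) := by
  obtain ⟨l0, l1⟩ := hl
  have step : ∀ k, (1 - l) / 4 * min (x k) (1 / x k) ≤ 1 / (1 + x (k+1)) - 1 / (1 + x k) := by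
    intro k
    have hk := x0 k
    have h1 : min (x k) (1 / x k) ≤ 4 * (x k / (1 + x k)^2) := by
      rw [← mul_div_assoc, le_div_iff₀ (by positivity)]
      rcases le_total (x k) 1 with h | h
      · calc _ ≤ x k * (1 + x k)^2 := by gcongr; exact min_le_left _ _
          _ ≤ _ := by nlinarith [mul_nonneg hk.le (sub_nonneg.2 h)]
      · calc _ ≤ (1 / x k) * (1 + x k)^2 := by gcongr; exact min_le_right _ _
          _ ≤ _ := by
            rw [one_div, inv_mul_le_iff₀ hk]; nlinarith
    have h2 : 1 / (1 + l * x k) ≤ 1 / (1 + x (k+1)) := one_div_le_one_div_of_le (by have := x0 (k+1); linarith) (by linarith [hx k])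
    have h3 : (1 - l) * (x k / (1 + x k)^2) ≤ 1 / (1 + l * x k) - 1 / (1 + x k) := by
      have : 1 / (1 + l * x k) - 1 / (1 + x k) = (1 - l) * (x k / ((1 + x k) * (1 + l * x k))) := by
        field_simp; ring
      rw [this, sq]
      have : 0 ≤ 1 - l := by linarith
      gcongr
      nlinarith
    nlinarith
  have h := sum_le_sum fun k (_ : k ∈ Finset.range N) => step k
  rw [← mul_sum, Finset.sum_range_sub (fun k => 1 / (1 + x k))] at h
  have h4 : 1 / (1 + x N) ≤ 1 := by rw [div_le_one (by linarith [x0 N])]; linarith [x0 N]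
  have h5 : 0 < 1 / (1 + x 0) := by have := x0 0; positivity
  rw [le_div_iff₀ (by linarith)]
  linarith
theorem sparse_lac (u : ℕ → ℝ) (u0 : ∀ k, 0 < u k) (l : ℝ) (hl : l ∈ Ioo (0:ℝ) 1) (hx : ∀ k, u (k+1) ≤ l * u k) (N e : ℕ)
    (he : ∀ k < N, 1 ≤ u k * 2^e) : Sparse ((Finset.range N).image fun k => ⌈u k * 2^e⌉₊) (8 / (1 - l)) := by
  intro Q hQ
  refine (Finset.sum_image_le_of_nonneg fun n _ => by positivity).trans ?_
  have h := lac_sum (fun k => u k * 2^e / Q) (fun k => by have := u0 k; positivity) l hl (fun k => by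
    rw [← mul_div_assoc, ← mul_assoc]; gcongr; exact hx k) N
  calc _ ≤ ∑ k ∈ Finset.range N, 2 * min (u k * 2^e / Q) (1 / (u k * 2^e / Q)) := by
        refine sum_le_sum fun k hk => ?_
        have h1 := he k (Finset.mem_range.1 hk)
        have h2 := Nat.le_ceil (u k * 2^e)
        have h3 := (Nat.ceil_lt_add_one (by linarith : 0 ≤ u k * 2^e)).le
        have h4 : 0 < u k * 2^e := by linarith
        rw [mul_min_of_nonneg _ _ (by norm_num)]
        refine min_le_min ?_ ?_
        · rw [← mul_div_assoc]; gcongr; linarith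
        · rw [one_div_div]
          calc _ ≤ Q / (u k * 2^e) := by gcongr
            _ ≤ _ := by have : 0 ≤ Q / (u k * 2^e) := by positivity
                        linarith
    _ ≤ _ := by rw [← mul_sum]; calc _ ≤ 2 * (4 / (1-l)) := by gcongr
                  _ = _ := by ring
theorem ofReal_discAvg (R : Rect) (φ : Z2 → ℝ) (fin : (latticePts R.carrier).Finite) (q : Z2) (hc : latticeCount R.carrier ≠ 0) :
    ofReal (discAvg R (fun q => |φ q|) q) =
      (latticeCount R.carrier : ENN)⁻¹ * ∑ p ∈ fin.toFinset, ofReal |φ (q + p)| := by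
  rw [discAvg, finsum_mem_eq_finite_toFinset_sum _ fin, ofReal_mul (by positivity), ENNReal.ofReal_inv_of_pos (by positivity),
    ofReal_natCast, ofReal_sum_of_nonneg fun _ _ => abs_nonneg _]
  rfl
theorem lpSum_eq (φ : Z2 → ℝ) {p : ℝ} (hp : 0 < p) : lpSum φ p = ∑' q, ofReal |φ q| ^ p :=
  tsum_congr fun q => (ofReal_rpow_of_nonneg (abs_nonneg _) hp.le).symm
theorem single (R : Rect) {p : ℝ} (hp : 1 < p) (φ : Z2 → ℝ) :
    ∑' q, ofReal (discAvg R (fun q => |φ q|) q) ^ p ≤ lpSum φ p := by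
  by_cases hc : latticeCount R.carrier = 0
  · simp [discAvg, hc, show 0 < p by linarith]
  · have fin : (latticePts R.carrier).Finite := Set.finite_of_ncard_ne_zero hc
    rw [lpSum_eq φ (by linarith)]
    have := isAvg_finset fin.toFinset (fun p : Z2 => p) (latticeCount R.carrier : ENN)⁻¹ (by
      rw [latticeCount, Set.ncard_eq_toFinset_card _ fin]; exact ENNReal.inv_mul_le_one _)
    refine le_of_eq_of_le (tsum_congr fun q => ?_) (this.tsum_rpow_le hp.le (fun q => ofReal |φ q|))
    rw [ofReal_discAvg R φ fin q hc]
theorem avg_arith {c a : ℕ} (hc : c ≠ 0) (h : a ≤ 288 * c) {S W : ENN} (hS : S ≤ 27 * (a:ENN) * W) : (c:ENN)⁻¹ * S ≤ 7776 * W := by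
  calc _ ≤ (c:ENN)⁻¹ * (27 * ((288 * c : ℕ):ENN) * W) := by refine mul_le_mul_right (hS.trans ?_) _; gcongr
    _ = (c:ENN)⁻¹ * c * (7776 * W) := by push_cast; ring
    _ = _ := by rw [ENNReal.inv_mul_cancel (by exact_mod_cast hc) (by finiteness), one_mul]
theorem core_disc (R : ℕ → Rect) (h0 : ∀ n, ((0:ℝ),(0:ℝ)) ∈ (R n).carrier) (u : ℕ → ℝ) (hu : ∀ k, u k ∈ Ioo (0:ℝ) 1)
    (l : ℝ) (hl : l ∈ Ioo (0:ℝ) 1) (hx : ∀ k, u (k+1) ≤ l * u k) (hs : ∀ n, ∃ k, (R n).slope = u k) {p : ℝ} (hp : 1 < p) :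
    ∃ C : ENN, C ≠ ⊤ ∧ ∀ s : Finset ℕ, (∀ n ∈ s, 8 ≤ (R n).shortSide) → ∀ φ : Z2 → ℝ,
      ∑' q, (⨆ n ∈ s, ofReal (discAvg (R n) (fun q => |φ q|) q)) ^ p ≤ C * lpSum φ p := by
  have hp0 : 0 < p := by linarith
  obtain ⟨C, hC, hB⟩ := PB_all (8 / (1 - l)) hp
  refine ⟨7776^p * (2 * hlC p * C), ?_, ?_⟩
  · have := hlC_ne_top hp0.le
    have h2 : (7776:ENN)^p ≠ ⊤ := rpow_ne_top_of_nonneg hp0.le (by simp)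
    finiteness
  intro s h8 φ
  choose k hk using hs
  choose! L l' h1 h2 h3 h4 h5 using fun n hn => geo (R n) (u (k n)) (hu _) (h8 n hn) (h0 n) (hk n)
  set N := s.sup k + 1 with hN
  have hkN : ∀ n ∈ s, k n < N := fun n hn => Nat.lt_succ_of_le (le_sup hn)
  have ev : ∀ A : ℝ, ∀ᶠ e : ℕ in atTop, A ≤ (2:ℝ)^e := fun A => (tendsto_pow_atTop_atTop_of_one_lt (by norm_num)).eventually_ge_atTop A
  obtain ⟨e, he1, he2⟩ := (((Finset.eventually_all s).2 fun n _ => ev (L n)).and ((Finset.eventually_all (Finset.range N)).2 fun k _ => ev (1 / u k))).exists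
  have he2 : ∀ k < N, 1 ≤ u k * 2^e := fun k hk => by
    have := he2 k (Finset.mem_range.2 hk)
    rwa [div_le_iff₀ (hu k).1, mul_comm] at this
  set K := (Finset.range N).image fun k => ⌈u k * 2^e⌉₊ with hK
  have hb := hB e K (sparse_lac u (fun k => (hu k).1) l hl hx N e he2) (by
    intro n hn
    obtain ⟨k, hk, rfl⟩ := Finset.mem_image.1 hn
    have := he2 k (Finset.mem_range.1 hk)
    refine ⟨Nat.ceil_pos.2 (by linarith), Nat.ceil_le.2 ?_⟩
    push_cast
    have := (hu k).2
    have h2 : (0:ℝ) < 2^e := by positivity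
    nlinarith)
  set g : EF := fun q => ofReal |φ q| with hg
  set A : EF := fun q => ⨆ n ∈ s, ofReal (discAvg (R n) (fun q => |φ q|) q) with hA
  have pw : ∀ y : Z2, A (y.1, y.2 / 2^e) ≤ 7776 * M (DD e K (f0 e g)) y := by
    intro y
    refine iSup₂_le fun n hn => ?_
    have hc : latticeCount (R n).carrier ≠ 0 := by
      have := h5 n hn
      have := Nat.mul_pos (h1 n hn) (h2 n hn)
      omega
    have hn1 := he2 _ (hkN n hn)
    have t := transfer e ⌈u (k n) * 2^e⌉₊ (L n) (l' n) (u (k n)) (by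
      have h2 := Nat.le_ceil (u (k n) * 2^e)
      have h3 := (Nat.ceil_lt_add_one (by linarith : 0 ≤ u (k n) * 2^e)).le
      rw [abs_le]; constructor <;> linarith) (by exact_mod_cast he1 n hn) (h1 n hn) (h2 n hn) (h3 n hn).toFinset
      (fun p hp => h4 n hn p ((h3 n hn).mem_toFinset.1 hp)) g y
    rw [ofReal_discAvg _ φ (h3 n hn) _ hc]
    have hmem : ⌈u (k n) * 2^e⌉₊ ∈ K := Finset.mem_image.2 ⟨k n, Finset.mem_range.2 (hkN n hn), rfl⟩
    have hd : Dn e ⌈u (k n) * 2^e⌉₊ (f0 e g) ≤ DD e K (f0 e g) := fun z => le_DD e hmem (f0 e g) z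
    have hm : Mv e2 (Dn e ⌈u (k n) * 2^e⌉₊ (f0 e g)) y ≤ M (DD e K (f0 e g)) y := le_trans (dir_e2 _ y) (isMax_M.mono hd y)
    exact avg_arith hc (h5 n hn) (t.trans (mul_le_mul_right hm _))
  have fin : (2:ENN)^e * ∑' q, A q ^ p ≤ 2^e * (7776^p * (2 * hlC p * C) * lpSum φ p) := by
    calc _ = ∑' y : Z2, A (y.1, y.2 / 2^e) ^ p := (cell e fun q => A q ^ p).symm
      _ ≤ ∑' y, (7776 * M (DD e K (f0 e g)) y)^p := tsum_le_tsum fun y => rpow_le_rpow (pw y) hp0.le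
      _ = 7776^p * ∑' y, M (DD e K (f0 e g)) y ^ p := by
          rw [← ENNReal.tsum_mul_left]; exact tsum_congr fun y => mul_rpow_of_nonneg _ _ hp0.le
      _ ≤ 7776^p * (2 * hlC p * (C * ∑' y, f0 e g y ^ p)) := by
          gcongr; exact (M_bdd hp _).trans (mul_le_mul_right (hb _) _)
      _ = 7776^p * (2 * hlC p * (C * (2^e * lpSum φ p))) := by
          rw [lpSum_eq φ hp0, ← cell e fun q => ofReal |φ q| ^ p]; rfl
      _ = _ := by ring
  exact (ENNReal.mul_le_mul_iff_right (by simp) (by finiteness)).1 fin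
theorem root {a b C : ENN} {p : ℝ} (hp : 0 < p) (h : a ≤ C * b) : a ^ (1/p) ≤ C ^ (1/p) * b ^ (1/p) := by
  rw [← mul_rpow_of_nonneg _ _ (by positivity)]
  exact rpow_le_rpow h (by positivity)
end LacMax

/-- for a process with slopes in a lacunary subset of `(0,1)` converging
to `0` and `1 < p < ∞`, there are `N` and `C > 0` with
`‖A*_N φ‖_{ℓ^p} ≤ C ‖φ‖_{ℓ^p}`; consequently `A*` is of weak-type `(p,p)`. -/
theorem stmt18 (R : ℕ → Rect) (hR : IsProcess R)
    (u : ℕ → ℝ) (hu01 : ∀ k, u k ∈ Set.Ioo (0 : ℝ) 1)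
    (hlac : ∃ l ∈ Set.Ioo (0 : ℝ) 1, ∀ k, u (k + 1) ≤ l * u k)
    (hu0 : Tendsto u atTop (𝓝 0))
    (hslope : ∀ n, ∃ k, (R n).slope = u k)
    (p : ℝ) (hp : 1 < p) :
    (∃ N : ℕ, ∃ C : ℝ, 0 < C ∧ ∀ φ : ℤ × ℤ → ℝ, Memlp φ p →
        lpNormE (fun kl => discMaxOpFrom R N φ kl) p ≤ ENNReal.ofReal C * lpNorm φ p) ∧
      IsDiscWeakType (discMaxOp R) p := by
  have hp0 : 0 < p := by linarith
  obtain ⟨l, hl, hx⟩ := hlac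
  obtain ⟨C, hC, hB⟩ := LacMax.core_disc R hR.1 u hu01 l hl hx hslope hp
  obtain ⟨N, hN⟩ := eventually_atTop.1 (hR.2.eventually_ge_atTop 8)
  have main : ∀ φ : ℤ × ℤ → ℝ, ∑' q, discMaxOpFrom R N φ q ^ p ≤ C * lpSum φ p := by
    intro φ
    have h := LacMax.tsum_mono_lim hp0 (fun T q => ⨆ n ∈ Finset.Ico N T, ENNReal.ofReal (discAvg (R n) (fun q => |φ q|) q))
      (fun T T' hT q => biSup_mono fun n hn => by rw [Finset.mem_Ico] at *; omega)
      (fun T => hB (Finset.Ico N T) (fun n hn => hN n (Finset.mem_Ico.1 hn).1) φ)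
    refine le_trans (ENNReal.tsum_le_tsum fun q => ENNReal.rpow_le_rpow ?_ hp0.le) h
    refine iSup₂_le fun n hn => le_iSup_of_le (n+1) (le_iSup₂_of_le n (Finset.mem_Ico.2 ⟨hn, Nat.lt_succ_self n⟩) le_rfl)
  constructor
  · refine ⟨N, (C ^ (1/p)).toReal + 1, by positivity, fun φ _ => ?_⟩
    have h := LacMax.root hp0 (main φ)
    refine h.trans (mul_le_mul_left ?_ _)
    have : C ^ (1/p) ≠ ⊤ := ENNReal.rpow_ne_top_of_nonneg (by positivity) hC
    calc _ = ENNReal.ofReal (C ^ (1/p)).toReal := (ENNReal.ofReal_toReal this).symm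
      _ ≤ _ := ENNReal.ofReal_le_ofReal (by linarith)
  · refine ⟨(N + C).toReal + 1, by positivity, fun φ hφ lam hlam => ?_⟩
    have tot : ∑' q, discMaxOp R φ q ^ p ≤ (N + C) * lpSum φ p := by
      calc _ ≤ ∑' q, (∑ n ∈ Finset.range N, ENNReal.ofReal (discAvg (R n) (fun q => |φ q|) q) ^ p + discMaxOpFrom R N φ q ^ p) := by
            refine ENNReal.tsum_le_tsum fun q => ?_
            rw [← ENNReal.le_rpow_inv_iff hp0]
            refine iSup_le fun n => ?_
            rw [ENNReal.le_rpow_inv_iff hp0]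
            rcases lt_or_ge n N with h | h
            · exact le_add_right (Finset.single_le_sum (f := fun n => ENNReal.ofReal (discAvg (R n) (fun q => |φ q|) q) ^ p)
                (fun _ _ => by positivity) (Finset.mem_range.2 h))
            · exact le_add_left (ENNReal.rpow_le_rpow (le_iSup₂_of_le n h le_rfl) hp0.le)
        _ = ∑ n ∈ Finset.range N, ∑' q, ENNReal.ofReal (discAvg (R n) (fun q => |φ q|) q) ^ p + ∑' q, discMaxOpFrom R N φ q ^ p := by
            rw [ENNReal.tsum_add, Summable.tsum_finsetSum fun _ _ => ENNReal.summable]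
        _ ≤ ∑ n ∈ Finset.range N, lpSum φ p + C * lpSum φ p :=
            add_le_add (Finset.sum_le_sum fun n _ => LacMax.single (R n) hp φ) (main φ)
        _ = _ := by rw [Finset.sum_const, Finset.card_range, nsmul_eq_mul, add_mul]
    have hNC : (N + C : ℝ≥0∞) ≠ ⊤ := by finiteness
    have ch : ENNReal.ofReal lam ^ p * Measure.count {kl : ℤ × ℤ | ENNReal.ofReal lam ≤ discMaxOp R φ kl} ≤ (N + C) * lpSum φ p := by
      refine le_trans ?_ tot
      rw [← lintegral_count]
      refine le_trans ?_ (mul_meas_ge_le_lintegral (measurable_of_countable _) (ENNReal.ofReal lam ^ p))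
      exact mul_le_mul_right (measure_mono fun q h => ENNReal.rpow_le_rpow h hp0.le) _
    have hl0 : ENNReal.ofReal lam ^ p = ENNReal.ofReal (lam ^ p) := ENNReal.ofReal_rpow_of_pos hlam
    have hlp : 0 < lam ^ p := by positivity
    have hS : (lpNorm φ p).toReal ^ p = (lpSum φ p).toReal := by
      rw [ENNReal.toReal_rpow, _root_.lpNorm, ← ENNReal.rpow_mul, one_div_mul_cancel hp0.ne', ENNReal.rpow_one]
    rw [Real.div_rpow (by positivity) hlam.le, hS]
    calc _ ≤ (N + C) * lpSum φ p / ENNReal.ofReal (lam ^ p) := by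
          rw [ENNReal.le_div_iff_mul_le (by simp [hlp]) (by simp), mul_comm, ← hl0]; exact ch
      _ = ENNReal.ofReal ((N + C).toReal * ((lpSum φ p).toReal / lam ^ p)) := by
          rw [ENNReal.ofReal_mul (by positivity), ENNReal.ofReal_div_of_pos hlp, ENNReal.ofReal_toReal hNC, ENNReal.ofReal_toReal hφ.ne, mul_div_assoc]
      _ ≤ _ := ENNReal.ofReal_le_ofReal (by gcongr; linarith)

end
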